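/- For every θ ∈ (1/2, 1) there exists a Beurling generalized number system having θ-well-behaved integers (N(x) = Ax + O(x^θ) for some A > 0) with the following property: for every λ ∈ [4/5, 1) there exist sequences (x_K)_K and (h_K)_K of positive reals with x_K → ∞ and h_K ≍ x_K^λ such that limsup_{K→∞} (ψ(x_K + h_K) − ψ(x_K))/h_K > 1 and liminf_{K→∞} (ψ(x_K + h_K) − ψ(x_K))/h_K < 1. -/

import Mathlib

open Filter Topology

/-- A Beurling generalized prime number system: a nondecreasing sequence of
generalized primes, each `> 1`, tending to infinity. -/
structure BeurlingSystem where
  p : ℕ → ℝ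
  one_lt_p : ∀ k, 1 < p k
  p_mono : Monotone p
  p_tendsto : Filter.Tendsto p Filter.atTop Filter.atTop

namespace BeurlingSystem

variable (S : BeurlingSystem)

/-- The numerical value of a generalized integer, encoded as the finitely supported
vector of exponents of the generalized primes. -/
noncomputable def val (n : ℕ →₀ ℕ) : ℝ := n.prod fun k e => S.p k ^ e

/-- The integer counting function `N(x)`. -/
noncomputable def cnt (x : ℝ) : ℝ := (Set.ncard {n : ℕ →₀ ℕ | S.val n ≤ x} : ℝ)

/-- `χ(x, λ)`: the number of generalized integers within distance `λ` of `x`. -/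
noncomputable def chi (x lam : ℝ) : ℝ := (Set.ncard {n : ℕ →₀ ℕ | |x - S.val n| ≤ lam} : ℝ)

/-- The integers are `θ`-well-behaved with density `A` and implied constant `K₀`:
`N(x) = A x + O(x^θ)`. -/
def WellBehaved (A θ K₀ : ℝ) : Prop :=
  0 < A ∧ 0 ≤ θ ∧ θ < 1 ∧ 0 ≤ K₀ ∧ ∀ x : ℝ, 1 ≤ x → |S.cnt x - A * x| ≤ K₀ * x ^ θ

/-- `ζ` is (the unique) analytic continuation of the Beurling zeta function
to `{Re s > θ} \ {1}`. -/
def IsZeta (θ : ℝ) (ζ : ℂ → ℂ) : Prop :=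
  DifferentiableOn ℂ ζ {s : ℂ | θ < s.re ∧ s ≠ 1} ∧
  ∀ s : ℂ, 1 < s.re → ζ s = ∑' n : ℕ →₀ ℕ, (S.val n : ℂ) ^ (-s)

/-- The von Mangoldt function: `log p` on prime powers `p^m`, `0` otherwise. -/
noncomputable def vonMangoldt (n : ℕ →₀ ℕ) : ℝ :=
  ∑ k ∈ n.support, if n.support = {k} then Real.log (S.p k) else 0

/-- The Chebyshev function `ψ(x)`. -/
noncomputable def psi (x : ℝ) : ℝ :=
  ∑ᶠ n ∈ {n : ℕ →₀ ℕ | S.val n ≤ x}, S.vonMangoldt n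

end BeurlingSystem

/-- The generalized divisor function: the number of ordered pairs of generalized
integers whose formal product equals `n`. -/
noncomputable def gDivisor (n : ℕ →₀ ℕ) : ℝ :=
  (Set.ncard {q : (ℕ →₀ ℕ) × (ℕ →₀ ℕ) | q.1 + q.2 = n} : ℝ)

/-- The generalized Möbius function. -/
noncomputable def gMoebius (n : ℕ →₀ ℕ) : ℝ :=
  if ∀ k ∈ n.support, n k ≤ 1 then (-1 : ℝ) ^ n.support.card else 0

/-- The zero-counting function `N(α, T)` of the (continued) zeta function. -/
noncomputable def zeroCount (ζ : ℂ → ℂ) (α T : ℝ) : ℝ :=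
  (Set.ncard {ρ : ℂ | ζ ρ = 0 ∧ ρ ≠ 1 ∧ α ≤ ρ.re ∧ |ρ.im| ≤ T} : ℝ)

/-- The Volterra convolution of two functions on the real line. -/
noncomputable def conv (b c : ℝ → ℝ) (v : ℝ) : ℝ := ∫ w in (0 : ℝ)..v, b (v - w) * c w

lemma conv_comm (b c : ℝ → ℝ) : conv b c = conv c b := by
  funext v
  unfold conv
  have := intervalIntegral.integral_comp_sub_left (a := 0) (b := v) (fun w => b (v - w) * c w) v
  simp only [sub_sub_cancel, sub_self, sub_zero] at this
  rw [← this]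
  exact intervalIntegral.integral_congr fun w _ => mul_comm _ _

lemma conv_eq_mul_integral (b c : ℝ → ℝ) (v : ℝ) :
    conv b c v = v * ∫ s in (0 : ℝ)..1, b (v - v * s) * c (v * s) := by
  have := intervalIntegral.mul_integral_comp_mul_left (a := 0) (b := 1)
    (f := fun w => b (v - w) * c w) v
  simp only [mul_zero, mul_one] at this
  rw [conv, ← this]

lemma continuous_conv {b c : ℝ → ℝ} (hb : Continuous b) (hc : Continuous c) :
    Continuous (conv b c) := by
  have h : conv b c = fun v => v * ∫ s in (0 : ℝ)..1, b (v - v * s) * c (v * s) :=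
    funext fun v => conv_eq_mul_integral b c v
  rw [h]
  refine continuous_id.mul ?_
  refine intervalIntegral.continuous_parametric_intervalIntegral_of_continuous' ?_ 0 1
  fun_prop

section Algebra

variable {a b c : ℝ → ℝ}

lemma intervalIntegrable_conv (hb : Continuous b) (hc : Continuous c) (v x y : ℝ) :
    IntervalIntegrable (fun w => b (v - w) * c w) MeasureTheory.volume x y :=
  Continuous.intervalIntegrable (by fun_prop) _ _

lemma conv_add_right (hb : Continuous b) (ha : Continuous a) (hc : Continuous c) :
    conv b (a + c) = conv b a + conv b c := by
  funext v
  simp only [conv, Pi.add_apply, mul_add]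
  exact intervalIntegral.integral_add (intervalIntegrable_conv hb ha _ _ _)
    (intervalIntegrable_conv hb hc _ _ _)

lemma conv_sub_right (hb : Continuous b) (ha : Continuous a) (hc : Continuous c) :
    conv b (a - c) = conv b a - conv b c := by
  funext v
  simp only [conv, Pi.sub_apply, mul_sub]
  exact intervalIntegral.integral_sub (intervalIntegrable_conv hb ha _ _ _)
    (intervalIntegrable_conv hb hc _ _ _)

lemma conv_smul_right (b c : ℝ → ℝ) (r : ℝ) : conv b (r • c) = r • conv b c := by
  funext v
  simp only [conv, Pi.smul_apply, smul_eq_mul]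
  rw [← intervalIntegral.integral_const_mul]
  exact intervalIntegral.integral_congr fun w _ => by ring

lemma conv_sub_left (hb : Continuous b) (ha : Continuous a) (hc : Continuous c) :
    conv (a - c) b = conv a b - conv c b := by
  rw [conv_comm, conv_sub_right hb ha hc, conv_comm b a, conv_comm b c]

lemma conv_smul_left (b c : ℝ → ℝ) (r : ℝ) : conv (r • b) c = r • conv b c := by
  rw [conv_comm, conv_smul_right, conv_comm]

lemma integral_triangle_swap {F : ℝ → ℝ → ℝ} (hF : Continuous (Function.uncurry F)) {v : ℝ}
    (hv : 0 ≤ v) :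
    ∫ w in (0 : ℝ)..v, ∫ u in (0 : ℝ)..(v - w), F w u
      = ∫ u in (0 : ℝ)..v, ∫ w in (0 : ℝ)..(v - u), F w u := by
  have key : ∀ (G : ℝ → ℝ → ℝ), Continuous (Function.uncurry G) →
      ∫ w in (0 : ℝ)..v, ∫ u in (0 : ℝ)..(v - w), G w u
      = ∫ w in Set.Ioc 0 v, ∫ u in Set.Ioc 0 v,
          (if w + u ≤ v then G w u else 0) := by
    intro G hG
    rw [intervalIntegral.integral_of_le hv]
    refine MeasureTheory.setIntegral_congr_fun measurableSet_Ioc fun w hw => ?_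
    rw [intervalIntegral.integral_of_le (by linarith [hw.2])]
    rw [← MeasureTheory.integral_indicator measurableSet_Ioc,
      ← MeasureTheory.integral_indicator measurableSet_Ioc]
    congr 1
    funext u
    simp only [Set.indicator, Set.mem_Ioc]
    have := hw.1
    by_cases h1 : 0 < u <;> by_cases h2 : w + u ≤ v
    · rw [if_pos ⟨h1, by linarith⟩, if_pos ⟨h1, by linarith⟩, if_pos h2]
    · rw [if_neg (fun h => h2 (by linarith [h.2])), if_neg h2]
      simp
    · simp [h1]
    · simp [h1]
  rw [key F hF, key (fun w u => F u w) (hF.comp continuous_swap)]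
  rw [MeasureTheory.integral_integral_swap]
  · simp only [add_comm]
  · obtain ⟨C, hC⟩ := (isCompact_Icc (a := (0 : ℝ)) (b := v)).prod
      (isCompact_Icc (a := (0 : ℝ)) (b := v)) |>.exists_bound_of_continuousOn hF.continuousOn
    have hm : Measurable (Function.uncurry fun w u : ℝ => if w + u ≤ v then F w u else 0) := by
      refine Measurable.ite ?_ hF.measurable measurable_const
      exact measurableSet_le (by fun_prop) measurable_const
    rw [MeasureTheory.Measure.prod_restrict]
    refine MeasureTheory.Measure.integrableOn_of_bounded (M := |C|) ?_ hm.aestronglyMeasurable ?_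
    · rw [MeasureTheory.Measure.prod_prod]; simp [ENNReal.mul_eq_top]
    · refine (MeasureTheory.ae_restrict_iff'
        (measurableSet_Ioc.prod measurableSet_Ioc)).2 (MeasureTheory.ae_of_all _ ?_)
      rintro ⟨w, u⟩ ⟨hw, hu⟩
      simp only [Function.uncurry]
      split_ifs
      · exact (hC (w, u) ⟨Set.Ioc_subset_Icc_self hw, Set.Ioc_subset_Icc_self hu⟩).trans
          (le_abs_self C)
      · simp

lemma conv_reflect (b c : ℝ → ℝ) (v : ℝ) :
    conv b c (-v) = -conv (fun x => b (-x)) (fun x => c (-x)) v := by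
  unfold conv
  have := intervalIntegral.integral_comp_neg (a := 0) (b := v) (fun w => b (-v - w) * c w)
  simp only [neg_zero] at this
  rw [intervalIntegral.integral_symm, ← this]
  congr 1
  refine intervalIntegral.integral_congr fun w _ => ?_
  simp only
  congr 2
  ring

lemma conv_conv_swap_of_nonneg (ha : Continuous a) (hb : Continuous b) (hc : Continuous c)
    {v : ℝ} (hv : 0 ≤ v) : conv (conv a b) c v = conv (conv a c) b v := by
  have h : ∀ b c : ℝ → ℝ, conv (conv a b) c v
      = ∫ w in (0 : ℝ)..v, ∫ u in (0 : ℝ)..(v - w), a (v - w - u) * b u * c w := by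
    intro b c
    rw [conv]
    refine intervalIntegral.integral_congr fun w _ => ?_
    simp only [conv]
    rw [← intervalIntegral.integral_mul_const]
  rw [h, h, integral_triangle_swap (F := fun w u => a (v - w - u) * b u * c w)
    (by unfold Function.uncurry; fun_prop) hv]
  refine intervalIntegral.integral_congr fun w _ => ?_
  refine intervalIntegral.integral_congr fun u _ => ?_
  rw [show v - u - w = v - w - u by ring]
  ring

lemma conv_conv_swap (ha : Continuous a) (hb : Continuous b) (hc : Continuous c) :
    conv (conv a b) c = conv (conv a c) b := by
  funext v
  rcases le_total 0 v with hv | hv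
  · exact conv_conv_swap_of_nonneg ha hb hc hv
  · obtain ⟨u, rfl⟩ : ∃ u, v = -u := ⟨-v, by ring⟩
    rw [conv_reflect, conv_reflect]
    have h : ∀ b : ℝ → ℝ, (fun x => conv a b (-x))
        = (-1 : ℝ) • conv (fun x => a (-x)) (fun x => b (-x)) := fun b => by
      funext x
      rw [conv_reflect]; simp
    rw [h, h, conv_smul_left, conv_smul_left, Pi.smul_apply, Pi.smul_apply,
      conv_conv_swap_of_nonneg (by fun_prop) (by fun_prop) (by fun_prop) (by linarith)]

lemma conv_assoc (ha : Continuous a) (hb : Continuous b) (hc : Continuous c) :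
    conv (conv a b) c = conv a (conv b c) := by
  rw [conv_comm a (conv b c), conv_comm a b, conv_conv_swap hb ha hc]

lemma conv_left_comm (ha : Continuous a) (hb : Continuous b) (hc : Continuous c) :
    conv a (conv b c) = conv b (conv a c) := by
  rw [← conv_assoc ha hb hc, conv_comm a b, conv_assoc hb ha hc]

/-- Multiplication by the variable is a derivation for the convolution. -/
lemma mul_conv (hb : Continuous b) (hc : Continuous c) (v : ℝ) :
    v * conv b c v = conv (fun x => x * b x) c v + conv b (fun x => x * c x) v := by
  simp only [conv]
  rw [← intervalIntegral.integral_const_mul, ← intervalIntegral.integral_add]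
  · refine intervalIntegral.integral_congr fun w _ => ?_
    ring
  · exact Continuous.intervalIntegrable (by fun_prop) _ _
  · exact Continuous.intervalIntegrable (by fun_prop) _ _

lemma id_mul_conv (hb : Continuous b) (hc : Continuous c) :
    (fun v => v * conv b c v) = conv (fun x => x * b x) c + conv b (fun x => x * c x) :=
  funext fun v => mul_conv hb hc v

end Algebra

lemma conv_congr {b b' c c' : ℝ → ℝ} {v : ℝ} (hv : 0 ≤ v)
    (hb : ∀ x, 0 ≤ x → x ≤ v → b x = b' x) (hc : ∀ x, 0 ≤ x → x ≤ v → c x = c' x) :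
    conv b c v = conv b' c' v := by
  refine intervalIntegral.integral_congr fun w hw => ?_
  rw [Set.uIcc_of_le hv] at hw
  rw [hb _ (by linarith [hw.2]) (by linarith [hw.1]), hc w hw.1 hw.2]

/-- Integrals of a Lipschitz function against a rapidly oscillating cosine are small. -/
lemma abs_integral_cos_mul_le {F : ℝ → ℝ} {K M γ φ a b : ℝ} (hγ : 0 < γ) (hab : a ≤ b)
    (hF : Continuous F) (hK : ∀ x y, |F x - F y| ≤ K * |x - y|) (hM : ∀ x, |F x| ≤ M) :
    |∫ z in a..b, Real.cos (γ * z + φ) * F z| ≤ Real.pi / γ * (K * (b - a) / 2 + M) := by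
  set δ := Real.pi / γ with hδ
  have hδ0 : 0 < δ := by positivity
  have hγδ : γ * δ = Real.pi := by rw [hδ]; field_simp
  set f : ℝ → ℝ := fun z => Real.cos (γ * z + φ) * F z with hf
  have hfc : Continuous f := by rw [hf]; fun_prop
  have hii : ∀ x y, IntervalIntegrable f MeasureTheory.volume x y :=
    fun x y => hfc.intervalIntegrable _ _
  have hfM : ∀ z, ‖f z‖ ≤ M := by
    intro z
    rw [Real.norm_eq_abs, hf, abs_mul]
    calc |Real.cos (γ * z + φ)| * |F z| ≤ 1 * M :=
          mul_le_mul (Real.abs_cos_le_one _) (hM z) (abs_nonneg _) zero_le_one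
      _ = M := one_mul M
  have hshift : ∫ z in a..b, f (z + δ) = ∫ z in (a + δ)..(b + δ), f z :=
    intervalIntegral.integral_comp_add_right f δ
  have hfs : ∀ z, f (z + δ) = -(Real.cos (γ * z + φ) * F (z + δ)) := by
    intro z
    simp only [hf]
    rw [show γ * (z + δ) + φ = γ * z + φ + Real.pi by rw [mul_add, hγδ]; ring, Real.cos_add_pi]
    ring
  have h2 : ∫ z in a..b, (f z + f (z + δ)) =
      (∫ z in a..b, f z) + ∫ z in a..b, f (z + δ) :=
    intervalIntegral.integral_add (hii _ _)
      (Continuous.intervalIntegrable (by fun_prop) _ _)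
  have hsplit1 : (∫ z in a..(a + δ), f z) + ∫ z in (a + δ)..(b + δ), f z
      = ∫ z in a..(b + δ), f z := intervalIntegral.integral_add_adjacent_intervals (hii _ _) (hii _ _)
  have hsplit2 : (∫ z in a..b, f z) + ∫ z in b..(b + δ), f z
      = ∫ z in a..(b + δ), f z := intervalIntegral.integral_add_adjacent_intervals (hii _ _) (hii _ _)
  have hA : |∫ z in a..b, (f z + f (z + δ))| ≤ K * δ * (b - a) := by
    have := intervalIntegral.norm_integral_le_of_norm_le_const (a := a) (b := b) (C := K * δ)
      (f := fun z => f z + f (z + δ)) ?_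
    · rwa [Real.norm_eq_abs, abs_of_nonneg (sub_nonneg.2 hab)] at this
    · intro z _
      rw [hfs, hf, Real.norm_eq_abs]
      simp only
      rw [← sub_eq_add_neg, ← mul_sub, abs_mul]
      have h3 := hK z (z + δ)
      rw [sub_add_cancel_left, abs_neg, abs_of_pos hδ0] at h3
      calc _ ≤ 1 * (K * δ) :=
          mul_le_mul (Real.abs_cos_le_one _) h3 (abs_nonneg _) zero_le_one
        _ = _ := one_mul _
  have hB1 : |∫ z in a..(a + δ), f z| ≤ M * δ := by
    have := intervalIntegral.norm_integral_le_of_norm_le_const (a := a) (b := a + δ) (C := M)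
      (f := f) (fun z _ => hfM z)
    rwa [Real.norm_eq_abs, add_sub_cancel_left, abs_of_pos hδ0] at this
  have hB2 : |∫ z in b..(b + δ), f z| ≤ M * δ := by
    have := intervalIntegral.norm_integral_le_of_norm_le_const (a := b) (b := b + δ) (C := M)
      (f := f) (fun z _ => hfM z)
    rwa [Real.norm_eq_abs, add_sub_cancel_left, abs_of_pos hδ0] at this
  have hfin : 2 * (∫ z in a..b, f z) = (∫ z in a..b, (f z + f (z + δ)))
      + (∫ z in a..(a + δ), f z) - ∫ z in b..(b + δ), f z := by
    rw [h2, hshift]; linarith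
  rw [abs_le] at hA hB1 hB2 ⊢
  constructor <;> nlinarith

/-- Induction along a delay of length one. -/
lemma delay_induction {P : ℝ → Prop} (h0 : ∀ v ≤ 0, P v)
    (h : ∀ v, (∀ w ≤ v - 1, P w) → P v) (v : ℝ) : P v := by
  have key : ∀ n : ℕ, ∀ v : ℝ, v ≤ n → P v := by
    intro n
    induction n with
    | zero => intro v hv; exact h0 v (by simpa using hv)
    | succ n ih =>
      intro v hv
      refine h v fun w hw => ih w ?_
      push_cast at hv
      linarith
  obtain ⟨n, hn⟩ := exists_nat_ge v
  exact key n v hn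

lemma conv_eq_zero_of_le {κ g : ℝ → ℝ} {l l' : ℝ} (hκ : ∀ z ≤ l, κ z = 0)
    (hg : ∀ z ≤ l', g z = 0) {v : ℝ} (hv : v ≤ l + l') : conv κ g v = 0 := by
  unfold conv
  rw [intervalIntegral.integral_congr (g := fun _ => (0 : ℝ)), intervalIntegral.integral_zero]
  intro w hw
  simp only
  rcases le_total (v - w) l with h | h
  · rw [hκ _ h, zero_mul]
  · rw [hg w (by linarith), mul_zero]

lemma conv_eq_zero_of_le_left {κ : ℝ → ℝ} {l : ℝ} (hκ : ∀ z ≤ l, κ z = 0) (g : ℝ → ℝ)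
    (hl : 0 ≤ l) {v : ℝ} (hv : v ≤ l) : conv κ g v = 0 := by
  unfold conv
  rw [intervalIntegral.integral_congr (g := fun _ => (0 : ℝ)), intervalIntegral.integral_zero]
  intro w hw
  simp only
  rw [hκ, zero_mul]
  rcases le_total 0 v with h | h
  · rw [Set.uIcc_of_le h] at hw; linarith [hw.1]
  · rw [Set.uIcc_of_ge h] at hw; linarith [hw.1]

/-- The delayed Volterra equation `H = g + κ * H` has a continuous solution. -/
lemma exists_delay_solution {κ g : ℝ → ℝ} (hκ : Continuous κ) (hg : Continuous g)
    (hκ0 : ∀ z ≤ 1, κ z = 0) (hg0 : ∀ z ≤ 0, g z = 0) :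
    ∃ H : ℝ → ℝ, Continuous H ∧ H = g + conv κ H := by
  let T : ℕ → ℝ → ℝ := fun m => (conv κ)^[m] g
  have hTs : ∀ m, T (m + 1) = conv κ (T m) := fun m => Function.iterate_succ_apply' _ _ _
  have hTc : ∀ m, Continuous (T m) := by
    intro m
    induction m with
    | zero => exact hg
    | succ m ih => rw [hTs]; exact continuous_conv hκ ih
  have hT0 : ∀ m : ℕ, ∀ z : ℝ, z ≤ m → T m z = 0 := by
    intro m
    induction m with
    | zero => intro z hz; exact hg0 z (by simpa using hz)
    | succ m ih =>
      intro z hz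
      rw [hTs]
      refine conv_eq_zero_of_le hκ0 ih ?_
      push_cast at hz
      linarith
  let H : ℝ → ℝ := fun v => ∑ m ∈ Finset.range ⌈v⌉₊, T m v
  have hH : ∀ (N : ℕ) (v : ℝ), v ≤ N → H v = ∑ m ∈ Finset.range N, T m v := by
    intro N v hv
    refine Finset.sum_subset ?_ ?_
    · exact Finset.range_mono (Nat.ceil_le.2 hv)
    · intro m _ hm
      refine hT0 m v ?_
      simpa [Nat.ceil_le] using hm
  have hHc : Continuous H := by
    rw [continuous_iff_continuousAt]
    intro v
    obtain ⟨N, hN⟩ := exists_nat_gt v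
    have hc : Continuous fun v => ∑ m ∈ Finset.range N, T m v :=
      continuous_finsetSum _ fun m _ => hTc m
    refine hc.continuousAt.congr ?_
    filter_upwards [Iio_mem_nhds hN] with w hw
    exact (hH N w (le_of_lt hw)).symm
  refine ⟨H, hHc, ?_⟩
  have hsum : ∀ N : ℕ, (∑ m ∈ Finset.range (N + 1), T m)
      = g + conv κ (∑ m ∈ Finset.range N, T m) := by
    intro N
    induction N with
    | zero =>
      have : conv κ 0 = 0 := by funext v; simp [conv]
      simp [this, T]
    | succ N ih =>
      have e : conv κ (∑ m ∈ Finset.range (N + 1), T m)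
          = conv κ (∑ m ∈ Finset.range N, T m) + conv κ (T N) := by
        rw [Finset.sum_range_succ, conv_add_right hκ _ (hTc N)]
        have := continuous_finsetSum (Finset.range N) fun m _ => hTc m
        convert this using 1
        funext v
        simp
      rw [e, Finset.sum_range_succ, ih, hTs, add_assoc]
  funext v
  obtain ⟨N, hN⟩ := exists_nat_ge v
  rw [hH (N + 1) v (by push_cast; linarith)]
  have h1 := congrFun (hsum N) v
  rw [Finset.sum_apply] at h1
  rw [h1, Pi.add_apply, Pi.add_apply]
  congr 1
  rcases le_total v 0 with hv | hv
  · rw [conv_eq_zero_of_le_left hκ0 _ zero_le_one (by linarith),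
      conv_eq_zero_of_le_left hκ0 _ zero_le_one (by linarith)]
  · refine conv_congr hv (fun _ _ _ => rfl) fun x _ hx => ?_
    rw [hH N x (by linarith), Finset.sum_apply]

/-- Pointwise bound for a convolution with a kernel supported in `[l, 3 * l]`. -/
lemma abs_conv_le_of_support {κ g : ℝ → ℝ} {l B v : ℝ} (hl : 0 ≤ l) (hκc : Continuous κ)
    (hg : Continuous g) (hB : 0 ≤ B)
    (hκ : ∀ z ≤ l, κ z = 0) (hκ3 : ∀ z, 3 * l ≤ z → κ z = 0)
    (h : ∀ z, l ≤ z → z ≤ 3 * l → z ≤ v → |κ z * g (v - z)| ≤ B) :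
    |conv κ g v| ≤ 2 * l * B := by
  rcases le_total v l with hv | hv
  · rw [conv_eq_zero_of_le_left hκ g hl hv, abs_zero]; positivity
  · rw [conv_comm, conv]
    have hii : ∀ x y, IntervalIntegrable (fun w => g (v - w) * κ w) MeasureTheory.volume x y :=
      intervalIntegrable_conv hg hκc v
    set m := min v (3 * l) with hm
    have hlm : l ≤ m := le_min hv (by linarith)
    rw [← intervalIntegral.integral_add_adjacent_intervals (hii 0 l) (hii l v),
      ← intervalIntegral.integral_add_adjacent_intervals (hii l m) (hii m v)]
    have h1 : ∫ w in (0 : ℝ)..l, g (v - w) * κ w = 0 := by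
      rw [intervalIntegral.integral_congr (g := fun _ => (0 : ℝ)), intervalIntegral.integral_zero]
      intro w hw
      rw [Set.uIcc_of_le hl] at hw
      simp [hκ w hw.2]
    have h2 : ∫ w in m..v, g (v - w) * κ w = 0 := by
      rcases le_total v (3 * l) with h3 | h3
      · rw [hm, min_eq_left h3, intervalIntegral.integral_same]
      · rw [intervalIntegral.integral_congr (g := fun _ => (0 : ℝ)),
          intervalIntegral.integral_zero]
        intro w hw
        rw [Set.uIcc_of_le (min_le_left _ _), hm, min_eq_right h3] at hw
        simp [hκ3 w hw.1]
    rw [h1, h2, zero_add, add_zero]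
    have := intervalIntegral.norm_integral_le_of_norm_le_const (a := l) (b := m) (C := B)
      (f := fun w => g (v - w) * κ w) ?_
    · rw [Real.norm_eq_abs, abs_of_nonneg (sub_nonneg.2 hlm)] at this
      refine this.trans ?_
      rw [mul_comm]
      refine mul_le_mul_of_nonneg_right ?_ hB
      have := min_le_right v (3 * l)
      linarith
    · intro w hw
      rw [Set.uIoc_of_le hlm] at hw
      rw [Real.norm_eq_abs, mul_comm]
      exact h w hw.1.le (hw.2.trans (min_le_right _ _)) (hw.2.trans (min_le_left _ _))

lemma abs_integral_le_of_abs_le_const {f : ℝ → ℝ} {a b C : ℝ}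
    (h : ∀ x ∈ Set.uIoc a b, |f x| ≤ C) : |∫ x in a..b, f x| ≤ C * |b - a| := by
  have := intervalIntegral.norm_integral_le_of_norm_le_const (f := f) h
  rwa [Real.norm_eq_abs] at this

/-- A small tent function supported in `[1, 3]`. -/
noncomputable def tent (z : ℝ) : ℝ := 1 / 100 * max 0 (1 - |z - 2|)

lemma continuous_tent : Continuous tent := by unfold tent; fun_prop

lemma tent_nonneg (z : ℝ) : 0 ≤ tent z := by unfold tent; positivity

lemma tent_le (z : ℝ) : tent z ≤ 1 / 100 := by
  unfold tent
  have : max 0 (1 - |z - 2|) ≤ 1 := max_le zero_le_one (by linarith [abs_nonneg (z - 2)])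
  linarith

lemma tent_eq_zero_of_le {z : ℝ} (hz : z ≤ 1) : tent z = 0 := by
  unfold tent
  rw [max_eq_left, mul_zero]
  rw [abs_of_nonpos (by linarith)]; linarith

lemma tent_eq_zero_of_ge {z : ℝ} (hz : 3 ≤ z) : tent z = 0 := by
  unfold tent
  rw [max_eq_left, mul_zero]
  rw [abs_of_nonneg (by linarith)]; linarith

lemma abs_tent_sub_le (x y : ℝ) : |tent x - tent y| ≤ 1 / 100 * |x - y| := by
  unfold tent
  rw [← mul_sub, abs_mul, abs_of_pos (by norm_num : (0 : ℝ) < 1 / 100)]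
  refine mul_le_mul_of_nonneg_left ?_ (by norm_num)
  have h1 := abs_max_sub_max_le_abs (1 - |x - 2|) (1 - |y - 2|) 0
  rw [max_comm, max_comm (1 - |y - 2|) 0] at h1
  refine h1.trans ?_
  have h2 := abs_abs_sub_abs_le_abs_sub (y - 2) (x - 2)
  calc _ = |(|y - 2| - |x - 2|)| := by congr 1; ring
    _ ≤ |y - 2 - (x - 2)| := h2
    _ = |x - y| := by rw [abs_sub_comm]; congr 1; ring

lemma tent_two : tent 2 = 1 / 100 := by unfold tent; norm_num

/-- The oscillating kernel at scale `l` and frequency `γ`. -/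
noncomputable def kernel (l γ : ℝ) (z : ℝ) : ℝ := 2 * Real.cos (γ * z) * tent (z / l) / l

lemma continuous_kernel (l γ : ℝ) : Continuous (kernel l γ) := by
  have := continuous_tent
  unfold kernel; fun_prop

section Kernel

variable {l γ : ℝ}

lemma kernel_eq_zero_of_le (hl : 0 < l) {z : ℝ} (hz : z ≤ l) : kernel l γ z = 0 := by
  unfold kernel
  rw [tent_eq_zero_of_le ((div_le_one hl).2 hz)]; simp

lemma kernel_eq_zero_of_ge (hl : 0 < l) {z : ℝ} (hz : 3 * l ≤ z) : kernel l γ z = 0 := by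
  unfold kernel
  rw [tent_eq_zero_of_ge ((le_div_iff₀ hl).2 hz)]; simp

lemma abs_kernel_le (hl : 0 < l) (z : ℝ) : |kernel l γ z| ≤ 1 / 50 / l := by
  unfold kernel
  rw [abs_div, abs_of_pos hl]
  refine div_le_div_of_nonneg_right ?_ hl.le
  rw [abs_mul, abs_mul, abs_of_nonneg (tent_nonneg _), abs_of_pos (by norm_num : (0 : ℝ) < 2)]
  have h1 := Real.abs_cos_le_one (γ * z)
  have h2 := tent_le (z / l)
  have h3 := tent_nonneg (z / l)
  nlinarith [abs_nonneg (Real.cos (γ * z))]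

lemma abs_conv_kernel_le (hl : 0 < l) {g : ℝ → ℝ} (hg : Continuous g) {B v : ℝ} (hB : 0 ≤ B)
    (h : ∀ z, l ≤ z → z ≤ 3 * l → z ≤ v → |g (v - z)| ≤ B) :
    |conv (kernel l γ) g v| ≤ B / 25 := by
  have := abs_conv_le_of_support (κ := kernel l γ) (g := g) (v := v) hl.le
    (continuous_kernel l γ) hg
    (B := 1 / 50 / l * B) (by positivity) (fun z hz => kernel_eq_zero_of_le hl hz)
    (fun z hz => kernel_eq_zero_of_ge hl hz) ?_
  · refine this.trans (le_of_eq ?_)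
    field_simp
    ring
  · intro z h1 h2 h3
    rw [abs_mul]
    exact mul_le_mul (abs_kernel_le hl z) (h z h1 h2 h3) (abs_nonneg _) (by positivity)

/-- The prime-side response to the kernel. -/
lemma exists_response (hl : 1 ≤ l) (γ : ℝ) :
    ∃ H : ℝ → ℝ, Continuous H ∧ H = (fun z => z * kernel l γ z) + conv (kernel l γ) H ∧
      (∀ v ≤ l, H v = 0) ∧ (∀ v, 0 < v → |H v| ≤ 1 / 4 * (l / v)) ∧ ∀ v, |H v| ≤ 1 / 4 := by
  have hl0 : 0 < l := by linarith
  have hk := continuous_kernel l γ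
  obtain ⟨H, hHc, hH⟩ := exists_delay_solution (κ := kernel l γ)
    (g := fun z => z * kernel l γ z) hk (by fun_prop)
    (fun z hz => kernel_eq_zero_of_le hl0 (by linarith))
    (fun z hz => by simp [kernel_eq_zero_of_le hl0 (show z ≤ l by linarith)])
  have hHz : ∀ v ≤ l, H v = 0 := by
    intro v hv
    rw [hH, Pi.add_apply, kernel_eq_zero_of_le hl0 hv,
      conv_eq_zero_of_le_left (fun z hz => kernel_eq_zero_of_le hl0 hz) _ hl0.le hv]
    simp
  have hb : ∀ v, 0 < v → |H v| ≤ 1 / 4 * (l / v) := by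
    intro v
    refine delay_induction (P := fun v => 0 < v → |H v| ≤ 1 / 4 * (l / v)) ?_ ?_ v
    · intro v hv hv'; linarith
    · intro v ih hv
      rcases le_total v l with hvl | hvl
      · rw [hHz v hvl, abs_zero]; positivity
      have h1 : |v * kernel l γ v| ≤ 9 / 50 * (l / v) := by
        rcases le_total v (3 * l) with h3 | h3
        · rw [abs_mul, abs_of_pos hv]
          calc v * |kernel l γ v| ≤ v * (1 / 50 / l) :=
                mul_le_mul_of_nonneg_left (abs_kernel_le hl0 v) hv.le
            _ ≤ 9 / 50 * (l / v) := by
              rw [← sub_nonneg]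
              have : 9 / 50 * (l / v) - v * (1 / 50 / l)
                  = 1 / 50 * ((3 * l - v) * (3 * l + v)) / (l * v) := by field_simp; ring
              rw [this]
              have : 0 ≤ 3 * l - v := by linarith
              positivity
        · rw [kernel_eq_zero_of_ge hl0 h3]; simp; positivity
      have h2 : |conv (kernel l γ) H v| ≤ l / v / 25 := by
        refine abs_conv_kernel_le hl0 hHc (by positivity) fun z hz1 hz2 hz3 => ?_
        rcases le_total (v - z) l with h4 | h4
        · rw [hHz _ h4, abs_zero]; positivity
        · refine (ih (v - z) (by linarith) (by linarith)).trans ?_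
          have h5 : v / 4 ≤ v - z := by linarith
          have h6 : 0 < v - z := by linarith
          have : l / (v - z) ≤ l / (v / 4) := div_le_div_of_nonneg_left hl0.le (by linarith) h5
          calc 1 / 4 * (l / (v - z)) ≤ 1 / 4 * (l / (v / 4)) := by linarith
            _ = l / v := by field_simp
      have h7 : H v = v * kernel l γ v + conv (kernel l γ) H v := congrFun hH v
      rw [h7]
      have h8 : 0 ≤ l / v := by positivity
      linarith [abs_add_le (v * kernel l γ v) (conv (kernel l γ) H v)]
  refine ⟨H, hHc, hH, hHz, hb, fun v => ?_⟩
  rcases le_total v l with hvl | hvl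
  · rw [hHz v hvl, abs_zero]; norm_num
  · refine (hb v (by linarith)).trans ?_
    have : l / v ≤ 1 := (div_le_one (by linarith)).2 hvl
    linarith

end Kernel

/-- The limiting profile of the response at unit scale. -/
lemma exists_profile : ∃ G : ℝ → ℝ, Continuous G ∧ G = (fun z => z * tent z) + conv tent G ∧
    (∀ v, 0 ≤ G v) ∧ (∀ v, G v ≤ 1) ∧ (∀ v w, |G v - G w| ≤ |v - w|) ∧
    ∀ m : ℕ, 0 < G (2 * (m + 1)) := by
  have ht := continuous_tent
  obtain ⟨G, hGc, hG⟩ := exists_delay_solution (κ := tent)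
    (g := fun z => z * tent z) ht (by fun_prop)
    (fun z hz => tent_eq_zero_of_le hz)
    (fun z hz => by simp [tent_eq_zero_of_le (show z ≤ 1 by linarith)])
  have hGv : ∀ v, G v = v * tent v + conv tent G v := fun v => congrFun hG v
  have hGz : ∀ v ≤ 1, G v = 0 := by
    intro v hv
    rw [hGv, tent_eq_zero_of_le hv,
      conv_eq_zero_of_le_left (fun z hz => tent_eq_zero_of_le hz) _ zero_le_one hv]
    simp
  have hrep : ∀ v, conv tent G v = ∫ z in (1 : ℝ)..3, tent z * G (v - z) := by
    intro v
    have hcont : Continuous fun z => tent z * G (v - z) := by fun_prop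
    have hii : ∀ x y, IntervalIntegrable (fun z => tent z * G (v - z)) MeasureTheory.volume x y :=
      fun x y => hcont.intervalIntegrable _ _
    have hz : ∀ x y, (∀ z ∈ Set.uIcc x y, tent z * G (v - z) = 0) →
        ∫ z in x..y, tent z * G (v - z) = 0 := by
      intro x y h
      rw [intervalIntegral.integral_congr (g := fun _ => (0 : ℝ)) h,
        intervalIntegral.integral_zero]
    have e : conv tent G v = ∫ z in (0 : ℝ)..v, tent z * G (v - z) := by
      rw [conv_comm, conv]
      exact intervalIntegral.integral_congr fun w _ => mul_comm _ _
    rw [e]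
    have e1 : ∫ z in (0 : ℝ)..1, tent z * G (v - z) = 0 := by
      refine hz _ _ fun z hz => ?_
      rw [Set.uIcc_of_le zero_le_one] at hz
      rw [tent_eq_zero_of_le hz.2, zero_mul]
    have e2 : ∫ z in v..3, tent z * G (v - z) = 0 := by
      refine hz _ _ fun z hz => ?_
      rcases le_total v 3 with h | h
      · rw [Set.uIcc_of_le h] at hz
        rw [hGz _ (by linarith [hz.1]), mul_zero]
      · rw [Set.uIcc_of_ge h] at hz
        rw [tent_eq_zero_of_ge hz.1, zero_mul]
    have := intervalIntegral.integral_add_adjacent_intervals (hii 0 1) (hii 1 3)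
    have := intervalIntegral.integral_add_adjacent_intervals (hii 0 v) (hii v 3)
    linarith
  have hnn : ∀ v, 0 ≤ G v := by
    refine delay_induction (fun v hv => (hGz v (by linarith)).ge) fun v ih => ?_
    rcases le_total v 1 with hv | hv
    · exact (hGz v hv).ge
    rw [hGv, hrep]
    refine add_nonneg (mul_nonneg (by linarith) (tent_nonneg v)) ?_
    refine intervalIntegral.integral_nonneg (by norm_num) fun z hz => ?_
    exact mul_nonneg (tent_nonneg _) (ih _ (by linarith [hz.1]))
  have hle : ∀ v, G v ≤ 1 := by
    refine delay_induction (fun v hv => by rw [hGz v (by linarith)]; norm_num) fun v ih => ?_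
    have h1 : v * tent v ≤ 3 / 100 := by
      rcases le_total v 1 with hv | hv
      · rw [tent_eq_zero_of_le hv]; norm_num
      rcases le_total v 3 with hv3 | hv3
      · nlinarith [tent_le v, tent_nonneg v]
      · rw [tent_eq_zero_of_ge hv3]; norm_num
    have h2 : |∫ z in (1 : ℝ)..3, tent z * G (v - z)| ≤ 1 / 100 * |(3 : ℝ) - 1| := by
      refine abs_integral_le_of_abs_le_const fun z hz => ?_
      rw [Set.uIoc_of_le (by norm_num)] at hz
      rw [abs_of_nonneg (mul_nonneg (tent_nonneg _) (hnn _))]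
      calc tent z * G (v - z) ≤ 1 / 100 * 1 :=
            mul_le_mul (tent_le z) (ih _ (by linarith [hz.1])) (hnn _) (by norm_num)
        _ = _ := by norm_num
    rw [hGv, hrep]
    have := le_of_abs_le h2
    norm_num at this
    linarith
  have hlip : ∀ v w, w ≤ v → |G v - G w| ≤ |v - w| := by
    refine delay_induction (fun v hv w hw => ?_) fun v ih w hw => ?_
    · rw [hGz v (by linarith), hGz w (by linarith)]; simp
    have hgl : |v * tent v - w * tent w| ≤ 4 / 100 * |v - w| := by
      have hcases : ∀ v w : ℝ, |w| ≤ 3 → |v * tent v - w * tent w| ≤ 4 / 100 * |v - w| := by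
        intro v w hw
        rw [show v * tent v - w * tent w = (v - w) * tent v + w * (tent v - tent w) by ring]
        refine (abs_add_le _ _).trans ?_
        rw [abs_mul, abs_mul, abs_of_nonneg (tent_nonneg _)]
        nlinarith [tent_le v, abs_tent_sub_le v w, abs_nonneg (v - w), abs_nonneg w,
          mul_le_mul hw (abs_tent_sub_le v w) (abs_nonneg _) (by norm_num)]
      by_cases h3 : |w| ≤ 3
      · exact hcases v w h3
      by_cases h4 : |v| ≤ 3
      · have := hcases w v h4
        rwa [abs_sub_comm, abs_sub_comm w v] at this
      · have ht0 : ∀ x : ℝ, ¬ |x| ≤ 3 → tent x = 0 := by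
          intro x hx
          push Not at hx
          rcases lt_abs.1 hx with h | h
          · exact tent_eq_zero_of_ge h.le
          · exact tent_eq_zero_of_le (by linarith)
        rw [ht0 v h4, ht0 w h3]
        simp
    have hcl : |conv tent G v - conv tent G w| ≤ 1 / 100 * |v - w| * |(3 : ℝ) - 1| := by
      rw [hrep, hrep, ← intervalIntegral.integral_sub
        (Continuous.intervalIntegrable (by fun_prop) _ _)
        (Continuous.intervalIntegrable (by fun_prop) _ _)]
      refine abs_integral_le_of_abs_le_const fun z hz => ?_
      rw [Set.uIoc_of_le (by norm_num)] at hz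
      rw [← mul_sub, abs_mul, abs_of_nonneg (tent_nonneg _)]
      have := ih (v - z) (by linarith [hz.1]) (w - z) (by linarith)
      rw [sub_sub_sub_cancel_right] at this
      exact mul_le_mul (tent_le z) this (abs_nonneg _) (by norm_num)
    rw [hGv, hGv w]
    rw [show v * tent v + conv tent G v - (w * tent w + conv tent G w)
      = (v * tent v - w * tent w) + (conv tent G v - conv tent G w) by ring]
    refine (abs_add_le _ _).trans ?_
    norm_num at hcl
    linarith [abs_nonneg (v - w)]
  refine ⟨G, hGc, hG, hnn, hle, fun v w => ?_, fun m => ?_⟩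
  · rcases le_total w v with h | h
    · exact hlip v w h
    · rw [abs_sub_comm, abs_sub_comm v w]; exact hlip w v h
  · induction m with
    | zero =>
      rw [hGv, hrep]
      have : 0 ≤ ∫ z in (1 : ℝ)..3, tent z * G (2 * ((0 : ℕ) + 1) - z) :=
        intervalIntegral.integral_nonneg (by norm_num) fun z _ =>
          mul_nonneg (tent_nonneg _) (hnn _)
      have h2 : tent (2 * ((0 : ℕ) + 1)) = 1 / 100 := by rw [← tent_two]; norm_num
      rw [h2]
      norm_num at this ⊢
      linarith
    | succ m ih =>
      rw [hGv, hrep]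
      refine add_pos_of_nonneg_of_pos (mul_nonneg (by positivity) (tent_nonneg _)) ?_
      refine intervalIntegral.integral_pos (by norm_num) (by fun_prop)
        (fun z _ => mul_nonneg (tent_nonneg _) (hnn _)) ⟨2, by norm_num, ?_⟩
      rw [tent_two]
      rw [show (2 * (((m + 1 : ℕ) : ℝ) + 1) - 2) = 2 * (m + 1) by push_cast; ring]
      positivity

section Approximation

variable {l γ : ℝ} {G H : ℝ → ℝ}

lemma conv_kernel_oscillation (hl : 1 ≤ l) (hGc : Continuous G) (v : ℝ) :
    conv (kernel l γ) (fun w => 2 * Real.cos (γ * w) * G (w / l)) v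
      = 2 * Real.cos (γ * v) * conv tent G (v / l)
        + ∫ w in (0 : ℝ)..v, Real.cos (2 * γ * w + -(γ * v)) *
            (2 / l * (tent ((v - w) / l) * G (w / l))) := by
  have hl0 : l ≠ 0 := by positivity
  have ht := continuous_tent
  have h1 : conv tent G (v / l) = ∫ w in (0 : ℝ)..v, tent ((v - w) / l) * G (w / l) / l := by
    have := intervalIntegral.integral_comp_div (a := 0) (b := v)
      (fun w => tent (v / l - w) * G w) hl0
    rw [zero_div] at this
    rw [intervalIntegral.integral_div, conv]
    simp only [← sub_div] at this
    rw [this, smul_eq_mul]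
    field_simp
  rw [h1, ← intervalIntegral.integral_const_mul, ← intervalIntegral.integral_add
    (Continuous.intervalIntegrable (by fun_prop) _ _)
    (Continuous.intervalIntegrable (by fun_prop) _ _), conv]
  refine intervalIntegral.integral_congr fun w _ => ?_
  simp only [kernel]
  have h2 : 2 * Real.cos (γ * (v - w)) * Real.cos (γ * w)
      = Real.cos (γ * v) + Real.cos (2 * γ * w + -(γ * v)) := by
    rw [Real.two_mul_cos_mul_cos, add_comm, ← Real.cos_neg (γ * (v - w) - γ * w)]
    congr 2 <;> ring
  calc _ = 2 * (2 * Real.cos (γ * (v - w)) * Real.cos (γ * w)) *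
        (tent ((v - w) / l) * G (w / l)) / l := by ring
    _ = _ := by rw [h2]; ring

lemma abs_response_sub_le (hl : 1 ≤ l) (hγ : 0 < γ) (hGc : Continuous G)
    (hG : G = (fun z => z * tent z) + conv tent G) (hG0 : ∀ v, 0 ≤ G v) (hG1 : ∀ v, G v ≤ 1)
    (hGl : ∀ v w, |G v - G w| ≤ |v - w|) (hHc : Continuous H)
    (hH : H = (fun z => z * kernel l γ z) + conv (kernel l γ) H) (hHz : ∀ v ≤ l, H v = 0)
    {V v : ℝ} (hV : 0 ≤ V) (hvV : v ≤ V) :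
    |H v - 2 * Real.cos (γ * v) * G (v / l)| ≤ 2 * (Real.pi / γ * (V / 2 + 1)) := by
  have hl0 : 0 < l := by linarith
  have ht := continuous_tent
  have hGz : ∀ v ≤ 1, G v = 0 := by
    intro v hv
    rw [hG, Pi.add_apply, tent_eq_zero_of_le hv,
      conv_eq_zero_of_le_left (fun z hz => tent_eq_zero_of_le hz) _ zero_le_one hv]
    simp
  set P : ℝ → ℝ := fun w => 2 * Real.cos (γ * w) * G (w / l) with hP
  have hPc : Continuous P := by rw [hP]; fun_prop
  set Q : ℝ → ℝ := fun v => ∫ w in (0 : ℝ)..v, Real.cos (2 * γ * w + -(γ * v)) *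
            (2 / l * (tent ((v - w) / l) * G (w / l))) with hQ
  have hPeq : ∀ v, P v = v * kernel l γ v + conv (kernel l γ) P v - Q v := by
    intro v
    have h1 : conv (kernel l γ) P v = _ := conv_kernel_oscillation (γ := γ) hl hGc v
    rw [h1]
    simp only [hP]
    rw [congrFun hG (v / l), Pi.add_apply, kernel]
    ring
  set E := Real.pi / γ * (V / 2 + 1) with hE
  have hE0 : 0 ≤ E := by have := Real.pi_pos; positivity
  have hQb : ∀ v, 0 ≤ v → v ≤ V → |Q v| ≤ E := by
    intro v hv hvV
    have := abs_integral_cos_mul_le (F := fun w => 2 / l * (tent ((v - w) / l) * G (w / l)))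
      (K := 1) (M := 1) (γ := 2 * γ) (φ := -(γ * v)) (by positivity) hv (by fun_prop) ?_ ?_
    · refine this.trans ?_
      rw [hE, sub_zero, one_mul]
      refine mul_le_mul ?_ (by linarith) (by positivity) (by have := Real.pi_pos; positivity)
      exact div_le_div_of_nonneg_left Real.pi_pos.le hγ (by linarith)
    · intro x y
      have h1 := abs_tent_sub_le ((v - x) / l) ((v - y) / l)
      have h2 := hGl (x / l) (y / l)
      rw [show (v - x) / l - (v - y) / l = (y - x) / l by ring, abs_div, abs_of_pos hl0,
        abs_sub_comm y x] at h1
      rw [← sub_div, abs_div, abs_of_pos hl0] at h2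
      have h3 : |x - y| / l ≤ |x - y| := div_le_self (abs_nonneg _) hl
      rw [show 2 / l * (tent ((v - x) / l) * G (x / l)) - 2 / l * (tent ((v - y) / l) * G (y / l))
        = 2 / l * ((tent ((v - x) / l) - tent ((v - y) / l)) * G (x / l)
          + tent ((v - y) / l) * (G (x / l) - G (y / l))) by ring, abs_mul,
          abs_of_pos (by positivity)]
      have h4 : 2 / l ≤ 2 := div_le_self (by norm_num) hl
      have h5 : |(tent ((v - x) / l) - tent ((v - y) / l)) * G (x / l)
          + tent ((v - y) / l) * (G (x / l) - G (y / l))| ≤ 2 / 100 * |x - y| := by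
        refine (abs_add_le _ _).trans ?_
        rw [abs_mul, abs_mul, abs_of_nonneg (hG0 _), abs_of_nonneg (tent_nonneg _)]
        have h6 := mul_le_mul (h1.trans (mul_le_mul_of_nonneg_left h3 (by norm_num)))
          (hG1 (x / l)) (hG0 _) (by positivity)
        have h7 := mul_le_mul (tent_le ((v - y) / l)) (h2.trans h3) (abs_nonneg _) (by norm_num)
        linarith
      calc _ ≤ 2 * (2 / 100 * |x - y|) := mul_le_mul h4 h5 (abs_nonneg _) (by norm_num)
        _ ≤ 1 * |x - y| := by linarith [abs_nonneg (x - y)]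
    · intro x
      rw [abs_of_nonneg (by have := tent_nonneg ((v - x) / l); have := hG0 (x / l); positivity)]
      have h4 : 2 / l ≤ 2 := div_le_self (by norm_num) hl
      have h5 := mul_le_mul (tent_le ((v - x) / l)) (hG1 (x / l)) (hG0 _) (by norm_num)
      have h6 := mul_le_mul h4 h5 (mul_nonneg (tent_nonneg _) (hG0 _)) (by norm_num)
      linarith
  have key : ∀ v, v ≤ V → |H v - P v| ≤ 2 * E := by
    refine delay_induction ?_ ?_
    · intro v hv _
      rw [hHz v (by linarith), hP]
      simp only
      rw [hGz _ ((div_le_one hl0).2 (by linarith))]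
      simp
      exact hE0
    · intro v ih hvV
      rcases lt_or_ge v 0 with hv | hv
      · rw [hHz v (by linarith), hP]
        simp only
        rw [hGz _ ((div_le_one hl0).2 (by linarith))]
        simp
        exact hE0
      have h1 : H v - P v = conv (kernel l γ) (H - P) v + Q v := by
        rw [hPeq v, congrFun hH v, conv_sub_right (continuous_kernel l γ) hHc hPc]
        simp only [Pi.add_apply, Pi.sub_apply]
        ring
      have h2 : |conv (kernel l γ) (H - P) v| ≤ 2 * E / 25 := by
        refine abs_conv_kernel_le hl0 (hHc.sub hPc) (by positivity) fun z hz1 _ _ => ?_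
        exact ih (v - z) (by linarith) (by linarith)
      rw [h1]
      linarith [abs_add_le (conv (kernel l γ) (H - P) v) (Q v), hQb v hv hvV]
  exact key v hvV

end Approximation

/-- One modification step of the density: properties of `n - κ * n`. -/
lemma density_step {l M a : ℝ} (hl : 1 ≤ l) (hM : 1 ≤ M) (hlM : 8 * l * M ≤ Real.exp (2 * l))
    {n : ℝ → ℝ} (hn : Continuous n) (hnM : ∀ x, |n x| ≤ M)
    (hnL : ∀ x y, |n x - n y| ≤ M * |x - y|) (hna : ∀ x, l ≤ x → n x = a) :
    let γ := Real.exp (4 * l)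
    let n' := n - conv (kernel l γ) n
    Continuous n' ∧ (∀ x, |n' x| ≤ 2 * M) ∧ (∀ x y, |n' x - n' y| ≤ 2 * M * |x - y|) ∧
      (∀ x, x ≤ l → n' x = n x) ∧ (∀ x, |n' x - n x| ≤ Real.exp (-2 * l)) ∧
      ∀ x, 4 * l ≤ x → n' x = n' (4 * l) := by
  intro γ n'
  have hl0 : 0 < l := by linarith
  have ht := continuous_tent
  have hk := continuous_kernel l γ
  have hkz : ∀ z ≤ l, kernel l γ z = 0 := fun z hz => kernel_eq_zero_of_le hl0 hz
  have hc : Continuous (conv (kernel l γ) n) := continuous_conv hk hn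
  have hcz : ∀ x ≤ l, conv (kernel l γ) n x = 0 := fun x hx =>
    conv_eq_zero_of_le_left hkz _ hl0.le hx
  have hcb : ∀ x, |conv (kernel l γ) n x| ≤ M / 25 := fun x =>
    abs_conv_kernel_le hl0 hn (by linarith) fun z _ _ _ => hnM _
  have hmin : ∀ v, 0 ≤ v → conv (kernel l γ) n v
      = ∫ z in (0 : ℝ)..(min v (3 * l)), kernel l γ z * n (v - z) := by
    intro v hv
    have hii : ∀ x y, IntervalIntegrable (fun z => kernel l γ z * n (v - z))
        MeasureTheory.volume x y := fun x y => Continuous.intervalIntegrable (by fun_prop) _ _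
    have e : conv (kernel l γ) n v = ∫ z in (0 : ℝ)..v, kernel l γ z * n (v - z) := by
      rw [conv_comm, conv]
      exact intervalIntegral.integral_congr fun w _ => mul_comm _ _
    rw [e]
    rcases le_total v (3 * l) with h3 | h3
    · rw [min_eq_left h3]
    · rw [min_eq_right h3, ← intervalIntegral.integral_add_adjacent_intervals
        (hii 0 (3 * l)) (hii (3 * l) v)]
      rw [intervalIntegral.integral_congr (a := 3 * l) (b := v) (g := fun _ => (0 : ℝ)),
          intervalIntegral.integral_zero, add_zero]
      intro w hw
      rw [Set.uIcc_of_le h3] at hw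
      simp [kernel_eq_zero_of_ge hl0 hw.1]
  refine ⟨hn.sub hc, fun x => ?_, ?_, fun x hx => ?_, fun x => ?_, fun x hx => ?_⟩
  · have h1 : n' x = n x - conv (kernel l γ) n x := rfl
    rw [h1]
    linarith [abs_sub (n x) (conv (kernel l γ) n x), hcb x, hnM x]
  · have hnn : ∀ v w, 0 ≤ v → v ≤ w →
        |conv (kernel l γ) n w - conv (kernel l γ) n v| ≤ M * |w - v| := by
      intro v w hv hvw
      have e : ∀ v : ℝ, conv (kernel l γ) n v = ∫ z in (0 : ℝ)..v, kernel l γ z * n (v - z) := by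
        intro v
        rw [conv_comm, conv]
        exact intervalIntegral.integral_congr fun w _ => mul_comm _ _
      have h1 : conv (kernel l γ) n w - conv (kernel l γ) n v
          = conv (kernel l γ) (fun x => n (x + (w - v)) - n x) v
            + ∫ z in v..w, kernel l γ z * n (w - z) := by
        have h2 : conv (kernel l γ) (fun x => n (x + (w - v)) - n x) v
            = ∫ z in (0 : ℝ)..v, (kernel l γ z * n (w - z) - kernel l γ z * n (v - z)) := by
          rw [conv_comm, conv]
          refine intervalIntegral.integral_congr fun z _ => ?_
          rw [show v - z + (w - v) = w - z by ring]
          ring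
        rw [h2, e, e, intervalIntegral.integral_sub
          (Continuous.intervalIntegrable (by fun_prop) _ _)
          (Continuous.intervalIntegrable (by fun_prop) _ _)]
        have := intervalIntegral.integral_add_adjacent_intervals (a := 0) (b := v) (c := w)
          (f := fun z => kernel l γ z * n (w - z)) (μ := MeasureTheory.volume)
          (Continuous.intervalIntegrable (by fun_prop) _ _)
          (Continuous.intervalIntegrable (by fun_prop) _ _)
        linarith
      rw [h1]
      have h3 : |conv (kernel l γ) (fun x => n (x + (w - v)) - n x) v| ≤ M * |w - v| / 25 := by
        refine abs_conv_kernel_le hl0 (by fun_prop) (by positivity) fun z _ _ _ => ?_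
        have := hnL (v - z + (w - v)) (v - z)
        rwa [add_sub_cancel_left] at this
      have h4 : |∫ z in v..w, kernel l γ z * n (w - z)| ≤ 1 / 50 * M * |w - v| := by
        refine abs_integral_le_of_abs_le_const fun z _ => ?_
        rw [abs_mul]
        refine mul_le_mul ((abs_kernel_le hl0 z).trans ?_) (hnM _) (abs_nonneg _) (by norm_num)
        exact div_le_self (by norm_num) hl
      have h5 : 0 ≤ M * |w - v| := by positivity
      linarith [abs_add_le (conv (kernel l γ) (fun x => n (x + (w - v)) - n x) v)
        (∫ z in v..w, kernel l γ z * n (w - z))]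
    have hall : ∀ v w, v ≤ w →
        |conv (kernel l γ) n w - conv (kernel l γ) n v| ≤ M * |w - v| := by
      intro v w hvw
      rcases le_total 0 v with hv | hv
      · exact hnn v w hv hvw
      · rw [hcz v (by linarith)]
        rcases le_total w 0 with hw | hw
        · rw [hcz w (by linarith)]; simp; positivity
        · have := hnn 0 w le_rfl hw
          rw [hcz 0 (by linarith)] at this
          refine this.trans (mul_le_mul_of_nonneg_left ?_ (by linarith))
          rw [abs_of_nonneg (by linarith), abs_of_nonneg (by linarith)]
          linarith
    intro x y
    have h1 : n' x - n' y = (n x - n y) - (conv (kernel l γ) n x - conv (kernel l γ) n y) := by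
      simp only [n', Pi.sub_apply]; ring
    have h2 : |conv (kernel l γ) n x - conv (kernel l γ) n y| ≤ M * |x - y| := by
      rcases le_total x y with h | h
      · rw [abs_sub_comm, abs_sub_comm x y]; exact hall x y h
      · exact hall y x h
    rw [h1]
    linarith [abs_sub (n x - n y) (conv (kernel l γ) n x - conv (kernel l γ) n y), hnL x y]
  · simp only [n', Pi.sub_apply, hcz x hx, sub_zero]
  · simp only [n', Pi.sub_apply]
    rw [sub_sub_cancel_left, abs_neg]
    rcases lt_or_ge x 0 with hx | hx
    · rw [hcz x (by linarith), abs_zero]; positivity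
    rw [hmin x hx]
    have h0 : 0 ≤ min x (3 * l) := le_min hx (by linarith)
    have := abs_integral_cos_mul_le (F := fun z => 2 / l * (tent (z / l) * n (x - z)))
      (K := M) (M := M) (γ := γ) (φ := 0) (Real.exp_pos _) h0 (by fun_prop) ?_ ?_
    · have e : ∫ z in (0 : ℝ)..(min x (3 * l)), kernel l γ z * n (x - z)
          = ∫ z in (0 : ℝ)..(min x (3 * l)),
            Real.cos (γ * z + 0) * (2 / l * (tent (z / l) * n (x - z))) := by
        refine intervalIntegral.integral_congr fun z _ => ?_
        simp only [kernel, add_zero]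
        ring
      rw [e]
      refine this.trans ?_
      have h5 : M * (min x (3 * l) - 0) / 2 + M ≤ 5 / 2 * (l * M) := by
        have := min_le_right x (3 * l)
        have h6 : M * (min x (3 * l)) ≤ M * (3 * l) := mul_le_mul_of_nonneg_left this (by linarith)
        nlinarith
      have h7 : Real.pi ≤ 3.2 := by have := Real.pi_lt_d2; norm_num at this ⊢; linarith
      have h8 : Real.exp (-2 * l) = Real.exp (2 * l) / Real.exp (4 * l) := by
        rw [← Real.exp_sub]; congr 1; ring
      rw [h8, div_mul_eq_mul_div]
      refine div_le_div_of_nonneg_right ?_ (Real.exp_pos _).le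
      have h9 : 0 ≤ M * (min x (3 * l) - 0) / 2 + M := by
        rw [sub_zero]; positivity
      calc _ ≤ 3.2 * (5 / 2 * (l * M)) := mul_le_mul h7 h5 h9 (by norm_num)
        _ = 8 * l * M := by ring
        _ ≤ _ := hlM
    · intro u y
      have h1 := abs_tent_sub_le (u / l) (y / l)
      have h2 := hnL (x - u) (x - y)
      rw [← sub_div, abs_div, abs_of_pos hl0] at h1
      rw [show x - u - (x - y) = y - u by ring, abs_sub_comm y u] at h2
      have h3 : |u - y| / l ≤ |u - y| := div_le_self (abs_nonneg _) hl
      rw [show 2 / l * (tent (u / l) * n (x - u)) - 2 / l * (tent (y / l) * n (x - y))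
        = 2 / l * ((tent (u / l) - tent (y / l)) * n (x - u)
          + tent (y / l) * (n (x - u) - n (x - y))) by ring, abs_mul, abs_of_pos (by positivity)]
      have h4 : 2 / l ≤ 2 := div_le_self (by norm_num) hl
      have h5 : |(tent (u / l) - tent (y / l)) * n (x - u)
          + tent (y / l) * (n (x - u) - n (x - y))| ≤ 2 / 100 * (M * |u - y|) := by
        refine (abs_add_le _ _).trans ?_
        rw [abs_mul, abs_mul, abs_of_nonneg (tent_nonneg _)]
        have h6 := mul_le_mul (h1.trans (mul_le_mul_of_nonneg_left h3 (by norm_num)))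
          (hnM (x - u)) (abs_nonneg _) (by positivity)
        have h7 := mul_le_mul (tent_le (y / l)) h2 (abs_nonneg _) (by norm_num)
        linarith
      have h10 : 0 ≤ M * |u - y| := by positivity
      calc _ ≤ 2 * (2 / 100 * (M * |u - y|)) := mul_le_mul h4 h5 (abs_nonneg _) (by norm_num)
        _ ≤ _ := by linarith
    · intro z
      rw [abs_mul, abs_mul, abs_of_pos (by positivity : 0 < 2 / l),
        abs_of_nonneg (tent_nonneg _)]
      have h4 : 2 / l ≤ 2 := div_le_self (by norm_num) hl
      have h5 := mul_le_mul (tent_le (z / l)) (hnM (x - z)) (abs_nonneg _) (by norm_num)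
      have h6 := mul_le_mul h4 h5 (mul_nonneg (tent_nonneg _) (abs_nonneg _)) (by norm_num)
      linarith
  · have h1 : ∀ y, 4 * l ≤ y → conv (kernel l γ) n y
        = ∫ z in (0 : ℝ)..(3 * l), kernel l γ z * a := by
      intro y hy
      rw [hmin y (by linarith), min_eq_right (by linarith)]
      refine intervalIntegral.integral_congr fun z hz => ?_
      rw [Set.uIcc_of_le (by linarith)] at hz
      rw [hna _ (by linarith [hz.2])]
    simp only [n', Pi.sub_apply]
    rw [h1 x hx, h1 _ le_rfl, hna x (by linarith), hna (4 * l) (by linarith)]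

/-- The rapidly growing sequence of scales. -/
noncomputable def scale (k : ℕ) : ℝ := (Nat.factorial (k + 8) : ℝ)

lemma scale_succ (k : ℕ) : scale (k + 1) = (k + 9) * scale k := by
  unfold scale
  rw [show k + 1 + 8 = (k + 8) + 1 by ring, Nat.factorial_succ]
  push_cast; ring

lemma le_scale (k : ℕ) : (k : ℝ) + 8 ≤ scale k := by
  unfold scale
  have := Nat.self_le_factorial (k + 8)
  exact_mod_cast this

lemma one_le_scale (k : ℕ) : 1 ≤ scale k := by
  have := le_scale k
  have : (0 : ℝ) ≤ k := Nat.cast_nonneg k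
  linarith

lemma four_mul_scale_le (k : ℕ) : 4 * scale k ≤ scale (k + 1) := by
  rw [scale_succ]
  have := one_le_scale k
  have : (0 : ℝ) ≤ k := Nat.cast_nonneg k
  nlinarith

lemma scale_mono : Monotone scale := by
  refine monotone_nat_of_le_succ fun k => ?_
  have := one_le_scale k
  linarith [four_mul_scale_le k]

lemma sum_scale_le (k : ℕ) : ∑ j ∈ Finset.range k, scale j ≤ 2 * scale k / (k + 8) := by
  induction k with
  | zero => have := one_le_scale 0; simp; linarith
  | succ k ih =>
    have hk : (0 : ℝ) ≤ k := Nat.cast_nonneg k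
    have h1 := one_le_scale k
    rw [Finset.sum_range_succ, scale_succ]
    have h2 : 2 * ((k + 9) * scale k) / (((k + 1 : ℕ) : ℝ) + 8) = 2 * scale k := by
      push_cast; field_simp; ring
    have h3 : 2 * scale k / (k + 8) ≤ scale k := by
      rw [div_le_iff₀ (by positivity)]; nlinarith
    rw [h2]; linarith

/-- The successive densities. -/
noncomputable def density : ℕ → ℝ → ℝ
  | 0 => fun _ => 1
  | k + 1 => density k - conv (kernel (scale k) (Real.exp (4 * scale k))) (density k)

lemma density_succ (k : ℕ) : density (k + 1)
    = density k - conv (kernel (scale k) (Real.exp (4 * scale k))) (density k) := rfl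

lemma eight_mul_scale_le (k : ℕ) : 8 * scale k * 2 ^ k ≤ Real.exp (2 * scale k) := by
  have h1 : scale k ≤ Real.exp (scale k) := by linarith [Real.add_one_le_exp (scale k)]
  have h2 : (8 : ℝ) * 2 ^ k ≤ Real.exp (scale k) := by
    have h3 : (2 : ℝ) ≤ Real.exp 1 := by linarith [Real.add_one_le_exp (1 : ℝ)]
    calc (8 : ℝ) * 2 ^ k = 2 ^ (k + 3) := by ring
      _ ≤ Real.exp 1 ^ (k + 3) := by gcongr
      _ = Real.exp (k + 3 : ℕ) := by rw [← Real.exp_nat_mul]; simp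
      _ ≤ _ := by
        rw [Real.exp_le_exp]; push_cast; linarith [le_scale k]
  have h4 := one_le_scale k
  rw [show 2 * scale k = scale k + scale k by ring, Real.exp_add]
  calc 8 * scale k * 2 ^ k = scale k * (8 * 2 ^ k) := by ring
    _ ≤ _ := mul_le_mul h1 h2 (by positivity) (Real.exp_pos _).le

lemma density_invariant (k : ℕ) : Continuous (density k) ∧ (∀ x, |density k x| ≤ 2 ^ k) ∧
    (∀ x y, |density k x - density k y| ≤ 2 ^ k * |x - y|) ∧
    (∀ x, scale k ≤ x → density k x = density k (scale k)) := by
  induction k with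
  | zero =>
    refine ⟨continuous_const, fun x => by simp [density], fun x y => by simp [density],
      fun x _ => by simp [density]⟩
  | succ k ih =>
    obtain ⟨h1, h2, h3, h4⟩ := ih
    obtain ⟨g1, g2, g3, g4, g5, g6⟩ := density_step (one_le_scale k) (one_le_pow₀ one_le_two)
      (eight_mul_scale_le k) h1 h2 h3 h4
    rw [← density_succ] at g1 g2 g3 g6
    refine ⟨g1, fun x => (g2 x).trans (by rw [pow_succ]; linarith),
      fun x y => (g3 x y).trans (by rw [pow_succ]; linarith), fun x hx => ?_⟩
    have := four_mul_scale_le k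
    rw [g6 x (by linarith), g6 (scale (k + 1)) (by linarith)]

lemma density_succ_eq (k : ℕ) : (∀ x, x ≤ scale k → density (k + 1) x = density k x) ∧
    (∀ x, |density (k + 1) x - density k x| ≤ Real.exp (-2 * scale k)) ∧
    ∀ x, 4 * scale k ≤ x → density (k + 1) x = density (k + 1) (4 * scale k) := by
  obtain ⟨h1, h2, h3, h4⟩ := density_invariant k
  obtain ⟨g1, g2, g3, g4, g5, g6⟩ := density_step (one_le_scale k) (one_le_pow₀ one_le_two)
      (eight_mul_scale_le k) h1 h2 h3 h4
  exact ⟨g4, g5, g6⟩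

lemma two_mul_exp_scale_le (k : ℕ) :
    2 * Real.exp (-2 * scale (k + 1)) ≤ Real.exp (-2 * scale k) := by
  have h3 : (2 : ℝ) ≤ Real.exp 1 := by linarith [Real.add_one_le_exp (1 : ℝ)]
  calc 2 * Real.exp (-2 * scale (k + 1)) ≤ Real.exp 1 * Real.exp (-2 * scale (k + 1)) := by
        gcongr
    _ = Real.exp (1 + -2 * scale (k + 1)) := by rw [← Real.exp_add]
    _ ≤ _ := by
      rw [Real.exp_le_exp]
      linarith [four_mul_scale_le k, one_le_scale k]

lemma density_eq_of_le {k N : ℕ} (h : k ≤ N) {x : ℝ} (hx : x ≤ scale k) :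
    density N x = density k x := by
  induction N, h using Nat.le_induction with
  | base => rfl
  | succ N hN ih => rw [(density_succ_eq N).1 x (hx.trans (scale_mono hN)), ih]

/-- The terminal value of the successive densities. -/
noncomputable def terminal (k : ℕ) : ℝ := density k (scale k)

lemma density_eq_terminal {k : ℕ} {x : ℝ} (hx : scale k ≤ x) : density k x = terminal k :=
  (density_invariant k).2.2.2 x hx

lemma abs_terminal_sub_le {k N : ℕ} (h : k ≤ N) :
    |terminal N - terminal k| ≤ 2 * Real.exp (-2 * scale k) - 2 * Real.exp (-2 * scale N) := by
  induction N, h using Nat.le_induction with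
  | base => simp
  | succ N hN ih =>
    have h1 : |terminal (N + 1) - terminal N| ≤ Real.exp (-2 * scale N) := by
      have := (density_succ_eq N).2.1 (scale (N + 1))
      rwa [density_eq_terminal le_rfl, density_eq_terminal (scale_mono N.le_succ)] at this
    have := abs_sub_le (terminal (N + 1)) (terminal N) (terminal k)
    linarith [two_mul_exp_scale_le N]

lemma tendsto_scale : Tendsto scale atTop atTop := by
  refine tendsto_atTop_mono (f := fun k : ℕ => (k : ℝ)) (fun k => ?_) tendsto_natCast_atTop_atTop
  linarith [le_scale k]

lemma exists_terminal_limit :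
    ∃ A0 : ℝ, ∀ k, |terminal k - A0| ≤ 2 * Real.exp (-2 * scale k) := by
  have ht : Tendsto (fun k => 2 * Real.exp (-2 * scale k)) atTop (𝓝 0) := by
    rw [show (0 : ℝ) = 2 * 0 by ring]
    refine Tendsto.const_mul 2 (Real.tendsto_exp_atBot.comp ?_)
    exact tendsto_scale.const_mul_atTop_of_neg (by norm_num)
  have hb : ∀ k N : ℕ, k ≤ N → |terminal N - terminal k| ≤ 2 * Real.exp (-2 * scale k) :=
    fun k N h => (abs_terminal_sub_le h).trans (by linarith [Real.exp_pos (-2 * scale N)])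
  have hc : CauchySeq terminal := by
    refine cauchySeq_of_le_tendsto_0' (fun k => 2 * Real.exp (-2 * scale k)) (fun k N h => ?_) ht
    rw [dist_comm, Real.dist_eq]
    exact hb k N h
  obtain ⟨A0, hA⟩ := cauchySeq_tendsto_of_complete hc
  refine ⟨A0, fun k => ?_⟩
  have : Tendsto (fun N => |terminal k - terminal N|) atTop (𝓝 |terminal k - A0|) :=
    (tendsto_const_nhds.sub hA).abs
  refine le_of_tendsto this ?_
  filter_upwards [eventually_ge_atTop k] with N hN
  rw [abs_sub_comm]
  exact hb k N hN

/-- The limiting density. -/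
noncomputable def limitDensity (v : ℝ) : ℝ := density ⌈v⌉₊ v

lemma limitDensity_eq {N : ℕ} {v : ℝ} (h : v ≤ scale N) : limitDensity v = density N v := by
  have h1 : v ≤ scale ⌈v⌉₊ := by linarith [le_scale ⌈v⌉₊, Nat.le_ceil v]
  rcases le_total N ⌈v⌉₊ with h2 | h2
  · exact density_eq_of_le h2 h
  · exact (density_eq_of_le h2 h1).symm

lemma continuous_limitDensity : Continuous limitDensity := by
  rw [continuous_iff_continuousAt]
  intro v
  obtain ⟨N, hN⟩ := exists_nat_gt v
  refine ((density_invariant N).1.continuousAt (x := v)).congr ?_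
  filter_upwards [Iio_mem_nhds hN] with w hw
  exact (limitDensity_eq (by linarith [le_scale N, Set.mem_Iio.1 hw])).symm

lemma exists_limitDensity_bound :
    ∃ A0 : ℝ, ∀ v, 0 ≤ v → |limitDensity v - A0| ≤ 3 * Real.exp (-(v / 2)) := by
  obtain ⟨A0, hA⟩ := exists_terminal_limit
  refine ⟨A0, fun v hv => ?_⟩
  have hex : ∃ k, v ≤ scale k := ⟨⌈v⌉₊, by linarith [le_scale ⌈v⌉₊, Nat.le_ceil v]⟩
  classical
  rcases h : Nat.find hex with _ | k
  · have h0 : v ≤ scale 0 := h ▸ Nat.find_spec hex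
    have h1 : limitDensity v = terminal 0 := by rw [limitDensity_eq h0]; rfl
    rw [h1]
    refine (hA 0).trans ?_
    have : Real.exp (-2 * scale 0) ≤ Real.exp (-(v / 2)) :=
      Real.exp_le_exp.2 (by linarith)
    linarith [Real.exp_pos (-(v / 2))]
  · have h0 : v ≤ scale (k + 1) := h ▸ Nat.find_spec hex
    have h1 : scale k < v := not_le.1 (Nat.find_min hex (by omega))
    rw [limitDensity_eq h0]
    rcases le_total (4 * scale k) v with h2 | h2
    · have h3 : density (k + 1) v = terminal (k + 1) := by
        rw [(density_succ_eq k).2.2 v h2, terminal,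
          (density_succ_eq k).2.2 (scale (k + 1)) (four_mul_scale_le k)]
      rw [h3]
      refine (hA _).trans ?_
      have : Real.exp (-2 * scale (k + 1)) ≤ Real.exp (-(v / 2)) :=
        Real.exp_le_exp.2 (by linarith)
      linarith [Real.exp_pos (-(v / 2))]
    · have h3 := (density_succ_eq k).2.1 v
      rw [density_eq_terminal h1.le] at h3
      have := abs_sub_le (density (k + 1) v) (terminal k) A0
      have h4 : Real.exp (-2 * scale k) ≤ Real.exp (-(v / 2)) :=
        Real.exp_le_exp.2 (by linarith)
      linarith [hA k]

/-- The response at the `k`-th scale. -/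
noncomputable def response (k : ℕ) : ℝ → ℝ :=
  (exists_response (one_le_scale k) (Real.exp (4 * scale k))).choose

lemma response_spec (k : ℕ) : Continuous (response k) ∧
    response k = (fun z => z * kernel (scale k) (Real.exp (4 * scale k)) z)
      + conv (kernel (scale k) (Real.exp (4 * scale k))) (response k) ∧
      (∀ v ≤ scale k, response k v = 0) ∧
      (∀ v, 0 < v → |response k v| ≤ 1 / 4 * (scale k / v)) ∧ ∀ v, |response k v| ≤ 1 / 4 :=
  (exists_response (one_le_scale k) (Real.exp (4 * scale k))).choose_spec

lemma sum_abs_response_le (N : ℕ) (v : ℝ) :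
    ∑ k ∈ Finset.range N, |response k v| ≤ 1 / 2 := by
  induction N with
  | zero => simp
  | succ N ih =>
    rcases le_total v (scale N) with h | h
    · rw [Finset.sum_range_succ, (response_spec N).2.2.1 v h]
      simpa using ih
    · have hv : 0 < v := by linarith [one_le_scale N]
      calc ∑ k ∈ Finset.range (N + 1), |response k v|
          ≤ ∑ k ∈ Finset.range (N + 1), 1 / 4 * (scale k / v) :=
            Finset.sum_le_sum fun k _ => (response_spec k).2.2.2.1 v hv
        _ = 1 / 4 * ((∑ k ∈ Finset.range (N + 1), scale k) / v) := by
            rw [Finset.sum_div, Finset.mul_sum]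
        _ ≤ 1 / 4 * (2 * v / v) := by
            gcongr
            rw [Finset.sum_range_succ]
            have h1 := sum_scale_le N
            have h2 : 2 * scale N / ((N : ℝ) + 8) ≤ scale N := by
              have := one_le_scale N
              rw [div_le_iff₀ (by positivity)]
              have : (0 : ℝ) ≤ N := Nat.cast_nonneg N
              nlinarith
            linarith
        _ = 1 / 2 := by field_simp; norm_num

/-- The total response. -/
noncomputable def totalResponse (v : ℝ) : ℝ := ∑ k ∈ Finset.range ⌈v⌉₊, response k v

lemma totalResponse_eq {N : ℕ} {v : ℝ} (h : v ≤ scale N) :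
    totalResponse v = ∑ k ∈ Finset.range N, response k v := by
  have hz : ∀ k, v ≤ scale k → response k v = 0 := fun k hk => (response_spec k).2.2.1 v hk
  have h1 : v ≤ scale ⌈v⌉₊ := by linarith [le_scale ⌈v⌉₊, Nat.le_ceil v]
  have key : ∀ N M : ℕ, N ≤ M → v ≤ scale N →
      ∑ k ∈ Finset.range N, response k v = ∑ k ∈ Finset.range M, response k v := by
    intro N M hNM hN
    refine Finset.sum_subset (Finset.range_mono hNM) fun k _ hk => hz k ?_
    exact hN.trans (scale_mono (by simpa using hk))
  rcases le_total N ⌈v⌉₊ with h2 | h2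
  · exact (key _ _ h2 h).symm
  · exact key _ _ h2 h1

lemma continuous_totalResponse : Continuous totalResponse := by
  rw [continuous_iff_continuousAt]
  intro v
  obtain ⟨N, hN⟩ := exists_nat_gt v
  have hc : Continuous fun v => ∑ k ∈ Finset.range N, response k v :=
    continuous_finsetSum _ fun k _ => (response_spec k).1
  refine (hc.continuousAt (x := v)).congr ?_
  filter_upwards [Iio_mem_nhds hN] with w hw
  exact (totalResponse_eq (by linarith [le_scale N, Set.mem_Iio.1 hw])).symm

lemma abs_totalResponse_le (v : ℝ) : |totalResponse v| ≤ 1 / 2 :=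
  (Finset.abs_sum_le_sum_abs _ _).trans (sum_abs_response_le _ v)

lemma totalResponse_eq_zero {v : ℝ} (hv : v ≤ 8) : totalResponse v = 0 := by
  have : v ≤ scale 0 := by have := le_scale 0; norm_num at this; linarith
  rw [totalResponse_eq this]; simp

/-- The Chebyshev identity for the successive densities. -/
lemma mul_density (k : ℕ) : (fun v => v * density k v)
    = conv (density k) (fun v => 1 - ∑ j ∈ Finset.range k, response j v) := by
  induction k with
  | zero =>
    funext v
    simp [density, conv]
  | succ k ih =>
    set κ := kernel (scale k) (Real.exp (4 * scale k)) with hκ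
    have hκc : Continuous κ := continuous_kernel _ _
    obtain ⟨hHc, hH, -⟩ := response_spec k
    rw [← hκ] at hH
    have hn := (density_invariant k).1
    set b : ℝ → ℝ := fun v => 1 - ∑ j ∈ Finset.range k, response j v with hb
    have hbc : Continuous b :=
      continuous_const.sub (continuous_finsetSum _ fun j _ => (response_spec j).1)
    have e1 : (fun v => 1 - ∑ j ∈ Finset.range (k + 1), response j v) = b - response k := by
      funext v
      simp only [hb, Pi.sub_apply, Finset.sum_range_succ]
      ring
    have e2 : (fun v => v * density (k + 1) v)
        = (fun v => v * density k v) - (fun v => v * conv κ (density k) v) := by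
      funext v
      simp only [density_succ, Pi.sub_apply]
      ring
    have e3 : conv (fun x => x * κ x) (density k)
        = conv (density k) (response k) - conv (density k) (conv κ (response k)) := by
      have e4 : (fun x => x * κ x) = response k - conv κ (response k) := by
        rw [eq_sub_iff_add_eq]; exact hH.symm
      rw [e4, conv_sub_left hn hHc (continuous_conv hκc hHc), conv_comm _ (density k),
        conv_comm _ (density k)]
    rw [e1, e2, id_mul_conv hκc hn, ih, density_succ, ← hκ,
      conv_sub_left (hbc.sub hHc) hn (continuous_conv hκc hn),
      conv_sub_right hn hbc hHc, conv_sub_right (continuous_conv hκc hn) hbc hHc, e3,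
      conv_assoc hκc hn hbc, conv_assoc hκc hn hHc, conv_left_comm hκc hn hHc]
    abel

lemma mul_limitDensity (v : ℝ) : v * limitDensity v
    = conv limitDensity (fun w => 1 - totalResponse w) v := by
  rcases le_total 0 v with hv | hv
  · have h1 : v ≤ scale ⌈v⌉₊ := by linarith [le_scale ⌈v⌉₊, Nat.le_ceil v]
    rw [limitDensity_eq h1]
    have := congrFun (mul_density ⌈v⌉₊) v
    rw [this]
    refine conv_congr hv (fun x _ hx => (limitDensity_eq (hx.trans h1)).symm) fun x _ hx => ?_
    rw [totalResponse_eq (hx.trans h1)]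
  · have h1 : ∀ w, w ≤ 0 → limitDensity w = 1 := fun w hw => by
      rw [limitDensity_eq (N := 0) (by linarith [one_le_scale 0])]; rfl
    rw [h1 v hv, conv, intervalIntegral.integral_congr (g := fun _ => (1 : ℝ))]
    · simp
    · intro w hw
      rw [Set.uIcc_of_ge hv] at hw
      simp only
      rw [h1 _ (by linarith [hw.1]), totalResponse_eq_zero (by linarith [hw.2])]
      norm_num

lemma half_le_cos_of_close {x : ℝ} (h : |x| ≤ 1) : 1 / 2 ≤ Real.cos x := by
  have h1 := Real.one_sub_sq_div_two_le_cos (x := x)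
  have h2 : x ^ 2 ≤ 1 := by rw [← sq_abs]; exact pow_le_one₀ (abs_nonneg _) h
  linarith

/-- Choice of a starting point at which a fast cosine has a prescribed sign. -/
lemma exists_phase {γ L ε : ℝ} (hγ : 0 < γ) (hε : ε = 1 ∨ ε = -1) :
    ∃ v, L ≤ v ∧ v ≤ L + 4 * Real.pi / γ ∧
      ∀ w, γ * |w - v| ≤ 1 → 1 / 2 ≤ ε * Real.cos (γ * w) := by
  have hpi := Real.pi_pos
  set j : ℤ := ⌈γ * L / (2 * Real.pi)⌉ with hj
  have h1 : γ * L ≤ j * (2 * Real.pi) := by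
    have := Int.le_ceil (γ * L / (2 * Real.pi))
    rwa [div_le_iff₀ (by positivity)] at this
  have h2 : j * (2 * Real.pi) ≤ γ * L + 2 * Real.pi := by
    have := (Int.ceil_lt_add_one (γ * L / (2 * Real.pi))).le
    rw [← hj] at this
    calc (j : ℝ) * (2 * Real.pi) ≤ (γ * L / (2 * Real.pi) + 1) * (2 * Real.pi) := by gcongr
      _ = _ := by field_simp
  rcases hε with rfl | rfl
  · refine ⟨j * (2 * Real.pi) / γ, ?_, ?_, fun w hw => ?_⟩
    · rw [le_div_iff₀ hγ]; linarith
    · rw [← sub_nonneg]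
      have : L + 4 * Real.pi / γ - j * (2 * Real.pi) / γ
          = (γ * L + 4 * Real.pi - j * (2 * Real.pi)) / γ := by field_simp
      rw [this]
      exact div_nonneg (by linarith) hγ.le
    · rw [one_mul, ← Real.cos_sub_int_mul_two_pi (γ * w) j]
      refine half_le_cos_of_close ?_
      have : γ * w - j * (2 * Real.pi) = γ * (w - j * (2 * Real.pi) / γ) := by field_simp
      rwa [this, abs_mul, abs_of_pos hγ]
  · refine ⟨(j * (2 * Real.pi) + Real.pi) / γ, ?_, ?_, fun w hw => ?_⟩
    · rw [le_div_iff₀ hγ]; linarith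
    · rw [← sub_nonneg]
      have : L + 4 * Real.pi / γ - (j * (2 * Real.pi) + Real.pi) / γ
          = (γ * L + 4 * Real.pi - (j * (2 * Real.pi) + Real.pi)) / γ := by field_simp
      rw [this]
      exact div_nonneg (by linarith) hγ.le
    · rw [neg_one_mul, ← Real.cos_sub_pi, ← Real.cos_sub_int_mul_two_pi (γ * w - Real.pi) j]
      refine half_le_cos_of_close ?_
      have : γ * w - Real.pi - j * (2 * Real.pi)
          = γ * (w - (j * (2 * Real.pi) + Real.pi) / γ) := by field_simp; ring
      rwa [this, abs_mul, abs_of_pos hγ]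

lemma totalResponse_oscillates {lam : ℝ} (hlam : lam < 1) :
    ∃ q > 0, ∀ ε : ℝ, (ε = 1 ∨ ε = -1) → ∀ X : ℝ, ∃ v, X ≤ v ∧ 0 ≤ v ∧
      ∀ w, v ≤ w → w ≤ v + 2 * Real.exp (-((1 - lam) * v)) →
        q ≤ ε * (totalResponse w + Real.exp (-w)) := by
  obtain ⟨G, hGc, hG, hG0, hG1, hGl, hGm⟩ := exists_profile
  obtain ⟨m, hm⟩ : ∃ m : ℕ, 5 ≤ 2 * ((m : ℝ) + 1) * (1 - lam) := by
    obtain ⟨m, hm⟩ := exists_nat_ge (5 / (1 - lam))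
    refine ⟨m, ?_⟩
    rw [div_le_iff₀ (by linarith)] at hm
    nlinarith [Nat.cast_nonneg (α := ℝ) m]
  set g := G (2 * (m + 1)) with hg
  have hg0 : 0 < g := hGm m
  refine ⟨g / 2, by positivity, fun ε hε X => ?_⟩
  have hexp : ∀ c : ℝ, Tendsto (fun k => c * Real.exp (-scale k)) atTop (𝓝 0) := by
    intro c
    rw [show (0 : ℝ) = c * 0 by ring]
    exact Tendsto.const_mul c (Real.tendsto_exp_neg_atTop_nhds_zero.comp tendsto_scale)
  have hinv : Tendsto (fun k : ℕ => 1 / (2 * ((k : ℝ) + 8))) atTop (𝓝 0) := by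
    refine Tendsto.div_atTop tendsto_const_nhds ?_
    refine Tendsto.const_mul_atTop (by norm_num) ?_
    exact tendsto_atTop_add_const_right _ _ tendsto_natCast_atTop_atTop
  have hev : ∀ᶠ k : ℕ in atTop, 20 * Real.exp (-scale k) ≤ g / 10 ∧
      (8 * (2 * (m : ℝ) + 4)) * Real.exp (-scale k) ≤ g / 10 ∧
      1 / (2 * ((k : ℝ) + 8)) ≤ g / 10 ∧ 2 * Real.exp (-scale k) ≤ 1 ∧
      20 * Real.exp (-scale k) ≤ 1 ∧
      X ≤ scale k ∧ 2 * m + 3 ≤ k := by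
    have hg' : 0 < g / 10 := by positivity
    filter_upwards [(hexp 20).eventually_le_const hg', (hexp _).eventually_le_const hg',
      hinv.eventually_le_const hg', (hexp 2).eventually_le_const one_pos,
      (hexp 20).eventually_le_const one_pos, tendsto_scale.eventually_ge_atTop X,
      eventually_ge_atTop (2 * m + 3)] with k h1 h2 h3 h4 h5 h6 h7
    exact ⟨h1, h2, h3, h4, h5, h6, h7⟩
  obtain ⟨k, hk1, hk2, hk3, hk4, hk5, hkX, hkm⟩ := hev.exists
  set l := scale k with hl
  have hl1 : 1 ≤ l := one_le_scale k
  set γ := Real.exp (4 * l) with hγ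
  have hγ0 : 0 < γ := Real.exp_pos _
  have hm0 : (0 : ℝ) ≤ m := Nat.cast_nonneg m
  have hpi := Real.pi_pos
  have hpi4 : Real.pi ≤ 4 := Real.pi_le_four
  obtain ⟨v, hv1, hv2, hv3⟩ := exists_phase (L := 2 * (m + 1) * l) hγ0 hε
  have hγi : 1 / γ ≤ Real.exp (-l) := by
    rw [hγ, one_div, ← Real.exp_neg, Real.exp_le_exp]; linarith
  have hv2' : v ≤ 2 * (m + 1) * l + 16 * Real.exp (-l) := by
    refine hv2.trans ?_
    have : 4 * Real.pi / γ = 4 * Real.pi * (1 / γ) := by ring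
    rw [this]
    have : 4 * Real.pi * (1 / γ) ≤ 16 * Real.exp (-l) :=
      mul_le_mul (by linarith) hγi (by positivity) (by norm_num)
    linarith
  have hlv : l ≤ v := by nlinarith
  refine ⟨v, by linarith, by linarith, fun w hw1 hw2 => ?_⟩
  have hδ : 2 * Real.exp (-((1 - lam) * v)) ≤ 2 * Real.exp (-(5 * l)) := by
    have h0 : 5 * l ≤ (1 - lam) * v := by
      calc 5 * l ≤ 2 * ((m : ℝ) + 1) * (1 - lam) * l := by gcongr
        _ = (1 - lam) * (2 * (m + 1) * l) := by ring
        _ ≤ (1 - lam) * v := mul_le_mul_of_nonneg_left hv1 (by linarith)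
    have := Real.exp_le_exp.2 (neg_le_neg h0)
    linarith
  have hwv : |w - v| ≤ 2 * Real.exp (-(5 * l)) := by
    rw [abs_of_nonneg (by linarith)]; linarith
  have hcos : 1 / 2 ≤ ε * Real.cos (γ * w) := by
    refine hv3 w ?_
    calc γ * |w - v| ≤ γ * (2 * Real.exp (-(5 * l))) := by gcongr
      _ = 2 * Real.exp (-l) := by
        rw [hγ, mul_left_comm, ← Real.exp_add]; congr 2; ring
      _ ≤ 1 := hk4
  have h5l : Real.exp (-(5 * l)) ≤ Real.exp (-l) := Real.exp_le_exp.2 (by linarith)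
  have hwl : |w - 2 * (m + 1) * l| ≤ 18 * Real.exp (-l) := by
    rw [abs_of_nonneg (by linarith)]; linarith
  have hwle : w ≤ (2 * m + 3) * l := by
    have := le_of_abs_le hwl
    nlinarith
  have hlw : l ≤ w := hlv.trans hw1
  have hw0 : 0 < w := by linarith
  -- the main term
  have hGw : g - 18 * Real.exp (-l) ≤ G (w / l) := by
    have h1 := hGl (w / l) (2 * (m + 1))
    have h2 : |w / l - 2 * (m + 1)| ≤ 18 * Real.exp (-l) := by
      have : w / l - 2 * (m + 1) = (w - 2 * (m + 1) * l) / l := by field_simp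
      rw [this, abs_div, abs_of_pos (by linarith : 0 < l)]
      exact (div_le_self (abs_nonneg _) hl1).trans hwl
    have := neg_le_of_abs_le (h1.trans h2)
    linarith
  obtain ⟨hHc, hH, hHz, -, -⟩ := response_spec k
  have hHk := abs_response_sub_le hl1 hγ0 hGc hG hG0 hG1 hGl hHc hH hHz
    (V := (2 * m + 3) * l) (by positivity) hwle
  have herr : 2 * (Real.pi / γ * ((2 * m + 3) * l / 2 + 1)) ≤ g / 10 := by
    refine le_trans ?_ hk2
    have h1 : Real.pi / γ ≤ 4 * Real.exp (-(2 * l)) := by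
      have : Real.pi / γ = Real.pi * Real.exp (-(4 * l)) := by
        rw [hγ, div_eq_mul_inv, Real.exp_neg]
      rw [this]
      gcongr
      linarith
    have h2 : (2 * m + 3) * l / 2 + 1 ≤ (2 * m + 4) * l := by nlinarith
    have h3 : l ≤ Real.exp l := by linarith [Real.add_one_le_exp l]
    calc 2 * (Real.pi / γ * ((2 * m + 3) * l / 2 + 1))
        ≤ 2 * (4 * Real.exp (-(2 * l)) * ((2 * m + 4) * Real.exp l)) := by
          gcongr
          exact h2.trans (by gcongr)
      _ = 8 * (2 * m + 4) * (Real.exp (-(2 * l)) * Real.exp l) := by ring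
      _ = _ := by rw [← Real.exp_add]; congr 2; ring
  have hlower : ∑ j ∈ Finset.range k, |response j w| ≤ g / 10 := by
    refine le_trans ?_ hk3
    calc ∑ j ∈ Finset.range k, |response j w|
        ≤ ∑ j ∈ Finset.range k, 1 / 4 * (scale j / w) :=
            Finset.sum_le_sum fun j _ => (response_spec j).2.2.2.1 w hw0
      _ = 1 / 4 * ((∑ j ∈ Finset.range k, scale j) / w) := by
            rw [Finset.sum_div, Finset.mul_sum]
      _ ≤ 1 / 4 * ((2 * l / (k + 8)) / l) := by
            gcongr
            exact sum_scale_le k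
      _ = 1 / (2 * ((k : ℝ) + 8)) := by field_simp; norm_num
  have htot : totalResponse w = (∑ j ∈ Finset.range k, response j w) + response k w := by
    rw [← Finset.sum_range_succ]
    refine totalResponse_eq (hwle.trans ?_)
    rw [scale_succ]
    have : ((2 * m + 3 : ℕ) : ℝ) ≤ k := by exact_mod_cast hkm
    push_cast at this
    exact mul_le_mul_of_nonneg_right (by linarith) (by linarith)
  have hε1 : |ε| = 1 := by rcases hε with rfl | rfl <;> simp
  have hS : |ε * ∑ j ∈ Finset.range k, response j w| ≤ g / 10 := by
    rw [abs_mul, hε1, one_mul]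
    exact (Finset.abs_sum_le_sum_abs _ _).trans hlower
  have hR : |ε * (response k w - 2 * Real.cos (γ * w) * G (w / l))| ≤ g / 10 := by
    rw [abs_mul, hε1, one_mul]
    exact hHk.trans herr
  have hE : |ε * Real.exp (-w)| ≤ g / 10 := by
    rw [abs_mul, hε1, one_mul, abs_of_pos (Real.exp_pos _)]
    have : Real.exp (-w) ≤ Real.exp (-l) := Real.exp_le_exp.2 (by linarith)
    linarith [Real.exp_pos (-l)]
  have hmain : G (w / l) ≤ 2 * (ε * Real.cos (γ * w)) * G (w / l) := by
    have := mul_le_mul_of_nonneg_right hcos (hG0 (w / l))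
    linarith
  rw [htot]
  have h1 := neg_le_of_abs_le hS
  have h2 := neg_le_of_abs_le hR
  have h3 := neg_le_of_abs_le hE
  have h4 : ε * (∑ j ∈ Finset.range k, response j w + response k w + Real.exp (-w))
      = ε * ∑ j ∈ Finset.range k, response j w
        + ε * (response k w - 2 * Real.cos (γ * w) * G (w / l))
        + 2 * (ε * Real.cos (γ * w)) * G (w / l) + ε * Real.exp (-w) := by ring
  rw [h4]
  linarith [Real.exp_pos (-l)]

/-- The continuous prime density, in logarithmic scale and relative to `exp`. -/
noncomputable def primeDensity (w : ℝ) : ℝ :=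
  (∫ s in (0 : ℝ)..1, Real.exp (-(s * w))) - totalResponse w / w

lemma mul_primeDensity (w : ℝ) :
    w * primeDensity w = 1 - Real.exp (-w) - totalResponse w := by
  rcases eq_or_ne w 0 with rfl | hw
  · simp [totalResponse_eq_zero (show (0 : ℝ) ≤ 8 by norm_num)]
  have h := intervalIntegral.mul_integral_comp_mul_right (a := 0) (b := 1)
    (f := fun x => Real.exp (-x)) w
  simp only [zero_mul, one_mul] at h
  rw [primeDensity, mul_sub, h, mul_div_cancel₀ _ hw]
  have := intervalIntegral.integral_comp_neg (a := 0) (b := w) Real.exp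
  rw [this, integral_exp]
  simp

lemma continuous_primeDensity : Continuous primeDensity := by
  refine Continuous.sub ?_ ?_
  · refine intervalIntegral.continuous_parametric_intervalIntegral_of_continuous' ?_ 0 1
    fun_prop
  · rw [continuous_iff_continuousAt]
    intro v
    rcases lt_or_ge v 8 with hv | hv
    · refine (continuousAt_const (y := (0 : ℝ))).congr ?_
      filter_upwards [Iio_mem_nhds hv] with w hw
      rw [totalResponse_eq_zero (le_of_lt hw), zero_div]
    · exact continuous_totalResponse.continuousAt.div continuousAt_id (by simp; linarith)

lemma primeDensity_bounds {w : ℝ} (hw : 0 ≤ w) : 0 ≤ primeDensity w ∧ primeDensity w ≤ 2 := by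
  have h1 : 0 ≤ ∫ s in (0 : ℝ)..1, Real.exp (-(s * w)) :=
    intervalIntegral.integral_nonneg zero_le_one fun _ _ => (Real.exp_pos _).le
  have h2 : |∫ s in (0 : ℝ)..1, Real.exp (-(s * w))| ≤ 1 * |(1 : ℝ) - 0| := by
    refine abs_integral_le_of_abs_le_const fun s hs => ?_
    rw [Set.uIoc_of_le zero_le_one] at hs
    rw [abs_of_pos (Real.exp_pos _), Real.exp_le_one_iff]
    have := mul_nonneg hs.1.le hw
    linarith
  have h2' := le_of_abs_le h2
  norm_num at h2'
  rcases lt_or_ge w 8 with h | h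
  · have : primeDensity w = ∫ s in (0 : ℝ)..1, Real.exp (-(s * w)) := by
      rw [primeDensity, totalResponse_eq_zero h.le]; simp
    rw [this]
    exact ⟨h1, by linarith⟩
  · have h3 := mul_primeDensity w
    have h4 := abs_le.1 (abs_totalResponse_le w)
    have h5 : Real.exp (-w) ≤ 1 / 2 := by
      rw [Real.exp_neg, one_div]
      exact inv_anti₀ (by norm_num) (by linarith [Real.add_one_le_exp w])
    have h6 := Real.exp_pos (-w)
    constructor
    · by_contra! hneg
      nlinarith
    · by_contra! hneg
      nlinarith

lemma quarter_le_mul_primeDensity {w : ℝ} (hw : 1 ≤ w) : 1 / 4 ≤ w * primeDensity w := by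
  rw [mul_primeDensity]
  have h4 := abs_le.1 (abs_totalResponse_le w)
  rcases lt_or_ge w 8 with h | h
  · rw [totalResponse_eq_zero h.le]
    have : Real.exp (-w) ≤ 1 / 2 := by
      rw [Real.exp_neg, one_div]
      exact inv_anti₀ (by norm_num) (by linarith [Real.add_one_le_exp w])
    linarith
  · have : Real.exp (-w) ≤ 1 / 4 := by
      rw [Real.exp_neg, one_div]
      exact inv_anti₀ (by norm_num) (by linarith [Real.add_one_le_exp w])
    linarith

/-- A continuous prime density with oscillations in short intervals, whose integer density
approximates a constant to exponential accuracy. -/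
theorem exists_template : ∃ (n p : ℝ → ℝ) (A0 : ℝ), Continuous n ∧ n 0 = 1 ∧
    (∀ v, 0 ≤ v → |n v - A0| ≤ 3 * Real.exp (-(v / 2))) ∧ Continuous p ∧
    (∀ w, 0 ≤ w → 0 ≤ p w ∧ p w ≤ 2) ∧ (∀ w, 1 ≤ w → 1 / 4 ≤ w * p w) ∧
    (∀ w, w * p w ≤ 2) ∧ (∀ v, v * n v = conv n (fun w => w * p w + Real.exp (-w)) v) ∧
    ∀ lam < 1, ∃ q > 0, ∀ ε : ℝ, (ε = 1 ∨ ε = -1) → ∀ X : ℝ, ∃ v, X ≤ v ∧ 0 ≤ v ∧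
      ∀ w, v ≤ w → w ≤ v + 2 * Real.exp (-((1 - lam) * v)) → q ≤ ε * (w * p w - 1) := by
  obtain ⟨A0, hA0⟩ := exists_limitDensity_bound
  refine ⟨limitDensity, primeDensity, A0, continuous_limitDensity, ?_, hA0,
    continuous_primeDensity, fun w hw => primeDensity_bounds hw,
    fun w hw => quarter_le_mul_primeDensity hw, fun w => ?_, fun v => ?_, fun lam hlam => ?_⟩
  · rw [limitDensity_eq (N := 0) (by linarith [one_le_scale 0])]; rfl
  · rw [mul_primeDensity]
    linarith [(abs_le.1 (abs_totalResponse_le w)).1, Real.exp_pos (-w)]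
  · rw [mul_limitDensity]
    congr 1
    funext w
    rw [mul_primeDensity]; ring
  · obtain ⟨q, hq, h⟩ := totalResponse_oscillates hlam
    refine ⟨q, hq, fun ε hε X => ?_⟩
    obtain ⟨v, h1, h2, h3⟩ := h (-ε) (by rcases hε with rfl | rfl <;> simp) X
    refine ⟨v, h1, h2, fun w hw1 hw2 => ?_⟩
    have := h3 w hw1 hw2
    rw [mul_primeDensity]
    linarith

lemma abs_conv_le_of_abs_le {b c : ℝ → ℝ} {v L B C : ℝ} (hv : |v| ≤ L) (hB0 : 0 ≤ B)
    (hC0 : 0 ≤ C) (hb : ∀ x, |x| ≤ L → |b x| ≤ B) (hc : ∀ x, |x| ≤ L → |c x| ≤ C) :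
    |conv b c v| ≤ B * C * L := by
  have h := intervalIntegral.norm_integral_le_of_norm_le_const (a := 0) (b := v) (C := B * C)
    (f := fun w => b (v - w) * c w) ?_
  · rw [Real.norm_eq_abs, sub_zero] at h
    exact h.trans (mul_le_mul_of_nonneg_left hv (by positivity))
  · intro w hw
    have hw' := Set.uIoc_subset_uIcc hw
    rw [Real.norm_eq_abs, abs_mul]
    have h1 : |w| ≤ L ∧ |v - w| ≤ L := by
      rcases le_total 0 v with h | h
      · rw [Set.uIcc_of_le h] at hw'
        rw [abs_of_nonneg h] at hv
        rw [abs_of_nonneg hw'.1, abs_of_nonneg (by linarith [hw'.2])]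
        exact ⟨by linarith [hw'.2], by linarith [hw'.1]⟩
      · rw [Set.uIcc_of_ge h] at hw'
        rw [abs_of_nonpos h] at hv
        rw [abs_of_nonpos hw'.2, abs_of_nonpos (by linarith [hw'.1])]
        exact ⟨by linarith [hw'.1], by linarith [hw'.2]⟩
    exact mul_le_mul (hb _ h1.2) (hc w h1.1) (abs_nonneg _) hB0

lemma eq_const_of_mul_eq_integral {z : ℝ → ℝ} (hz : Continuous z)
    (h : ∀ v, v * z v = ∫ w in (0 : ℝ)..v, z w) {v : ℝ} (hv : 0 ≤ v) : z v = z 0 := by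
  rcases hv.eq_or_lt with rfl | hv
  · rfl
  have hd : ∀ x, HasDerivAt (fun v => ∫ w in (0 : ℝ)..v, z w) (z x) x := fun x =>
    intervalIntegral.integral_hasDerivAt_right (hz.intervalIntegrable _ _)
      (hz.stronglyMeasurableAtFilter _ _) hz.continuousAt
  have hzd : ∀ x, 0 < x → HasDerivAt z 0 x := by
    intro x hx
    have h1 : HasDerivAt (fun v => (∫ w in (0 : ℝ)..v, z w) / v)
        ((z x * x - (∫ w in (0 : ℝ)..x, z w) * 1) / x ^ 2) x :=
      (hd x).div (hasDerivAt_id x) hx.ne'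
    rw [← h x] at h1
    rw [show (z x * x - x * z x * 1) / x ^ 2 = 0 by ring] at h1
    refine h1.congr_of_eventuallyEq ?_
    filter_upwards [Ioi_mem_nhds hx] with y hy
    rw [← h y, mul_div_cancel_left₀ _ (ne_of_gt hy)]
  have hconst : ∀ a, 0 < a → a ≤ v → z v = z a := by
    intro a ha hav
    refine constant_of_has_deriv_right_zero (a := a) (b := v) hz.continuousOn
      (fun x hx => (hzd x (ha.trans_le hx.1)).hasDerivWithinAt) v ⟨hav, le_rfl⟩
  have h1 : Tendsto z (𝓝[>] 0) (𝓝 (z 0)) := hz.continuousAt.mono_left nhdsWithin_le_nhds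
  refine tendsto_nhds_unique (f := z) (l := 𝓝[>] 0) ?_ h1
  refine tendsto_const_nhds.congr' ?_
  filter_upwards [Ioc_mem_nhdsGT hv] with a ha
  exact hconst a ha.1 ha.2

/-- Iterated convolutions with `p`. -/
noncomputable def convPow (p n : ℝ → ℝ) (r : ℕ) : ℝ → ℝ := (conv p)^[r] n

lemma convPow_zero (p n : ℝ → ℝ) : convPow p n 0 = n := rfl

lemma convPow_succ (p n : ℝ → ℝ) (r : ℕ) : convPow p n (r + 1) = conv p (convPow p n r) :=
  Function.iterate_succ_apply' _ _ _

section ExpIdentity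

variable {p n : ℝ → ℝ}

lemma continuous_convPow (hp : Continuous p) (hn : Continuous n) (r : ℕ) :
    Continuous (convPow p n r) := by
  induction r with
  | zero => exact hn
  | succ r ih => rw [convPow_succ]; exact continuous_conv hp ih

lemma abs_convPow_le {L P M : ℝ} (hP0 : 0 ≤ P) (hM0 : 0 ≤ M) (hL0 : 0 ≤ L)
    (hP : ∀ x, |x| ≤ L → |p x| ≤ P) (hM : ∀ x, |x| ≤ L → |n x| ≤ M) (r : ℕ) :
    ∀ x, |x| ≤ L → |convPow p n r x| ≤ M * (P * L) ^ r := by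
  induction r with
  | zero => simpa [convPow_zero] using hM
  | succ r ih =>
    intro x hx
    rw [convPow_succ]
    refine (abs_conv_le_of_abs_le hx hP0 (by positivity) hP ih).trans (le_of_eq ?_)
    ring

lemma mul_convPow (hp : Continuous p) (hn : Continuous n) {b e : ℝ → ℝ} (hb : Continuous b)
    (he : Continuous e) (hpb : b = fun w => w * p w)
    (h : (fun v => v * n v) = conv n (b + e)) (r : ℕ) :
    (fun v => v * convPow p n (r + 1) v) = ((r : ℝ) + 1) • conv b (convPow p n r)
      + conv b (convPow p n (r + 1)) + conv e (convPow p n (r + 1)) := by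
  induction r with
  | zero =>
    have e1 := id_mul_conv hp hn
    rw [← hpb, h, conv_add_right hn hb he, conv_add_right hp (continuous_conv hn hb)
      (continuous_conv hn he), conv_comm n b, conv_comm n e, conv_left_comm hp hb hn,
      conv_left_comm hp he hn] at e1
    rw [convPow_succ, convPow_zero, e1]
    simp [add_assoc]
  | succ r ih =>
    have hc := continuous_convPow hp hn
    have e1 := id_mul_conv hp (hc (r + 1))
    rw [ih, ← hpb] at e1
    rw [conv_add_right hp (((continuous_conv hb (hc r)).const_smul _).add
      (continuous_conv hb (hc (r + 1)))) (continuous_conv he (hc (r + 1))),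
      conv_add_right hp ((continuous_conv hb (hc r)).const_smul _)
      (continuous_conv hb (hc (r + 1))), conv_smul_right, conv_left_comm hp hb (hc r),
      conv_left_comm hp hb (hc (r + 1)), conv_left_comm hp he (hc (r + 1)), ← convPow_succ,
      ← convPow_succ] at e1
    rw [convPow_succ p n (r + 1), ← convPow_succ] at *
    rw [e1]
    push_cast
    funext v
    simp only [Pi.add_apply, Pi.smul_apply, smul_eq_mul]
    ring

/-- Partial sums of the convolution exponential of `-p`, applied to `n`. -/
noncomputable def expPartial (p n : ℝ → ℝ) (R : ℕ) : ℝ → ℝ :=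
  ∑ r ∈ Finset.range (R + 1), ((-1) ^ r / (r.factorial : ℝ)) • convPow p n r

lemma continuous_expPartial (hp : Continuous p) (hn : Continuous n) (R : ℕ) :
    Continuous (expPartial p n R) := by
  have := continuous_finsetSum (Finset.range (R + 1)) fun r _ =>
    (continuous_convPow hp hn r).const_smul ((-1) ^ r / (r.factorial : ℝ))
  convert this using 1
  funext v
  simp [expPartial]

lemma mul_expPartial (hp : Continuous p) (hn : Continuous n) {b e : ℝ → ℝ} (hb : Continuous b)
    (he : Continuous e) (hpb : b = fun w => w * p w)
    (h : (fun v => v * n v) = conv n (b + e)) (R : ℕ) :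
    (fun v => v * expPartial p n R v) = conv e (expPartial p n R)
      + ((-1) ^ R / (R.factorial : ℝ)) • conv b (convPow p n R) := by
  induction R with
  | zero =>
    have : expPartial p n 0 = n := by simp [expPartial, convPow_zero]
    rw [this, h, conv_add_right hn hb he, conv_comm n b, conv_comm n e, convPow_zero]
    simp [add_comm]
  | succ R ih =>
    have hs : expPartial p n (R + 1) = expPartial p n R
        + ((-1) ^ (R + 1) / ((R + 1).factorial : ℝ)) • convPow p n (R + 1) := by
      rw [expPartial, Finset.sum_range_succ]; rfl
    have h1 : (fun v => v * expPartial p n (R + 1) v) = (fun v => v * expPartial p n R v)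
        + ((-1) ^ (R + 1) / ((R + 1).factorial : ℝ)) •
          (fun v => v * convPow p n (R + 1) v) := by
      funext v
      rw [hs]
      simp only [Pi.add_apply, Pi.smul_apply, smul_eq_mul]
      ring
    rw [h1, ih, mul_convPow hp hn hb he hpb h, hs, conv_add_right he
      (continuous_expPartial hp hn R) ((continuous_convPow hp hn _).const_smul _),
      conv_smul_right]
    funext v
    simp only [Pi.add_apply, Pi.smul_apply, smul_eq_mul]
    have h2 : ((-1) ^ (R + 1) / ((R + 1).factorial : ℝ)) * (R + 1)
        = -((-1) ^ R / (R.factorial : ℝ)) := by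
      rw [Nat.factorial_succ]
      push_cast
      field_simp
      ring
    linear_combination conv b (convPow p n R) v * h2

/-- If `v n = n * (v p + exp (-v))` then the convolution exponential of `-p` maps `n` to
`exp (-v)`. -/
theorem hasSum_convPow (hp : Continuous p) (hn : Continuous n) (hn0 : n 0 = 1)
    (h : ∀ v, v * n v = conv n (fun w => w * p w + Real.exp (-w)) v) {v : ℝ} (hv : 0 ≤ v) :
    HasSum (fun r : ℕ => (-1) ^ r / (r.factorial : ℝ) * convPow p n r v) (Real.exp (-v)) := by
  set b : ℝ → ℝ := fun w => w * p w with hb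
  set e : ℝ → ℝ := fun w => Real.exp (-w) with he
  have hbc : Continuous b := by rw [hb]; fun_prop
  have hec : Continuous e := by rw [he]; fun_prop
  have h' : (fun v => v * n v) = conv n (b + e) := funext h
  have hbd : ∀ L : ℝ, ∀ f : ℝ → ℝ, Continuous f → ∃ M, 0 ≤ M ∧ ∀ x, |x| ≤ L → |f x| ≤ M := by
    intro L f hf
    obtain ⟨M, hM⟩ := (isCompact_Icc (a := -L) (b := L)).exists_bound_of_continuousOn
      hf.continuousOn
    exact ⟨|M|, abs_nonneg _, fun x hx => (hM x (abs_le.1 hx)).trans (le_abs_self M)⟩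
  have hmaj : ∀ L, 0 ≤ L → ∃ u : ℕ → ℝ, Summable u ∧
      ∀ r x, |x| ≤ L → |(-1) ^ r / (r.factorial : ℝ) * convPow p n r x| ≤ u r := by
    intro L hL
    obtain ⟨P, hP0, hP⟩ := hbd L p hp
    obtain ⟨M, hM0, hM⟩ := hbd L n hn
    refine ⟨fun r => M * ((P * L) ^ r / r.factorial),
      (Real.summable_pow_div_factorial (P * L)).mul_left M, fun r x hx => ?_⟩
    rw [abs_mul, abs_div, abs_pow, abs_neg, abs_one, one_pow, Nat.abs_cast]
    calc 1 / (r.factorial : ℝ) * |convPow p n r x|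
        ≤ 1 / (r.factorial : ℝ) * (M * (P * L) ^ r) :=
          mul_le_mul_of_nonneg_left (abs_convPow_le hP0 hM0 hL hP hM r x hx) (by positivity)
      _ = _ := by ring
  have hsm : ∀ x, Summable fun r : ℕ => (-1) ^ r / (r.factorial : ℝ) * convPow p n r x := by
    intro x
    obtain ⟨u, hu, hur⟩ := hmaj |x| (abs_nonneg x)
    exact Summable.of_norm_bounded hu fun r => hur r x le_rfl
  set E : ℝ → ℝ := fun x => ∑' r : ℕ, (-1) ^ r / (r.factorial : ℝ) * convPow p n r x with hE
  have hEc : Continuous E := by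
    rw [continuous_iff_continuousAt]
    intro x
    obtain ⟨u, hu, hur⟩ := hmaj (|x| + 1) (by positivity)
    have hon : ContinuousOn E {y | |y| ≤ |x| + 1} := by
      refine continuousOn_tsum (fun r => ?_) hu fun r y hy => hur r y hy
      exact (continuous_const.mul (continuous_convPow hp hn r)).continuousOn
    refine hon.continuousAt ?_
    filter_upwards [continuous_abs.continuousAt.eventually_lt
      (continuousAt_const (y := |x| + 1)) (by linarith)] with y hy
    exact le_of_lt hy
  have hpar : ∀ R x, expPartial p n R x
      = ∑ r ∈ Finset.range (R + 1), (-1) ^ r / (r.factorial : ℝ) * convPow p n r x := by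
    intro R x
    simp [expPartial]
  have hlim : ∀ x, Tendsto (fun R => expPartial p n R x) atTop (𝓝 (E x)) := by
    intro x
    simp only [hpar]
    exact (hsm x).hasSum.tendsto_sum_nat.comp (tendsto_add_atTop_nat 1)
  have hEeq : ∀ x, x * E x = conv e E x := by
    intro x
    obtain ⟨u, hu, hur⟩ := hmaj |x| (abs_nonneg x)
    obtain ⟨Be, hBe0, hBe⟩ := hbd |x| e hec
    have hu0 : ∀ r, 0 ≤ u r := fun r => (abs_nonneg _).trans (hur r 0 (by simp))
    have hEb : ∀ R y, |y| ≤ |x| → |expPartial p n R y| ≤ ∑' r, u r := by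
      intro R y hy
      rw [hpar]
      refine (Finset.abs_sum_le_sum_abs _ _).trans ?_
      refine (Finset.sum_le_sum fun r _ => hur r y hy).trans ?_
      exact hu.sum_le_tsum _ fun r _ => hu0 r
    have h1 : Tendsto (fun R => conv e (expPartial p n R) x) atTop (𝓝 (conv e E x)) := by
      refine intervalIntegral.tendsto_integral_filter_of_dominated_convergence
        (fun _ => Be * ∑' r, u r) ?_ ?_ (by simp) ?_
      · refine Eventually.of_forall fun R => Continuous.aestronglyMeasurable ?_
        have := continuous_expPartial hp hn R
        fun_prop
      · refine Eventually.of_forall fun R => MeasureTheory.ae_of_all _ fun w hw => ?_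
        have hw' := Set.uIoc_subset_uIcc hw
        have h2 : |w| ≤ |x| ∧ |x - w| ≤ |x| := by
          have h3 := Set.abs_sub_left_of_mem_uIcc hw'
          have h4 := Set.abs_sub_right_of_mem_uIcc hw'
          rw [sub_zero, sub_zero] at h3
          rw [sub_zero] at h4
          exact ⟨h3, h4⟩
        rw [norm_mul]
        exact mul_le_mul (hBe _ h2.2) (hEb R w h2.1) (abs_nonneg _) hBe0
      · exact MeasureTheory.ae_of_all _ fun w _ => (hlim w).const_mul _
    have h2 : Tendsto (fun R : ℕ => (-1) ^ R / (R.factorial : ℝ) * conv b (convPow p n R) x) atTop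
        (𝓝 0) := by
      obtain ⟨Bb, hBb0, hBb⟩ := hbd |x| b hbc
      have h3 : Tendsto (fun R => Bb * |x| * u R) atTop (𝓝 0) := by
        rw [show (0 : ℝ) = Bb * |x| * 0 by ring]
        exact hu.tendsto_atTop_zero.const_mul _
      refine squeeze_zero_norm (fun R => ?_) h3
      rw [← smul_eq_mul, ← Pi.smul_apply, ← conv_smul_right, Real.norm_eq_abs]
      refine (abs_conv_le_of_abs_le le_rfl hBb0 (hu0 R) hBb
        (fun y hy => hur R y hy)).trans (le_of_eq ?_)
      ring
    have h3 : Tendsto (fun R => x * expPartial p n R x) atTop (𝓝 (conv e E x + 0)) := by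
      refine (h1.add h2).congr fun R => ?_
      exact (congrFun (mul_expPartial hp hn hbc hec hb h' R) x).symm
    rw [add_zero] at h3
    exact tendsto_nhds_unique ((hlim x).const_mul x) h3
  have hE0 : E 0 = 1 := by
    have hz : ∀ r, r ≠ 0 → (-1) ^ r / (r.factorial : ℝ) * convPow p n r 0 = 0 := by
      intro r hr
      obtain ⟨s, rfl⟩ := Nat.exists_eq_succ_of_ne_zero hr
      rw [Nat.succ_eq_add_one, convPow_succ]
      simp [conv]
    rw [hE]
    simp only
    rw [tsum_eq_single 0 hz]
    simp [convPow_zero, hn0]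
  have hz : ∀ x, x * (Real.exp x * E x) = ∫ w in (0 : ℝ)..x, Real.exp w * E w := by
    intro x
    rw [mul_left_comm, hEeq, conv, ← intervalIntegral.integral_const_mul]
    refine intervalIntegral.integral_congr fun w _ => ?_
    simp only [he]
    rw [← mul_assoc, ← Real.exp_add]
    congr 2
    ring
  have hfin := eq_const_of_mul_eq_integral (z := fun x => Real.exp x * E x) (by fun_prop) hz hv
  simp only [Real.exp_zero, hE0, one_mul] at hfin
  have : E v = Real.exp (-v) := by
    rw [Real.exp_neg]
    exact eq_inv_of_mul_eq_one_right hfin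
  rw [← this]
  exact (hsm v).hasSum

end ExpIdentity

/-- Second-order Taylor estimate for the exponential in a Banach algebra. -/
lemma norm_exp_sub_one_sub_le {𝔸 : Type*} [NormedRing 𝔸] [NormedAlgebra ℝ 𝔸] [CompleteSpace 𝔸]
    [NormOneClass 𝔸] (x : 𝔸) (hx : ‖x‖ ≤ 1) : ‖NormedSpace.exp x - 1 - x‖ ≤ ‖x‖ ^ 2 := by
  have h1 := NormedSpace.exp_series_hasSum_exp' (𝕂 := ℝ) x
  have h2 := (hasSum_nat_add_iff' 2).2 h1
  have h3 := NormedSpace.exp_series_hasSum_exp' (𝕂 := ℝ) (‖x‖ : ℝ)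
  have h4 := (hasSum_nat_add_iff' 2).2 h3
  have h5 : ‖NormedSpace.exp x - ∑ i ∈ Finset.range 2, ((i.factorial : ℝ)⁻¹ • x ^ i)‖
      ≤ NormedSpace.exp ‖x‖ - ∑ i ∈ Finset.range 2, ((i.factorial : ℝ)⁻¹ • ‖x‖ ^ i) := by
    refine h2.norm_le_of_bounded h4 fun i => ?_
    rw [norm_smul, Real.norm_of_nonneg (by positivity), smul_eq_mul]
    exact mul_le_mul_of_nonneg_left (norm_pow_le _ _) (by positivity)
  rw [← Real.exp_eq_exp_ℝ] at h5
  simp only [Finset.sum_range_succ, Finset.sum_range_zero, Nat.factorial, smul_eq_mul] at h5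
  norm_num at h5
  have h6 := Real.abs_exp_sub_one_sub_id_le (x := ‖x‖) (by rwa [abs_of_nonneg (norm_nonneg _)])
  have h7 := le_abs_self (Real.exp ‖x‖ - 1 - ‖x‖)
  rw [sub_sub]
  linarith

section AbstractStep

variable {E : Type*} [NormedAddCommGroup E] [NormedSpace ℝ E]

lemma norm_le_div_of_one_sub {U : E →L[ℝ] E} {e : ℝ} (he : e < 1) (hU : ‖U‖ ≤ e) (z : E) :
    ‖z‖ ≤ ‖(1 - U) z‖ / (1 - e) := by
  rw [le_div_iff₀ (by linarith)]
  have h1 : z = (1 - U) z + U z := by simp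
  have h2 : ‖z‖ ≤ ‖(1 - U) z‖ + ‖U z‖ := by
    conv_lhs => rw [h1]
    exact norm_add_le _ _
  have h3 : ‖U z‖ ≤ e * ‖z‖ := U.le_of_opNorm_le hU z
  linarith

lemma exists_one_sub_apply_eq [CompleteSpace E] {U : E →L[ℝ] E} (hU : ‖U‖ < 1) (y : E) :
    ∃ z, (1 - U) z = y := by
  have h := mul_neg_geom_series U hU
  refine ⟨(∑' i : ℕ, U ^ i) y, ?_⟩
  rw [← mul_apply_eq_comp, h]
  simp

/-- Replacing a short piece of the continuous prime measure by one atom changes the state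
to first order by `U g - D g`. -/
lemma exists_replace [CompleteSpace E] {U D : E →L[ℝ] E} {e e0 : ℝ} (he0 : e0 < 1) (hee : e ≤ e0)
    (hU : ‖U‖ ≤ e) (hD : ‖D‖ ≤ e) (g : E) :
    ∃ g', (1 - U) g' = NormedSpace.exp (-D) g ∧
      ‖g' - (g + (U g - D g))‖ ≤ 3 * e ^ 2 / (1 - e0) * ‖g‖ := by
  rcases subsingleton_or_nontrivial E with hE | hE
  · exact ⟨0, Subsingleton.elim _ _, by
      rw [Subsingleton.elim g 0, Subsingleton.elim (0 - _ : E) 0]; simp⟩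
  have he : 0 ≤ e := (norm_nonneg _).trans hU
  obtain ⟨g', hg'⟩ := exists_one_sub_apply_eq (lt_of_le_of_lt (hU.trans hee) he0)
    (NormedSpace.exp (-D) g)
  refine ⟨g', hg', ?_⟩
  refine (norm_le_div_of_one_sub he0 (hU.trans hee) _).trans ?_
  rw [div_mul_eq_mul_div]
  refine div_le_div_of_nonneg_right ?_ (by linarith)
  rw [map_sub, hg']
  have h1 : NormedSpace.exp (-D) g - (1 - U) (g + (U g - D g))
      = (NormedSpace.exp (-D) - 1 - (-D)) g + U (U g) - U (D g) := by
    simp only [sub_apply, one_apply_eq_self, map_add, map_sub,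
      neg_apply]
    abel
  rw [h1]
  have h2 : ‖(NormedSpace.exp (-D) - 1 - (-D)) g‖ ≤ e ^ 2 * ‖g‖ := by
    refine ContinuousLinearMap.le_of_opNorm_le _ ?_ g
    refine (norm_exp_sub_one_sub_le (-D) (by rw [norm_neg]; linarith)).trans ?_
    rw [norm_neg]
    exact pow_le_pow_left₀ (norm_nonneg _) hD 2
  have h3 : ‖U (U g)‖ ≤ e * (e * ‖g‖) := (U.le_of_opNorm_le hU _).trans
    (mul_le_mul_of_nonneg_left (U.le_of_opNorm_le hU _) he)
  have h4 : ‖U (D g)‖ ≤ e * (e * ‖g‖) := (U.le_of_opNorm_le hU _).trans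
    (mul_le_mul_of_nonneg_left (D.le_of_opNorm_le hD _) he)
  have h5 := norm_sub_le ((NormedSpace.exp (-D) - 1 - (-D)) g + U (U g)) (U (D g))
  have h6 := norm_add_le ((NormedSpace.exp (-D) - 1 - (-D)) g) (U (U g))
  nlinarith

end AbstractStep

section ScalarInequality

lemma abs_pow_mul_abs_pow_le {e a x : ℝ} {d k : ℕ} (he0 : 0 < e) (he : e ≤ 1) (hk : 2 ≤ k)
    (hkd : k ≤ d) : |a| ^ (d - k) * |x| ^ k ≤ e ^ 2 * |a| ^ d + (e⁻¹) ^ (d - 2) * |x| ^ d := by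
  rcases le_total |x| (e * |a|) with h | h
  · have h1 : |x| ^ k ≤ e ^ k * |a| ^ k := by
      rw [← mul_pow]; exact pow_le_pow_left₀ (abs_nonneg _) h k
    have h2 : e ^ k ≤ e ^ 2 := pow_le_pow_of_le_one he0.le he hk
    have h3 : |a| ^ (d - k) * |x| ^ k ≤ e ^ 2 * |a| ^ d := by
      calc |a| ^ (d - k) * |x| ^ k ≤ |a| ^ (d - k) * (e ^ 2 * |a| ^ k) := by
            gcongr
            exact h1.trans (by gcongr)
        _ = e ^ 2 * (|a| ^ (d - k) * |a| ^ k) := by ring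
        _ = e ^ 2 * |a| ^ d := by rw [← pow_add]; congr 2; omega
    have : 0 ≤ (e⁻¹) ^ (d - 2) * |x| ^ d := by positivity
    linarith
  · have h1 : |a| ≤ e⁻¹ * |x| := by
      rw [inv_mul_eq_div, le_div_iff₀ he0]; linarith
    have h2 : |a| ^ (d - k) ≤ (e⁻¹) ^ (d - 2) * |x| ^ (d - k) := by
      refine (pow_le_pow_left₀ (abs_nonneg _) h1 _).trans ?_
      rw [mul_pow]
      gcongr
      · exact (one_le_inv₀ he0).2 he
      
    have h3 : |a| ^ (d - k) * |x| ^ k ≤ (e⁻¹) ^ (d - 2) * |x| ^ d := by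
      calc |a| ^ (d - k) * |x| ^ k ≤ ((e⁻¹) ^ (d - 2) * |x| ^ (d - k)) * |x| ^ k := by gcongr
        _ = (e⁻¹) ^ (d - 2) * (|x| ^ (d - k) * |x| ^ k) := by ring
        _ = _ := by rw [← pow_add]; congr 2; omega
    have : 0 ≤ e ^ 2 * |a| ^ d := by positivity
    linarith

/-- First-order upper bound for even powers, uniform in a scale parameter `e`. -/
lemma add_pow_le_of_even {d : ℕ} (hd : Even d) (hd2 : 2 ≤ d) {e : ℝ} (he0 : 0 < e) (he : e ≤ 1)
    (a x : ℝ) : (a + x) ^ d ≤ a ^ d + d * (a ^ (d - 1) * x)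
      + 2 ^ d * (e ^ 2 * a ^ d + (e⁻¹) ^ (d - 2) * x ^ d) := by
  have hda : |a| ^ d = a ^ d := hd.pow_abs a
  have hdx : |x| ^ d = x ^ d := hd.pow_abs x
  set R := e ^ 2 * a ^ d + (e⁻¹) ^ (d - 2) * x ^ d with hR
  rw [add_comm a x, add_pow]
  obtain ⟨m, rfl⟩ : ∃ m, d = m + 2 := ⟨d - 2, by omega⟩
  rw [show m + 2 + 1 = (m + 1) + 2 by ring, Finset.sum_range_succ', Finset.sum_range_succ']
  have h1 : ∑ k ∈ Finset.range (m + 1), x ^ (k + 1 + 1) * a ^ (m + 2 - (k + 1 + 1))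
      * ((m + 2).choose (k + 1 + 1) : ℝ) ≤ 2 ^ (m + 2) * R := by
    have h2 : ∀ k ∈ Finset.range (m + 1), x ^ (k + 1 + 1) * a ^ (m + 2 - (k + 1 + 1))
      * ((m + 2).choose (k + 1 + 1) : ℝ) ≤ ((m + 2).choose (k + 1 + 1) : ℝ) * R := by
      intro k hk
      rw [Finset.mem_range] at hk
      rw [mul_comm]
      refine mul_le_mul_of_nonneg_left ?_ (by positivity)
      have h3 := abs_pow_mul_abs_pow_le (a := a) (x := x) (d := m + 2) (k := k + 1 + 1) he0 he
        (by omega) (by omega)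
      rw [hda, hdx] at h3
      refine le_trans (le_abs_self _) (le_trans (le_of_eq ?_) h3)
      rw [abs_mul, abs_pow, abs_pow, mul_comm]
    refine (Finset.sum_le_sum h2).trans ?_
    rw [← Finset.sum_mul]
    have hR0 : 0 ≤ R := by
      rw [hR, ← hda, ← hdx]; positivity
    refine mul_le_mul_of_nonneg_right ?_ hR0
    have h4 := Nat.sum_range_choose (m + 2)
    have h5 : ∑ k ∈ Finset.range (m + 1), (m + 2).choose (k + 1 + 1) ≤ 2 ^ (m + 2) := by
      rw [show m + 2 + 1 = (m + 1) + 2 by ring, Finset.sum_range_succ' _ (m + 1 + 1),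
        Finset.sum_range_succ' _ (m + 1)] at h4
      omega
    exact_mod_cast h5
  simp only [zero_add, pow_zero, pow_one, Nat.choose_one_right, Nat.choose_zero_right,
    Nat.sub_zero, one_mul, Nat.cast_one, mul_one] at h1 ⊢
  have h6 : m + 2 - 1 = m + 1 := by omega
  rw [h6]
  push_cast at h1 ⊢
  linarith

end ScalarInequality

open MeasureTheory
open scoped ENNReal

section Shift

variable {p : ℝ≥0∞} [Fact (1 ≤ p)]

/-- Translation by `w` on `L^p(ℝ)`. -/
noncomputable def shift (w : ℝ) : Lp ℝ p (volume : Measure ℝ) →L[ℝ] Lp ℝ p (volume : Measure ℝ) :=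
  (Lp.compMeasurePreservingₗᵢ ℝ (fun v => v - w)
    (measurePreserving_sub_right volume w)).toContinuousLinearMap

lemma norm_shift_apply (w : ℝ) (g : Lp ℝ p (volume : Measure ℝ)) : ‖shift w g‖ = ‖g‖ :=
  LinearIsometry.norm_map _ g

lemma shift_ae (w : ℝ) (g : Lp ℝ p (volume : Measure ℝ)) :
    shift w g =ᵐ[volume] fun v => g (v - w) :=
  Lp.coeFn_compMeasurePreserving g (measurePreserving_sub_right volume w)

lemma ae_comp_sub {P : ℝ → Prop} (h : ∀ᵐ v, P v) (w : ℝ) : ∀ᵐ v, P (v - w) :=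
  (measurePreserving_sub_right volume w).quasiMeasurePreserving.ae h

lemma shift_comm (u w : ℝ) (g : Lp ℝ p (volume : Measure ℝ)) :
    shift u (shift w g) = shift w (shift u g) := by
  refine Lp.ext ?_
  filter_upwards [shift_ae u (shift w g), shift_ae w (shift u g),
    ae_comp_sub (shift_ae w g) u, ae_comp_sub (shift_ae u g) w] with v h1 h2 h3 h4
  rw [h1, h2, h3, h4, sub_right_comm]

lemma continuous_shift (hp : p ≠ ⊤) (g : Lp ℝ p (volume : Measure ℝ)) :
    Continuous fun w => shift w g := by
  let c : ℝ → C(ℝ, ℝ) := fun w => ⟨fun v => v - w, by fun_prop⟩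
  have hc : Continuous c := ContinuousMap.continuous_of_continuous_uncurry _ (by
    show Continuous fun q : ℝ × ℝ => q.2 - q.1
    fun_prop)
  exact Continuous.compMeasurePreservingLp (continuous_const (y := g)) hc
    (fun w => measurePreserving_sub_right volume w) hp

variable (p) in
/-- The averaged translation operator `g ↦ ∫_s^t b(w) T_w g dw`. -/
noncomputable def shiftInt (hp : p ≠ ⊤) {b : ℝ → ℝ} (hb : Continuous b) (s t : ℝ) :
    Lp ℝ p (volume : Measure ℝ) →L[ℝ] Lp ℝ p (volume : Measure ℝ) :=
  LinearMap.mkContinuous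
    { toFun := fun g => ∫ w in s..t, b w • shift w g
      map_add' := fun f g => by
        simp only [map_add, smul_add]
        exact intervalIntegral.integral_add
          ((hb.smul (continuous_shift hp f)).intervalIntegrable _ _)
          ((hb.smul (continuous_shift hp g)).intervalIntegrable _ _)
      map_smul' := fun c g => by
        simp only [map_smul, RingHom.id_apply]
        rw [← intervalIntegral.integral_smul]
        simp only [smul_comm c] }
    (abs (∫ w in s..t, abs (b w))) (fun g => by
      refine (intervalIntegral.norm_integral_le_abs_integral_norm).trans (le_of_eq ?_)
      simp only [norm_smul, norm_shift_apply, Real.norm_eq_abs,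
        intervalIntegral.integral_mul_const, abs_mul, abs_norm])

variable (hp : p ≠ ⊤) {b : ℝ → ℝ} (hb : Continuous b)

lemma shiftInt_apply (s t : ℝ) (g : Lp ℝ p (volume : Measure ℝ)) :
    shiftInt p hp hb s t g = ∫ w in s..t, b w • shift w g := rfl

lemma norm_shiftInt_le {s t C : ℝ} (hst : s ≤ t) (hC : ∫ w in s..t, |b w| ≤ C) :
    ‖shiftInt p hp hb s t‖ ≤ C := by
  have h0 : 0 ≤ ∫ w in s..t, |b w| := intervalIntegral.integral_nonneg hst fun _ _ => abs_nonneg _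
  refine (LinearMap.mkContinuous_norm_le _ (abs_nonneg _) _).trans ?_
  rwa [abs_of_nonneg h0]

lemma shiftInt_add (s t u : ℝ) :
    shiftInt p hp hb s t + shiftInt p hp hb t u = shiftInt p hp hb s u := by
  ext1 g
  rw [add_apply, shiftInt_apply, shiftInt_apply, shiftInt_apply]
  exact intervalIntegral.integral_add_adjacent_intervals
    ((hb.smul (continuous_shift hp g)).intervalIntegrable _ _)
    ((hb.smul (continuous_shift hp g)).intervalIntegrable _ _)

lemma shiftInt_self (s : ℝ) : shiftInt p hp hb s s = 0 := by
  ext1 g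
  rw [shiftInt_apply, intervalIntegral.integral_same]; rfl

lemma map_shiftInt {F : Type*} [NormedAddCommGroup F] [NormedSpace ℝ F] [CompleteSpace F]
    (A : Lp ℝ p (volume : Measure ℝ) →L[ℝ] F)
    (s t : ℝ) (g : Lp ℝ p (volume : Measure ℝ)) :
    A (shiftInt p hp hb s t g) = ∫ w in s..t, b w • A (shift w g) := by
  have h : Continuous fun w => b w • shift w g := hb.smul (continuous_shift hp g)
  rw [shiftInt_apply, ← A.intervalIntegral_comp_comm (h.intervalIntegrable _ _)]
  simp only [map_smul]

lemma commute_shiftInt {A : Lp ℝ p (volume : Measure ℝ) →L[ℝ] Lp ℝ p (volume : Measure ℝ)}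
    (hA : ∀ w, Commute A (shift w)) (s t : ℝ) : Commute A (shiftInt p hp hb s t) := by
  ext1 g
  show A (shiftInt p hp hb s t g) = shiftInt p hp hb s t (A g)
  rw [map_shiftInt, shiftInt_apply]
  refine intervalIntegral.integral_congr fun w _ => ?_
  have : A (shift w g) = shift w (A g) := congrArg (fun B => B g) (hA w)
  simp only [this]

lemma commute_shift (u w : ℝ) : Commute (shift u : Lp ℝ p (volume : Measure ℝ) →L[ℝ] _) (shift w) := by
  ext1 g
  exact shift_comm u w g

lemma commute_shiftInt_shift (s t w : ℝ) : Commute (shiftInt p hp hb s t) (shift w) :=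
  (commute_shiftInt hp hb (commute_shift w) s t).symm

lemma commute_shiftInt_shiftInt (s t s' t' : ℝ) :
    Commute (shiftInt p hp hb s t) (shiftInt p hp hb s' t') :=
  commute_shiftInt hp hb (commute_shiftInt_shift hp hb s t) s' t'

end Shift

section Greedy

variable {d : ℕ}

lemma integrable_pow_Lp (hd : Even d) (hd2 : 2 ≤ d) (g : Lp ℝ d (volume : Measure ℝ)) :
    Integrable fun v => g v ^ d := by
  have h := (Lp.memLp g).integrable_norm_pow (p := d) (by omega)
  simpa only [Real.norm_eq_abs, hd.pow_abs] using h

lemma norm_pow_eq_integral (hd : Even d) (hd2 : 2 ≤ d) (g : Lp ℝ d (volume : Measure ℝ)) :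
    ‖g‖ ^ d = ∫ v, g v ^ d := by
  have hd0 : (d : ℝ≥0∞) ≠ 0 := by exact_mod_cast (by omega : d ≠ 0)
  have h0 : 0 ≤ ∫ v, g v ^ d := integral_nonneg fun v => hd.pow_nonneg _
  rw [Lp.norm_def, (Lp.memLp g).eLpNorm_eq_integral_rpow_norm hd0 (ENNReal.natCast_ne_top d)]
  simp only [ENNReal.toReal_natCast, Real.rpow_natCast, Real.norm_eq_abs, hd.pow_abs]
  rw [ENNReal.toReal_ofReal (by positivity), ← Real.rpow_natCast, ← Real.rpow_mul h0,
    inv_mul_cancel₀ (by exact_mod_cast (by omega : d ≠ 0)), Real.rpow_one]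

variable [Fact (1 ≤ (d : ℝ≥0∞))]

lemma exists_functional (hd2 : 2 ≤ d) (g : Lp ℝ d (volume : Measure ℝ)) :
    ∃ l : Lp ℝ d (volume : Measure ℝ) →L[ℝ] ℝ, ∀ x : Lp ℝ d (volume : Measure ℝ),
      l x = ∫ v, g v ^ (d - 1) * x v ∧ Integrable fun v => g v ^ (d - 1) * x v := by
  set q : ℝ≥0∞ := d / ((d - 1 : ℕ) : ℝ≥0∞) with hq
  have hd0 : (d : ℝ≥0∞) ≠ 0 := by exact_mod_cast (by omega : d ≠ 0)
  have hd1 : ((d - 1 : ℕ) : ℝ≥0∞) ≠ 0 := by exact_mod_cast (by omega : d - 1 ≠ 0)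
  have hc : ENNReal.HolderConjugate q d := by
    rw [ENNReal.holderConjugate_iff, hq, ENNReal.inv_div (Or.inl (ENNReal.natCast_ne_top _))
      (Or.inl hd1), ← one_div, ← ENNReal.add_div]
    have : ((d - 1 : ℕ) : ℝ≥0∞) + 1 = d := by exact_mod_cast (by omega : d - 1 + 1 = d)
    rw [this]
    exact ENNReal.div_self hd0 (ENNReal.natCast_ne_top _)
  have hq1 : Fact (1 ≤ q) := ⟨by
    rw [hq, ENNReal.le_div_iff_mul_le (Or.inl hd1) (Or.inl (ENNReal.natCast_ne_top _)), one_mul]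
    exact_mod_cast (by omega : d - 1 ≤ d)⟩
  have hm : MemLp (fun v => g v ^ (d - 1)) q volume := by
    have h1 := (Lp.memLp g).norm_rpow_div ((d - 1 : ℕ) : ℝ≥0∞)
    refine MemLp.of_le h1 ((Lp.aestronglyMeasurable g).pow _) (Eventually.of_forall fun v => ?_)
    simp only [ENNReal.toReal_natCast, Real.rpow_natCast, norm_pow, norm_norm, le_refl]
  refine ⟨(ContinuousLinearMap.mul ℝ ℝ).lpPairing volume q d (hm.toLp _), fun x => ⟨?_, ?_⟩⟩
  · rw [ContinuousLinearMap.lpPairing_eq_integral]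
    refine integral_congr_ae ?_
    filter_upwards [hm.coeFn_toLp] with v hv
    simp only [ContinuousLinearMap.mul_apply', hv]
  · exact hm.integrable_mul (Lp.memLp x)

lemma norm_add_pow_le (hd : Even d) (hd2 : 2 ≤ d) (g x : Lp ℝ d (volume : Measure ℝ))
    {l : Lp ℝ d (volume : Measure ℝ) →L[ℝ] ℝ}
    (hl : l x = ∫ v, g v ^ (d - 1) * x v) (hi : Integrable fun v => g v ^ (d - 1) * x v)
    {e : ℝ} (he0 : 0 < e) (he : e ≤ 1) :
    ‖g + x‖ ^ d ≤ ‖g‖ ^ d + d * l x + 2 ^ d * (e ^ 2 * ‖g‖ ^ d + (e⁻¹) ^ (d - 2) * ‖x‖ ^ d) := by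
  have hg := integrable_pow_Lp hd hd2 g
  have hx := integrable_pow_Lp hd hd2 x
  rw [norm_pow_eq_integral hd hd2, norm_pow_eq_integral hd hd2, norm_pow_eq_integral hd hd2, hl]
  have h1 : ∫ v, (g + x : Lp ℝ d (volume : Measure ℝ)) v ^ d
      ≤ ∫ v, (g v ^ d + d * (g v ^ (d - 1) * x v)
        + 2 ^ d * (e ^ 2 * g v ^ d + (e⁻¹) ^ (d - 2) * x v ^ d)) := by
    refine integral_mono_ae (integrable_pow_Lp hd hd2 _) ?_ ?_
    · exact (hg.add (hi.const_mul _)).add (((hg.const_mul _).add (hx.const_mul _)).const_mul _)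
    · filter_upwards [Lp.coeFn_add g x] with v hv
      rw [hv]
      exact add_pow_le_of_even hd hd2 he0 he _ _
  refine h1.trans (le_of_eq ?_)
  have hA : Integrable fun v => g v ^ d + d * (g v ^ (d - 1) * x v) := hg.add (hi.const_mul _)
  have hB : Integrable fun v => 2 ^ d * (e ^ 2 * g v ^ d + (e⁻¹) ^ (d - 2) * x v ^ d) :=
    ((hg.const_mul _).add (hx.const_mul _)).const_mul _
  rw [integral_add hA hB, integral_add hg (hi.const_mul _),
    integral_const_mul, integral_const_mul, integral_add (hg.const_mul _) (hx.const_mul _),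
    integral_const_mul, integral_const_mul]

/-- In a direction where the duality functional is nonpositive the norm grows only to second
order. -/
lemma norm_add_le_of_functional_nonpos (hd : Even d) (hd2 : 2 ≤ d)
    (g x : Lp ℝ d (volume : Measure ℝ)) {l : Lp ℝ d (volume : Measure ℝ) →L[ℝ] ℝ}
    (hl : l x = ∫ v, g v ^ (d - 1) * x v) (hi : Integrable fun v => g v ^ (d - 1) * x v)
    {e : ℝ} (he0 : 0 < e) (he : e ≤ 1) (hlx : l x ≤ 0) (hx : ‖x‖ ≤ 2 * e * ‖g‖) :
    ‖g + x‖ ≤ (1 + 2 * 4 ^ d * e ^ 2) * ‖g‖ := by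
  have h1 := norm_add_pow_le hd hd2 g x hl hi he0 he
  have h2 : (e⁻¹) ^ (d - 2) * ‖x‖ ^ d ≤ 2 ^ d * e ^ 2 * ‖g‖ ^ d := by
    calc (e⁻¹) ^ (d - 2) * ‖x‖ ^ d ≤ (e⁻¹) ^ (d - 2) * (2 * e * ‖g‖) ^ d := by gcongr
      _ = 2 ^ d * ((e⁻¹) ^ (d - 2) * e ^ (d - 2) * e ^ 2) * ‖g‖ ^ d := by
        rw [mul_pow, mul_pow]
        have : e ^ d = e ^ (d - 2) * e ^ 2 := by rw [← pow_add]; congr 1; omega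
        rw [this]; ring
      _ = 2 ^ d * e ^ 2 * ‖g‖ ^ d := by
        rw [← mul_pow, inv_mul_cancel₀ he0.ne', one_pow, one_mul]
  have h3 : ‖g + x‖ ^ d ≤ ((1 + 2 * 4 ^ d * e ^ 2) * ‖g‖) ^ d := by
    have hgd : 0 ≤ ‖g‖ ^ d := by positivity
    have h4 : (2 : ℝ) ^ d * (e ^ 2 * ‖g‖ ^ d + (e⁻¹) ^ (d - 2) * ‖x‖ ^ d)
        ≤ 2 * 4 ^ d * e ^ 2 * ‖g‖ ^ d := by
      have h10 : 0 ≤ e ^ 2 * ‖g‖ ^ d := by positivity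
      have h5 : (1 : ℝ) ≤ 2 ^ d := one_le_pow₀ (by norm_num)
      have h6 : (4 : ℝ) ^ d = 2 ^ d * 2 ^ d := by rw [← mul_pow]; norm_num
      calc (2 : ℝ) ^ d * (e ^ 2 * ‖g‖ ^ d + (e⁻¹) ^ (d - 2) * ‖x‖ ^ d)
          ≤ 2 ^ d * (2 ^ d * (e ^ 2 * ‖g‖ ^ d) + 2 ^ d * e ^ 2 * ‖g‖ ^ d) := by
            refine mul_le_mul_of_nonneg_left ?_ (by positivity)
            exact add_le_add (le_mul_of_one_le_left h10 h5) h2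
        _ = 2 * 4 ^ d * e ^ 2 * ‖g‖ ^ d := by rw [h6]; ring
    have h7 : (d : ℝ) * l x ≤ 0 := mul_nonpos_of_nonneg_of_nonpos (by positivity) hlx
    rw [mul_pow]
    have h8 : 1 + 2 * 4 ^ d * e ^ 2 ≤ (1 + 2 * 4 ^ d * e ^ 2) ^ d := by
      refine le_self_pow₀ ?_ (by omega)
      have : 0 ≤ 2 * 4 ^ d * e ^ 2 := by positivity
      linarith
    have h9 := mul_le_mul_of_nonneg_right h8 hgd
    linarith
  exact le_of_pow_le_pow_left₀ (by omega) (by positivity) h3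

lemma exists_le_weighted_integral {a f : ℝ → ℝ} (ha : Continuous a) (hf : Continuous f) {s t : ℝ}
    (hst : s ≤ t) (ha0 : ∀ w ∈ Set.Icc s t, 0 ≤ a w) (ha1 : ∫ w in s..t, a w = 1) :
    ∃ q ∈ Set.Icc s t, f q ≤ ∫ w in s..t, a w * f w := by
  obtain ⟨q, hq, hmin⟩ := isCompact_Icc.exists_isMinOn (Set.nonempty_Icc.2 hst)
    hf.continuousOn
  refine ⟨q, hq, ?_⟩
  have h1 : ∫ w in s..t, a w * f q ≤ ∫ w in s..t, a w * f w :=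
    intervalIntegral.integral_mono_on hst ((ha.mul continuous_const).intervalIntegrable _ _)
      ((ha.mul hf).intervalIntegrable _ _) fun w hw =>
        mul_le_mul_of_nonneg_left (hmin hw) (ha0 w hw)
  rwa [intervalIntegral.integral_mul_const, ha1, one_mul] at h1

/-- One greedy step: the continuous prime mass of a cell is replaced by one prime with
quadratically small growth of the norm. -/
lemma exists_greedy_step (hd : Even d) (hd2 : 2 ≤ d) {a : ℝ → ℝ} (ha : Continuous a) {σ : ℝ}
    (hσ : 0 ≤ σ) {b : ℝ → ℝ} (hb : Continuous b) (hab : ∀ w, b w = a w * Real.exp (-(σ * w)))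
    {s t : ℝ} (hst : s ≤ t) (ha0 : ∀ w ∈ Set.Icc s t, 0 ≤ a w) (ha1 : ∫ w in s..t, a w = 1)
    {e0 : ℝ} (he0 : e0 < 1) (hes : Real.exp (-(σ * s)) ≤ e0) (g : Lp ℝ d (volume : Measure ℝ)) :
    ∃ q ∈ Set.Icc s t, ∃ g' : Lp ℝ d (volume : Measure ℝ),
      (1 - Real.exp (-(σ * q)) • shift q) g'
        = NormedSpace.exp (-(shiftInt (d : ℝ≥0∞) (ENNReal.natCast_ne_top d) hb s t)) g ∧
      ‖g'‖ ≤ (1 + (2 * 4 ^ d + 3 / (1 - e0)) * Real.exp (-(σ * s)) ^ 2) * ‖g‖ := by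
  set e := Real.exp (-(σ * s)) with he
  set D := shiftInt (d : ℝ≥0∞) (ENNReal.natCast_ne_top d) hb s t with hD
  obtain ⟨l, hl⟩ := exists_functional hd2 g
  have hcont : Continuous fun w => l (Real.exp (-(σ * w)) • shift w g) :=
    l.continuous.comp ((by fun_prop : Continuous fun w : ℝ => Real.exp (-(σ * w))).smul
      (continuous_shift (ENNReal.natCast_ne_top d) g))
  obtain ⟨q, hq, hqle⟩ := exists_le_weighted_integral ha hcont hst ha0 ha1
  have hlD : l (D g) = ∫ w in s..t, a w * l (Real.exp (-(σ * w)) • shift w g) := by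
    rw [hD, map_shiftInt]
    refine intervalIntegral.integral_congr fun w _ => ?_
    simp only [map_smul, smul_eq_mul, hab]
    ring
  rw [← hlD] at hqle
  set U := Real.exp (-(σ * q)) • (shift q : Lp ℝ d (volume : Measure ℝ) →L[ℝ] _) with hU
  have hUn : ‖U‖ ≤ e := by
    rw [hU, norm_smul, Real.norm_of_nonneg (Real.exp_pos _).le]
    have h1 : ‖(shift q : Lp ℝ d (volume : Measure ℝ) →L[ℝ] _)‖ ≤ 1 :=
      ContinuousLinearMap.opNorm_le_bound _ zero_le_one fun g => by
        rw [norm_shift_apply, one_mul]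
    have h2 : Real.exp (-(σ * q)) ≤ e := by
      rw [he]; apply Real.exp_le_exp.2; nlinarith [hq.1]
    calc _ ≤ e * 1 := mul_le_mul h2 h1 (norm_nonneg _) (Real.exp_pos _).le
      _ = e := mul_one _
  have hDn : ‖D‖ ≤ e := by
    refine norm_shiftInt_le _ _ hst ?_
    have h1 : ∫ w in s..t, |b w| ≤ ∫ w in s..t, a w * e := by
      refine intervalIntegral.integral_mono_on hst (hb.abs.intervalIntegrable _ _)
        ((ha.mul continuous_const).intervalIntegrable _ _) fun w hw => ?_
      rw [hab, abs_mul, abs_of_nonneg (ha0 w hw), abs_of_nonneg (Real.exp_pos _).le, he]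
      refine mul_le_mul_of_nonneg_left (Real.exp_le_exp.2 ?_) (ha0 w hw)
      nlinarith [hw.1]
    rwa [intervalIntegral.integral_mul_const, ha1, one_mul] at h1
  obtain ⟨g', hg', hn⟩ := exists_replace he0 hes hUn hDn g
  refine ⟨q, hq, g', hg', ?_⟩
  have he1 : e ≤ 1 := hes.trans he0.le
  have hx : ‖U g - D g‖ ≤ 2 * e * ‖g‖ := by
    refine (norm_sub_le _ _).trans ?_
    have h1 := U.le_of_opNorm_le hUn g
    have h2 := D.le_of_opNorm_le hDn g
    linarith
  have hlx : l (U g - D g) ≤ 0 := by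
    rw [map_sub]
    have : U g = Real.exp (-(σ * q)) • shift q g := rfl
    rw [this]
    linarith
  have h1 := norm_add_le_of_functional_nonpos hd hd2 g (U g - D g) (hl _).1 (hl _).2
    (Real.exp_pos _) he1 hlx hx
  have h2 : ‖g'‖ ≤ ‖g' - (g + (U g - D g))‖ + ‖g + (U g - D g)‖ := norm_le_norm_sub_add _ _
  have h3 : (1 + (2 * 4 ^ d + 3 / (1 - e0)) * e ^ 2) * ‖g‖
      = 3 * e ^ 2 / (1 - e0) * ‖g‖ + (1 + 2 * 4 ^ d * e ^ 2) * ‖g‖ := by ring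
  linarith

end Greedy

section Evaluation

variable {d : ℕ}

/-- The state `g` agrees on `v < L` with the weighted error term of a counting function `f`
with density `c`. -/
def Represents (κ L : ℝ) (f : ℝ → ℝ) (c : ℝ) (g : Lp ℝ d (volume : Measure ℝ)) : Prop :=
  ∀ᵐ v, v < L → g v = ((if 0 ≤ v then f v else 0) - c) * Real.exp (κ * v)

lemma Represents.add {κ L : ℝ} {f f' : ℝ → ℝ} {c c' : ℝ} {g g' : Lp ℝ d (volume : Measure ℝ)}
    (h : Represents κ L f c g) (h' : Represents κ L f' c' g') :
    Represents κ L (fun v => f v + f' v) (c + c') (g + g') := by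
  filter_upwards [h, h', Lp.coeFn_add g g'] with v h1 h2 h3 hv
  rw [h3, Pi.add_apply, h1 hv, h2 hv]
  split_ifs <;> ring

lemma Represents.smul {κ L : ℝ} {f : ℝ → ℝ} {c : ℝ} {g : Lp ℝ d (volume : Measure ℝ)}
    (h : Represents κ L f c g) (r : ℝ) :
    Represents κ L (fun v => r * f v) (r * c) (r • g) := by
  filter_upwards [h, Lp.coeFn_smul r g] with v h1 h3 hv
  rw [h3, Pi.smul_apply, h1 hv, smul_eq_mul]
  split_ifs <;> ring

variable [Fact (1 ≤ (d : ℝ≥0∞))]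

lemma exists_setIntegral_clm (hd2 : 2 ≤ d) {S : Set ℝ} (hS : MeasurableSet S)
    (hSf : volume S ≠ ⊤) :
    ∃ l : Lp ℝ d (volume : Measure ℝ) →L[ℝ] ℝ, ∀ x : Lp ℝ d (volume : Measure ℝ),
      l x = ∫ v in S, x v := by
  set g : Lp ℝ d (volume : Measure ℝ) :=
    (memLp_indicator_const (d : ℝ≥0∞) hS (1 : ℝ) (Or.inr hSf)).toLp _ with hg
  obtain ⟨l, hl⟩ := exists_functional hd2 g
  refine ⟨l, fun x => ?_⟩
  rw [(hl x).1, ← integral_indicator hS]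
  refine integral_congr_ae ?_
  filter_upwards [(memLp_indicator_const (d : ℝ≥0∞) hS (1 : ℝ) (Or.inr hSf)).coeFn_toLp] with v hv
  rw [hg, hv]
  by_cases h : v ∈ S
  · simp [h]
  · have : d - 1 ≠ 0 := by omega
    simp [h, this]

/-- Almost everywhere evaluation of an `L^d`-valued integral. -/
lemma integral_Lp_ae_eq (hd2 : 2 ≤ d) {F : ℝ → Lp ℝ d (volume : Measure ℝ)} (hF : Continuous F)
    {K : ℝ → ℝ → ℝ} (hK : Measurable (Function.uncurry K)) {s t L M : ℝ} (hst : s ≤ t)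
    (hFK : ∀ w ∈ Set.Icc s t, ∀ᵐ v, v < L → F w v = K w v)
    (hM : ∀ w ∈ Set.Icc s t, ∀ v, v < L → |K w v| ≤ M) :
    ∀ᵐ v, v < L → (∫ w in s..t, F w) v = ∫ w in s..t, K w v := by
  have hmem : ∀ᵐ v ∂(volume.restrict (Set.Iio L)),
      (∫ w in s..t, F w) v = ∫ w in s..t, K w v := by
    have hd1 : (1 : ℝ≥0∞) ≤ d := Fact.out
    have hgm : StronglyMeasurable fun v => ∫ w in s..t, K w v := by
      have : StronglyMeasurable fun v => ∫ w in Set.Ioc s t, K w v :=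
        StronglyMeasurable.integral_prod_right (f := fun v w => K w v)
          (hK.comp measurable_swap).stronglyMeasurable
      simpa only [intervalIntegral.integral_of_le hst] using this
    have hIcc : Set.Ioc s t ⊆ Set.Icc s t := Set.Ioc_subset_Icc_self
    refine ae_eq_of_forall_setIntegral_eq_of_sigmaFinite ?_ ?_ ?_
    · intro S hS hSf
      have : IsFiniteMeasure ((volume.restrict (Set.Iio L)).restrict S) :=
        ⟨by rwa [Measure.restrict_apply_univ]⟩
      exact (((Lp.memLp (∫ w in s..t, F w)).restrict _).restrict S).integrable hd1
    · intro S hS hSf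
      refine Measure.integrableOn_of_bounded (M := M * |t - s|) hSf.ne hgm.aestronglyMeasurable ?_
      refine ae_restrict_of_ae ?_
      filter_upwards [ae_restrict_mem measurableSet_Iio] with v hv
      refine intervalIntegral.norm_integral_le_of_norm_le_const fun w hw => ?_
      rw [Set.uIoc_of_le hst] at hw
      exact hM w (hIcc hw) v hv
    · intro S hS hSf
      rw [Measure.restrict_apply hS] at hSf
      rw [Measure.restrict_restrict hS]
      set S' := S ∩ Set.Iio L with hS'
      have hS'm : MeasurableSet S' := hS.inter measurableSet_Iio
      obtain ⟨l, hl⟩ := exists_setIntegral_clm hd2 hS'm hSf.ne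
      rw [← hl, ← l.intervalIntegral_comp_comm (hF.intervalIntegrable _ _)]
      have h1 : ∫ w in s..t, l (F w) = ∫ w in s..t, ∫ v in S', K w v := by
        refine intervalIntegral.integral_congr fun w hw => ?_
        rw [Set.uIcc_of_le hst] at hw
        simp only [hl]
        refine setIntegral_congr_ae hS'm ?_
        filter_upwards [hFK w hw] with v hv hvS
        exact hv hvS.2
      rw [h1]
      simp only [intervalIntegral.integral_of_le hst]
      refine integral_integral_swap ?_
      have : IsFiniteMeasure (volume.restrict S') := ⟨by rwa [Measure.restrict_apply_univ]⟩
      refine Integrable.of_bound hK.aestronglyMeasurable M ?_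
      rw [Measure.prod_restrict]
      refine ae_restrict_of_forall_mem (measurableSet_Ioc.prod hS'm) fun q hq => ?_
      exact hM q.1 (hIcc hq.1) q.2 hq.2.2
  exact (ae_restrict_iff' measurableSet_Iio).1 hmem

lemma Represents.of_tendsto {κ L : ℝ} {f : ℕ → ℝ → ℝ} {c : ℕ → ℝ}
    {g : ℕ → Lp ℝ d (volume : Measure ℝ)} {f' : ℝ → ℝ} {c' : ℝ} {g' : Lp ℝ d (volume : Measure ℝ)}
    (h : ∀ r, Represents κ L (f r) (c r) (g r))
    (hf : ∀ v, 0 ≤ v → Tendsto (fun r => f r v) atTop (𝓝 (f' v)))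
    (hc : Tendsto c atTop (𝓝 c')) (hg : Tendsto g atTop (𝓝 g')) :
    Represents κ L f' c' g' := by
  obtain ⟨ns, hns, hae⟩ := (tendstoInMeasure_of_tendsto_Lp hg).exists_seq_tendsto_ae
  have hall : ∀ᵐ v, ∀ r, v < L → g r v
      = ((if 0 ≤ v then f r v else 0) - c r) * Real.exp (κ * v) := ae_all_iff.2 h
  filter_upwards [hae, hall] with v h1 h2 hv
  refine tendsto_nhds_unique h1 ?_
  simp only [h2 _ hv]
  refine Tendsto.mul_const _ (Tendsto.sub ?_ (hc.comp hns.tendsto_atTop))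
  split_ifs with h0
  · exact (hf v h0).comp hns.tendsto_atTop
  · exact tendsto_const_nhds

lemma Represents.conv_shiftInt (hd2 : 2 ≤ d) {κ L : ℝ} (hL : 0 ≤ L) (hκ : 0 ≤ κ) {f p b : ℝ → ℝ}
    (hf : Continuous f) (hp : Continuous p) (hb : Continuous b)
    (hbp : ∀ w, b w = p w * Real.exp (κ * w)) {c : ℝ} {g : Lp ℝ d (volume : Measure ℝ)}
    (h : Represents κ L f c g) :
    Represents κ L (conv p f) ((∫ w in (0 : ℝ)..L, p w) * c)
      (shiftInt (d : ℝ≥0∞) (ENNReal.natCast_ne_top d) hb 0 L g) := by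
  set K : ℝ → ℝ → ℝ := fun w v => p w * ((if 0 ≤ v - w then f (v - w) else 0) - c)
    * Real.exp (κ * v) with hKdef
  have hKm : Measurable (Function.uncurry K) := by
    have h1 : Measurable fun q : ℝ × ℝ => if 0 ≤ q.2 - q.1 then f (q.2 - q.1) else 0 :=
      Measurable.ite (measurableSet_le measurable_const (measurable_snd.sub measurable_fst))
        (hf.measurable.comp (measurable_snd.sub measurable_fst)) measurable_const
    exact ((hp.measurable.comp measurable_fst).mul (h1.sub measurable_const)).mul
      (by fun_prop)
  obtain ⟨Cp, hCp⟩ := isCompact_Icc.exists_bound_of_continuousOn (s := Set.Icc 0 L) hp.continuousOn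
  obtain ⟨Cf, hCf⟩ := isCompact_Icc.exists_bound_of_continuousOn (s := Set.Icc 0 L) hf.continuousOn
  have hCp0 : 0 ≤ Cp := (norm_nonneg _).trans (hCp 0 ⟨le_rfl, hL⟩)
  have hCf0 : 0 ≤ Cf := (norm_nonneg _).trans (hCf 0 ⟨le_rfl, hL⟩)
  have hcont : Continuous fun w => b w • shift w g :=
    hb.smul (continuous_shift (ENNReal.natCast_ne_top d) g)
  have hmain := integral_Lp_ae_eq hd2 hcont hKm (L := L) (M := Cp * (Cf + |c|) * Real.exp (κ * L))
    hL ?_ ?_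
  · filter_upwards [hmain] with v hv hvL
    rw [shiftInt_apply, hv hvL]
    simp only [hKdef]
    rw [intervalIntegral.integral_mul_const]
    congr 1
    have hsplit : ∀ x y, x ≤ y → (∀ w ∈ Set.Ioc x y, w ≤ v) →
        ∫ w in x..y, p w * ((if 0 ≤ v - w then f (v - w) else 0) - c)
          = ∫ w in x..y, p w * (f (v - w) - c) := fun x y hxy hw => by
      refine intervalIntegral.integral_congr_ae (Eventually.of_forall fun w hw' => ?_)
      rw [Set.uIoc_of_le hxy] at hw'
      rw [if_pos (by linarith [hw w hw'])]
    have hsplit2 : ∀ x y, x ≤ y → (∀ w ∈ Set.Ioc x y, v < w) →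
        ∫ w in x..y, p w * ((if 0 ≤ v - w then f (v - w) else 0) - c)
          = ∫ w in x..y, p w * -c := fun x y hxy hw => by
      refine intervalIntegral.integral_congr_ae (Eventually.of_forall fun w hw' => ?_)
      rw [Set.uIoc_of_le hxy] at hw'
      rw [if_neg (by linarith [hw w hw']), zero_sub]
    by_cases h0 : 0 ≤ v
    · rw [if_pos h0, conv_comm, conv]
      have hi1 : IntervalIntegrable (fun w => p w * ((if 0 ≤ v - w then f (v - w) else 0) - c))
          volume 0 v := by
        refine IntervalIntegrable.congr (f := fun w => p w * (f (v - w) - c)) ?_ ?_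
        · intro w hw'
          rw [Set.uIoc_of_le h0] at hw'
          simp only
          rw [if_pos (by linarith [hw'.2])]
        · exact Continuous.intervalIntegrable (by fun_prop) _ _
      have hi2 : IntervalIntegrable (fun w => p w * ((if 0 ≤ v - w then f (v - w) else 0) - c))
          volume v L := by
        refine IntervalIntegrable.congr (f := fun w => p w * -c) ?_ ?_
        · intro w hw'
          rw [Set.uIoc_of_le hvL.le] at hw'
          simp only
          rw [if_neg (by linarith [hw'.1]), zero_sub]
        · exact Continuous.intervalIntegrable (by fun_prop) _ _
      rw [← intervalIntegral.integral_add_adjacent_intervals hi1 hi2,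
        hsplit 0 v h0 (fun w hw => hw.2), hsplit2 v L hvL.le (fun w hw => hw.1)]
      rw [← intervalIntegral.integral_add_adjacent_intervals (hp.intervalIntegrable 0 v)
        (hp.intervalIntegrable v L), intervalIntegral.integral_mul_const]
      have h2 : ∫ w in (0 : ℝ)..v, p w * (f (v - w) - c)
          = (∫ w in (0 : ℝ)..v, f (v - w) * p w) - (∫ w in (0 : ℝ)..v, p w) * c := by
        rw [← intervalIntegral.integral_mul_const, ← intervalIntegral.integral_sub
          (Continuous.intervalIntegrable (by fun_prop) _ _)
          (Continuous.intervalIntegrable (by fun_prop) _ _)]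
        exact intervalIntegral.integral_congr fun w _ => by ring
      rw [h2]; ring
    · rw [if_neg h0, hsplit2 0 L hL fun w hw => by linarith [hw.1, not_le.1 h0],
        intervalIntegral.integral_mul_const]
      ring
  · intro w hw
    filter_upwards [Lp.coeFn_smul (b w) (shift w g), shift_ae w g, ae_comp_sub h w] with v h1 h2 h3 hv
    rw [h1, Pi.smul_apply, h2, h3 (by linarith [hw.1]), smul_eq_mul, hbp, hKdef]
    have : Real.exp (κ * v) = Real.exp (κ * w) * Real.exp (κ * (v - w)) := by
      rw [← Real.exp_add]; congr 1; ring
    simp only [this]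
    ring
  · intro w hw v hv
    rw [hKdef]
    simp only [abs_mul]
    have h1 : |p w| ≤ Cp := hCp w hw
    have h2 : |(if 0 ≤ v - w then f (v - w) else 0) - c| ≤ Cf + |c| := by
      refine (abs_sub _ _).trans (add_le_add ?_ le_rfl)
      split_ifs with h0
      · exact hCf _ ⟨h0, by linarith [hw.1]⟩
      · simpa using hCf0
    have h3 : |Real.exp (κ * v)| ≤ Real.exp (κ * L) := by
      rw [abs_of_pos (Real.exp_pos _)]
      exact Real.exp_le_exp.2 (mul_le_mul_of_nonneg_left hv.le hκ)
    gcongr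

/-- Removing all primes below `e^L` leaves only the integer `1` on `v < L`. -/
lemma Represents.exp_neg (hd2 : 2 ≤ d) {κ L : ℝ} (hL : 0 ≤ L) (hκ : 0 ≤ κ) {n p b : ℝ → ℝ}
    (hn : Continuous n) (hp : Continuous p) (hb : Continuous b) (hn0 : n 0 = 1)
    (hmul : ∀ v, v * n v = conv n (fun w => w * p w + Real.exp (-w)) v)
    (hbp : ∀ w, b w = p w * Real.exp (κ * w)) {c : ℝ} {g : Lp ℝ d (volume : Measure ℝ)}
    (h : Represents κ L n c g) :
    Represents κ L (fun v => Real.exp (-v)) (Real.exp (-∫ w in (0 : ℝ)..L, p w) * c)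
      (NormedSpace.exp (-shiftInt (d : ℝ≥0∞) (ENNReal.natCast_ne_top d) hb 0 L) g) := by
  set D := shiftInt (d : ℝ≥0∞) (ENNReal.natCast_ne_top d) hb 0 L with hD
  set I := ∫ w in (0 : ℝ)..L, p w with hI
  have hpow : ∀ r, Represents κ L (convPow p n r) (I ^ r * c) ((D ^ r) g) := by
    intro r
    induction r with
    | zero => simpa [convPow_zero] using h
    | succ r ih =>
      have := ih.conv_shiftInt hd2 hL hκ (continuous_convPow hp hn r) hp hb hbp
      rw [convPow_succ, pow_succ', pow_succ', mul_assoc]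
      exact this
  have hsum : ∀ R : ℕ, Represents κ L
      (fun v => ∑ r ∈ Finset.range R, (-1) ^ r / (r.factorial : ℝ) * convPow p n r v)
      (∑ r ∈ Finset.range R, (-1) ^ r / (r.factorial : ℝ) * (I ^ r * c))
      (∑ r ∈ Finset.range R, ((-1) ^ r / (r.factorial : ℝ)) • (D ^ r) g) := by
    intro R
    induction R with
    | zero =>
      filter_upwards [Lp.coeFn_zero ℝ (d : ℝ≥0∞) (volume : Measure ℝ)] with v _ _
      simp
    | succ R ih =>
      simp only [Finset.sum_range_succ]
      exact ih.add ((hpow R).smul _)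
  refine Represents.of_tendsto hsum (fun v hv => ?_) ?_ ?_
  · exact (hasSum_convPow hp hn hn0 hmul hv).tendsto_sum_nat
  · have h1 := NormedSpace.exp_series_hasSum_exp' (𝕂 := ℝ) (-I)
    rw [← Real.exp_eq_exp_ℝ] at h1
    refine (h1.mul_right c).tendsto_sum_nat.congr fun R => Finset.sum_congr rfl fun r _ => ?_
    rw [neg_pow, smul_eq_mul]
    ring
  · have h1 := (NormedSpace.exp_series_hasSum_exp' (𝕂 := ℝ) (-D)).tendsto_sum_nat
    have h2 := ((ContinuousLinearMap.apply ℝ (Lp ℝ d (volume : Measure ℝ)) g).continuous.tendsto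
      _).comp h1
    refine h2.congr fun R => ?_
    simp only [Function.comp_apply, map_sum, map_smul, ContinuousLinearMap.apply_apply]
    refine Finset.sum_congr rfl fun r _ => ?_
    rw [neg_pow, div_eq_inv_mul, mul_smul]
    congr 1
    rcases Nat.even_or_odd r with h3 | h3
    · simp [h3.neg_one_pow]
    · simp [h3.neg_one_pow]

end Evaluation

namespace BeurlingSystem

variable (S : BeurlingSystem)

lemma p_pos (k : ℕ) : 0 < S.p k := one_pos.trans (S.one_lt_p k)

lemma one_le_val (n : ℕ →₀ ℕ) : 1 ≤ S.val n :=
  Finset.prod_induction _ (fun y : ℝ => 1 ≤ y) (fun _ _ ha hb => one_le_mul_of_one_le_of_one_le ha hb)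
    le_rfl fun k _ => one_le_pow₀ (S.one_lt_p k).le

lemma val_add (m n : ℕ →₀ ℕ) : S.val (m + n) = S.val m * S.val n :=
  Finsupp.prod_add_index' (fun _ => pow_zero _) fun _ _ _ => pow_add _ _ _

lemma val_single (k m : ℕ) : S.val (Finsupp.single k m) = S.p k ^ m :=
  Finsupp.prod_single_index (pow_zero _)

lemma val_zero : S.val 0 = 1 := Finsupp.prod_zero_index

lemma pow_le_val (n : ℕ →₀ ℕ) (k : ℕ) : S.p k ^ n k ≤ S.val n := by
  have h : n = n.erase k + Finsupp.single k (n k) := (Finsupp.erase_add_single k n).symm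
  rw [h, val_add, val_single, ← h]
  exact le_mul_of_one_le_left (pow_nonneg (S.p_pos k).le _) (S.one_le_val _)

lemma finite_setOf_val_le (x : ℝ) : {n : ℕ →₀ ℕ | S.val n ≤ x}.Finite := by
  obtain ⟨J, hJ⟩ := (S.p_tendsto.eventually_gt_atTop x).exists_forall_of_atTop
  obtain ⟨M, hM⟩ := pow_unbounded_of_one_lt x (S.one_lt_p 0)
  refine (Set.finite_Iic (Finsupp.indicator (Finset.range J) fun _ _ => M)).subset ?_
  intro n hn k
  have h1 : S.p k ^ n k ≤ x := (S.pow_le_val n k).trans hn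
  rw [Finsupp.indicator_apply]
  split_ifs with hk
  · by_contra! hlt
    have h2 : S.p 0 ^ M ≤ S.p k ^ n k :=
      (pow_le_pow_left₀ (S.p_pos 0).le (S.p_mono (Nat.zero_le k)) M).trans
        (pow_le_pow_right₀ (S.one_lt_p k).le hlt.le)
    linarith
  · rw [Finset.mem_range, not_lt] at hk
    by_contra! hlt
    have h2 : S.p k ≤ S.p k ^ n k := le_self_pow₀ (S.one_lt_p k).le (by omega)
    linarith [hJ k hk]

/-- The number of generalized integers up to `x` composed of the first `J` primes only. -/
noncomputable def partialCnt (J : ℕ) (x : ℝ) : ℝ :=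
  (Set.ncard {n : ℕ →₀ ℕ | n.support ⊆ Finset.range J ∧ S.val n ≤ x} : ℝ)

lemma finite_partial (J : ℕ) (x : ℝ) :
    {n : ℕ →₀ ℕ | n.support ⊆ Finset.range J ∧ S.val n ≤ x}.Finite :=
  (S.finite_setOf_val_le x).subset fun _ h => h.2

lemma partialCnt_nonneg (J : ℕ) (x : ℝ) : 0 ≤ S.partialCnt J x := Nat.cast_nonneg _

lemma partialCnt_mono (J : ℕ) : Monotone (S.partialCnt J) := fun x y hxy => by
  unfold partialCnt
  have h : {n : ℕ →₀ ℕ | n.support ⊆ Finset.range J ∧ S.val n ≤ x}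
      ⊆ {n | n.support ⊆ Finset.range J ∧ S.val n ≤ y} := fun n hn => ⟨hn.1, hn.2.trans hxy⟩
  exact_mod_cast Set.ncard_le_ncard h (S.finite_partial J y)

lemma cnt_mono : Monotone S.cnt := fun x y hxy => by
  unfold cnt
  have h : {n : ℕ →₀ ℕ | S.val n ≤ x} ⊆ {n | S.val n ≤ y} := fun n hn => le_trans hn hxy
  exact_mod_cast Set.ncard_le_ncard h (S.finite_setOf_val_le y)

lemma partialCnt_of_lt_one (J : ℕ) {x : ℝ} (hx : x < 1) : S.partialCnt J x = 0 := by
  have : {n : ℕ →₀ ℕ | n.support ⊆ Finset.range J ∧ S.val n ≤ x} = ∅ := by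
    ext n
    simp only [Set.mem_ofPred_eq, Set.mem_empty_iff_false, iff_false, not_and, not_le]
    exact fun _ => hx.trans_le (S.one_le_val n)
  rw [partialCnt, this, Set.ncard_empty, Nat.cast_zero]

lemma partialCnt_zero {x : ℝ} (hx : 1 ≤ x) : S.partialCnt 0 x = 1 := by
  have : {n : ℕ →₀ ℕ | n.support ⊆ Finset.range 0 ∧ S.val n ≤ x} = {0} := by
    ext n
    simp only [Finset.range_zero, Finset.subset_empty, Finsupp.support_eq_empty, Set.mem_ofPred_eq,
      Set.mem_singleton_iff, and_iff_left_iff_imp]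
    rintro rfl
    rwa [val_zero]
  rw [partialCnt, this, Set.ncard_singleton, Nat.cast_one]

lemma partialCnt_succ (J : ℕ) (x : ℝ) :
    S.partialCnt (J + 1) x = S.partialCnt J x + S.partialCnt (J + 1) (x / S.p J) := by
  set T := {n : ℕ →₀ ℕ | n.support ⊆ Finset.range (J + 1) ∧ S.val n ≤ x / S.p J} with hT
  have hunion : {n : ℕ →₀ ℕ | n.support ⊆ Finset.range (J + 1) ∧ S.val n ≤ x}
      = {n : ℕ →₀ ℕ | n.support ⊆ Finset.range J ∧ S.val n ≤ x}
        ∪ (fun n => n + Finsupp.single J 1) '' T := by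
    ext n
    simp only [Set.mem_ofPred_eq, Set.mem_union, Set.mem_image, hT]
    constructor
    · rintro ⟨h1, h2⟩
      by_cases h0 : n J = 0
      · refine Or.inl ⟨fun k hk => ?_, h2⟩
        have := Finset.mem_range.1 (h1 hk)
        rcases Nat.lt_succ_iff_lt_or_eq.1 this with h | rfl
        · exact Finset.mem_range.2 h
        · exact absurd h0 (Finsupp.mem_support_iff.1 hk)
      · have hle : Finsupp.single J 1 ≤ n := by
          rw [Finsupp.single_le_iff]; omega
        have hsub : n - Finsupp.single J 1 + Finsupp.single J 1 = n := tsub_add_cancel_of_le hle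
        refine Or.inr ⟨n - Finsupp.single J 1, ⟨(Finsupp.support_tsub.trans h1), ?_⟩, hsub⟩
        rw [le_div_iff₀ (S.p_pos J)]
        rw [← hsub, val_add, val_single, pow_one] at h2
        exact h2
    · rintro (⟨h1, h2⟩ | ⟨m, ⟨h1, h2⟩, rfl⟩)
      · exact ⟨h1.trans (Finset.range_subset_range.2 (Nat.le_succ J)), h2⟩
      · refine ⟨Finsupp.support_add.trans (Finset.union_subset h1 ?_), ?_⟩
        · exact Finsupp.support_single_subset.trans (by simp)
        · rw [val_add, val_single, pow_one]
          exact (le_div_iff₀ (S.p_pos J)).1 h2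
  have hdisj : Disjoint {n : ℕ →₀ ℕ | n.support ⊆ Finset.range J ∧ S.val n ≤ x}
      ((fun n => n + Finsupp.single J 1) '' T) := by
    rw [Set.disjoint_left]
    rintro _ ⟨h1, -⟩ ⟨m, -, rfl⟩
    have : J ∈ (m + Finsupp.single J 1).support := by
      rw [Finsupp.mem_support_iff]; simp
    exact absurd (Finset.mem_range.1 (h1 this)) (lt_irrefl _)
  have hTf : T.Finite := S.finite_partial _ _
  rw [partialCnt, hunion, Set.ncard_union_eq hdisj (S.finite_partial J x) (hTf.image _),
    Set.ncard_image_of_injective _ (add_left_injective _), Nat.cast_add]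
  rfl

lemma partialCnt_eq_cnt {J : ℕ} {x : ℝ} (hx : x < S.p J) : S.partialCnt J x = S.cnt x := by
  have : {n : ℕ →₀ ℕ | n.support ⊆ Finset.range J ∧ S.val n ≤ x} = {n | S.val n ≤ x} := by
    ext n
    simp only [Set.mem_ofPred_eq, and_iff_right_iff_imp]
    intro h k hk
    rw [Finset.mem_range]
    by_contra! hJ
    have h1 : S.p k ≤ S.p k ^ n k :=
      le_self_pow₀ (S.one_lt_p k).le (Finsupp.mem_support_iff.1 hk)
    linarith [S.pow_le_val n k, S.p_mono hJ]
  rw [partialCnt, cnt, this]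

/-- The generalized primes in `(x, y]`, by index. -/
def primesIn (x y : ℝ) : Set ℕ := {k | x < S.p k ∧ S.p k ≤ y}

lemma finite_primesIn (x y : ℝ) : (S.primesIn x y).Finite := by
  obtain ⟨J, hJ⟩ := (S.p_tendsto.eventually_gt_atTop y).exists_forall_of_atTop
  refine (Set.finite_lt_nat J).subset fun k hk => ?_
  by_contra! h
  linarith [hk.2, hJ k (not_lt.1 h)]

lemma ncard_primesIn_le_cnt (x y : ℝ) : ((S.primesIn x y).ncard : ℝ) ≤ S.cnt y := by
  unfold cnt
  have : (S.primesIn x y).ncard ≤ {n : ℕ →₀ ℕ | S.val n ≤ y}.ncard :=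
    Set.ncard_le_ncard_of_injOn (fun k => Finsupp.single k 1)
      (fun k hk => by
        show S.val (Finsupp.single k 1) ≤ y
        rw [val_single, pow_one]; exact hk.2)
      (fun k _ l _ h => Finsupp.single_left_injective one_ne_zero h) (S.finite_setOf_val_le y)
  exact_mod_cast this

section PrimeCount

variable {A : ℝ → ℝ} (hA : Monotone A)
  (hp : ∀ k : ℕ, (k : ℝ) ≤ A (Real.log (S.p k)) ∧ A (Real.log (S.p k)) ≤ k + 1)

include hA hp

lemma ncard_primesIn_le {x y : ℝ} (hx : 0 < x) (hxy : x ≤ y) :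
    ((S.primesIn x y).ncard : ℝ) ≤ A (Real.log y) - A (Real.log x) + 3 := by
  have hAxy : A (Real.log x) ≤ A (Real.log y) := hA (Real.log_le_log hx hxy)
  have h1 : S.primesIn x y ⊆ (Finset.Icc ⌈A (Real.log x) - 1⌉₊ ⌊A (Real.log y)⌋₊ : Set ℕ) := by
    rintro k ⟨hk1, hk2⟩
    rw [Finset.coe_Icc]
    have h2 : A (Real.log x) ≤ A (Real.log (S.p k)) := hA (Real.log_le_log hx hk1.le)
    have h3 : A (Real.log (S.p k)) ≤ A (Real.log y) := hA (Real.log_le_log (S.p_pos k) hk2)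
    exact ⟨Nat.ceil_le.2 (by linarith [(hp k).2]), Nat.le_floor (by linarith [(hp k).1])⟩
  have h2 := Set.ncard_le_ncard h1 (Finset.finite_toSet _)
  rw [Set.ncard_coe_finset, Nat.card_Icc] at h2
  have h3 : ((S.primesIn x y).ncard : ℝ)
      ≤ ((⌊A (Real.log y)⌋₊ + 1 - ⌈A (Real.log x) - 1⌉₊ : ℕ) : ℝ) := by exact_mod_cast h2
  refine h3.trans ?_
  rcases le_total ⌈A (Real.log x) - 1⌉₊ (⌊A (Real.log y)⌋₊ + 1) with h | h
  · rw [Nat.cast_sub h]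
    push_cast
    have h4 := Nat.le_ceil (A (Real.log x) - 1)
    rcases le_total 0 (A (Real.log y)) with h5 | h5
    · linarith [Nat.floor_le h5]
    · rw [Nat.floor_of_nonpos h5]
      have h0 : (0 : ℝ) ≤ ⌈A (Real.log x) - 1⌉₊ := Nat.cast_nonneg _
      push_cast
      linarith
  · rw [Nat.sub_eq_zero_of_le h]
    push_cast
    linarith

lemma le_ncard_primesIn {x y : ℝ} (hy : 0 < y) (hA0 : 0 ≤ A (Real.log x)) :
    A (Real.log y) - A (Real.log x) - 3 ≤ ((S.primesIn x y).ncard : ℝ) := by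
  have h1 : (Finset.Ico (⌊A (Real.log x)⌋₊ + 1) (⌈A (Real.log y)⌉₊ - 1) : Set ℕ)
      ⊆ S.primesIn x y := by
    intro k hk
    rw [Finset.coe_Ico, Set.mem_Ico] at hk
    have h2 : A (Real.log x) < k := by
      refine (Nat.lt_floor_add_one _).trans_le ?_
      exact_mod_cast hk.1
    have h3 : (k : ℝ) + 1 < A (Real.log y) := by
      have : k + 1 < ⌈A (Real.log y)⌉₊ := by omega
      have := Nat.lt_ceil.1 this
      exact_mod_cast this
    constructor
    · by_contra! h
      have := hA (Real.log_le_log (S.p_pos k) h)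
      linarith [(hp k).1]
    · by_contra! h
      have := hA (Real.log_le_log hy h.le)
      linarith [(hp k).2]
  have h2 := Set.ncard_le_ncard h1 (S.finite_primesIn x y)
  rw [Set.ncard_coe_finset, Nat.card_Ico] at h2
  have h3 : (((⌈A (Real.log y)⌉₊ - 1) - (⌊A (Real.log x)⌋₊ + 1) : ℕ) : ℝ)
      ≤ ((S.primesIn x y).ncard : ℝ) := by exact_mod_cast h2
  refine le_trans ?_ h3
  have h4 : ((⌈A (Real.log y)⌉₊ : ℝ)) ≤ (((⌈A (Real.log y)⌉₊ - 1) - (⌊A (Real.log x)⌋₊ + 1) : ℕ) : ℝ)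
      + ⌊A (Real.log x)⌋₊ + 2 := by
    have : ⌈A (Real.log y)⌉₊ ≤ ((⌈A (Real.log y)⌉₊ - 1) - (⌊A (Real.log x)⌋₊ + 1))
      + ⌊A (Real.log x)⌋₊ + 2 := by omega
    exact_mod_cast this
  linarith [Nat.le_ceil (A (Real.log y)), Nat.floor_le hA0]

end PrimeCount

end BeurlingSystem

section Link

variable {d : ℕ}

lemma integrable_exp_neg_mul_abs {c : ℝ} (hc : 0 < c) :
    Integrable fun v : ℝ => Real.exp (-(c * |v|)) := by
  rw [← integrableOn_univ, ← Set.Iic_union_Ioi (a := (0 : ℝ))]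
  refine IntegrableOn.union ?_ ?_
  · refine (integrableOn_exp_mul_Iic hc 0).congr_fun (fun v hv => ?_) measurableSet_Iic
    simp only [abs_of_nonpos (Set.mem_Iic.1 hv), mul_neg, neg_neg]
  · refine (integrableOn_exp_mul_Ioi (neg_neg_of_pos hc) 0).congr_fun (fun v hv => ?_)
      measurableSet_Ioi
    simp only [abs_of_pos (Set.mem_Ioi.1 hv), neg_mul]

lemma memLp_of_abs_le_exp (hd : 1 ≤ d) {f : ℝ → ℝ} (hf : Measurable f) {C c : ℝ} (hc : 0 < c)
    (h : ∀ v, |f v| ≤ C * Real.exp (-(c * |v|))) : MemLp f d volume := by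
  have h0 : MemLp (fun v : ℝ => Real.exp (-(c * |v|))) d volume := by
    rw [← integrable_norm_rpow_iff (by fun_prop) (by simp; omega) (ENNReal.natCast_ne_top d)]
    have hcd : 0 < c * d := by positivity
    refine (integrable_exp_neg_mul_abs hcd).congr (Eventually.of_forall fun v => ?_)
    simp only [ENNReal.toReal_natCast, Real.norm_of_nonneg (Real.exp_pos _).le, ← Real.exp_mul]
    ring_nf
  exact h0.of_le_mul hf.aestronglyMeasurable (Eventually.of_forall fun v => by
    simpa only [Real.norm_eq_abs, Real.abs_exp] using h v)

variable [Fact (1 ≤ (d : ℝ≥0∞))]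

/-- Multiplying the zeta function by a single Euler factor: the solution of
`(1 - e^{-σq} T_q) h' = h` represents the enlarged counting function. -/
lemma Represents.of_one_sub (hd : 1 ≤ d) {σ κ L q : ℝ} (hσ : 0 < σ) (hκ : 0 < κ) (hσκ : σ + κ = 1)
    (hq : 0 < q) {f f' : ℝ → ℝ} (hf' : Measurable f') {M : ℝ}
    (hM : ∀ v, 0 ≤ v → v < L → |f' v| ≤ M)
    (hff : ∀ v, 0 ≤ v → v < L →
      f v = f' v - Real.exp (-q) * (if 0 ≤ v - q then f' (v - q) else 0))
    {c c' : ℝ} (hc : c = c' * (1 - Real.exp (-q))) {h h' : Lp ℝ d (volume : Measure ℝ)}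
    (hh : Represents κ L f c h) (hh' : (1 - Real.exp (-(σ * q)) • shift q) h' = h) :
    Represents κ L f' c' h' := by
  classical
  set y : ℝ → ℝ := fun v => ((if 0 ≤ v then f' v else 0) - c') * Real.exp (κ * v) with hy
  have hym : Measurable y := by
    refine Measurable.mul (Measurable.sub (Measurable.ite measurableSet_Ici hf' measurable_const)
      measurable_const) (by fun_prop)
  have hyL : MemLp ((Set.Iio L).indicator y) d volume := by
    refine memLp_of_abs_le_exp hd (hym.indicator measurableSet_Iio)
      (C := (|M| + |c'|) * Real.exp (2 * κ * |L|)) hκ fun v => ?_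
    by_cases hv : v < L
    · rw [Set.indicator_of_mem (Set.mem_Iio.2 hv)]
      have h1 : |(if 0 ≤ v then f' v else 0) - c'| ≤ |M| + |c'| := by
        refine (abs_sub _ _).trans (add_le_add ?_ le_rfl)
        split_ifs with h0
        · exact (hM v h0 hv).trans (le_abs_self M)
        · simp
      have h2 : Real.exp (κ * v) ≤ Real.exp (2 * κ * |L|) * Real.exp (-(κ * |v|)) := by
        rw [← Real.exp_add]
        refine Real.exp_le_exp.2 ?_
        have h3 : v + |v| ≤ 2 * |L| := by
          rcases le_total 0 v with h0 | h0
          · rw [abs_of_nonneg h0, abs_of_pos (h0.trans_lt hv)]; linarith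
          · rw [abs_of_nonpos h0]; linarith [abs_nonneg L]
        nlinarith
      rw [hy]
      simp only
      rw [abs_mul, Real.abs_exp, mul_assoc]
      exact mul_le_mul h1 h2 (Real.exp_pos _).le (by positivity)
    · rw [Set.indicator_of_notMem (by simpa using hv), abs_zero]
      positivity
  have hzL : MemLp ((Set.Iio L).indicator fun v => h' v - y v) d volume := by
    have h1 := ((Lp.memLp h').indicator (measurableSet_Iio (a := L))).sub hyL
    rwa [← Set.indicator_sub'] at h1
  set z := hzL.toLp _ with hz
  have hyq : ∀ v, v < L → y v - Real.exp (-(σ * q)) * y (v - q)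
      = ((if 0 ≤ v then f v else 0) - c) * Real.exp (κ * v) := by
    intro v hv
    have h1 : Real.exp (-(σ * q)) * Real.exp (κ * (v - q)) = Real.exp (-q) * Real.exp (κ * v) := by
      rw [← Real.exp_add, ← Real.exp_add]
      congr 1
      linear_combination -q * hσκ
    have h2 : y v - Real.exp (-(σ * q)) * y (v - q)
        = (((if 0 ≤ v then f' v else 0) - c')
          - Real.exp (-q) * ((if 0 ≤ v - q then f' (v - q) else 0) - c')) * Real.exp (κ * v) := by
      rw [hy]
      linear_combination -((if 0 ≤ v - q then f' (v - q) else 0) - c') * h1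
    rw [h2, hc]
    by_cases h0 : 0 ≤ v
    · rw [if_pos h0, if_pos h0, hff v h0 hv]; ring
    · rw [if_neg h0, if_neg h0, if_neg (by linarith)]; ring
  have hle : ‖z‖ ≤ Real.exp (-(σ * q)) * ‖shift q z‖ := by
    refine Lp.norm_le_mul_norm_of_ae_le_mul ?_
    have hcz := hzL.coeFn_toLp
    rw [← hz] at hcz
    filter_upwards [hcz, shift_ae q z, ae_comp_sub hcz q, hh,
      Lp.coeFn_sub h' (Real.exp (-(σ * q)) • shift q h'),
      Lp.coeFn_smul (Real.exp (-(σ * q))) (shift q h'), shift_ae q h'] with v h1 h2 h3 h4 h5 h6 h7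
    rw [h1, h2, h3]
    by_cases hv : v < L
    · have hvq : v - q < L := by linarith
      rw [Set.indicator_of_mem (Set.mem_Iio.2 hv), Set.indicator_of_mem (Set.mem_Iio.2 hvq)]
      have h8 : h v = h' v - Real.exp (-(σ * q)) * h' (v - q) := by
        rw [← hh']
        have : (1 - Real.exp (-(σ * q)) • shift q) h' = h' - Real.exp (-(σ * q)) • shift q h' := rfl
        rw [this, h5, Pi.sub_apply, h6, Pi.smul_apply, h7, smul_eq_mul]
      have h9 : h' v - y v = Real.exp (-(σ * q)) * (h' (v - q) - y (v - q)) := by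
        linarith [h4 hv, hyq v hv]
      rw [h9, norm_mul, Real.norm_of_nonneg (Real.exp_pos _).le]
    · rw [Set.indicator_of_notMem (by simpa using hv), norm_zero]
      positivity
  have hz0 : z = 0 := by
    rw [norm_shift_apply] at hle
    have : Real.exp (-(σ * q)) < 1 := by
      rw [Real.exp_lt_one_iff]
      nlinarith
    by_contra hne
    have := norm_pos_iff.2 hne
    nlinarith
  have hcz := hzL.coeFn_toLp
  rw [← hz, hz0] at hcz
  filter_upwards [hcz, Lp.coeFn_zero ℝ (d : ℝ≥0∞) (volume : Measure ℝ)] with v h1 h2 hv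
  rw [h2, Set.indicator_of_mem (Set.mem_Iio.2 hv), Pi.zero_apply] at h1
  linarith

end Link

section Construction

variable {d : ℕ}

lemma Represents.congr {κ L : ℝ} {f f' : ℝ → ℝ} {c : ℝ} {g : Lp ℝ d (volume : Measure ℝ)}
    (h : Represents κ L f c g) (hf : ∀ v, 0 ≤ v → v < L → f v = f' v) : Represents κ L f' c g := by
  filter_upwards [h] with v h1 hv
  rw [h1 hv]
  split_ifs with h0
  · rw [hf v h0 hv]
  · rfl

variable [Fact (1 ≤ (d : ℝ≥0∞))]

/-- Attaching the primes one at a time to the trivial system. -/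
lemma represents_partialCnt (hd : 1 ≤ d) {σ κ L : ℝ} (hσ : 0 < σ) (hκ : 0 < κ) (hσκ : σ + κ = 1)
    (S : BeurlingSystem) {J : ℕ} (h : ℕ → Lp ℝ d (volume : Measure ℝ)) {c : ℝ}
    (h0 : Represents κ L (fun v => Real.exp (-v)) c (h 0))
    (hs : ∀ i < J, (1 - Real.exp (-(σ * Real.log (S.p i))) • shift (Real.log (S.p i))) (h (i + 1))
      = h i) :
    ∃ c', Represents κ L (fun v => S.partialCnt J (Real.exp v) * Real.exp (-v)) c' (h J) := by
  suffices H : ∀ i ≤ J, ∃ c',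
      Represents κ L (fun v => S.partialCnt i (Real.exp v) * Real.exp (-v)) c' (h i) from
    H J le_rfl
  intro i
  induction i with
  | zero =>
    intro _
    refine ⟨c, h0.congr fun v hv _ => ?_⟩
    rw [S.partialCnt_zero (Real.one_le_exp hv), one_mul]
  | succ i ih =>
    intro hi
    obtain ⟨c1, hc1⟩ := ih (by omega)
    have hq : 0 < Real.log (S.p i) := Real.log_pos (S.one_lt_p i)
    have hne : (1 - Real.exp (-Real.log (S.p i))) ≠ 0 := by
      have : Real.exp (-Real.log (S.p i)) < 1 := by rw [Real.exp_lt_one_iff]; linarith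
      linarith
    refine ⟨c1 / (1 - Real.exp (-Real.log (S.p i))), Represents.of_one_sub hd hσ hκ hσκ hq
      (M := S.partialCnt (i + 1) (Real.exp L)) ?_ ?_ ?_ (div_mul_cancel₀ _ hne).symm hc1
      (hs i (by omega))⟩
    · exact ((S.partialCnt_mono (i + 1)).measurable.comp Real.measurable_exp).mul (by fun_prop)
    · intro v hv hvL
      rw [abs_of_nonneg (mul_nonneg (S.partialCnt_nonneg _ _) (Real.exp_pos _).le)]
      have h1 := S.partialCnt_mono (i + 1) (Real.exp_le_exp.2 hvL.le)
      have h2 : Real.exp (-v) ≤ 1 := Real.exp_le_one_iff.2 (by linarith)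
      calc _ ≤ S.partialCnt (i + 1) (Real.exp L) * 1 :=
            mul_le_mul h1 h2 (Real.exp_pos _).le (S.partialCnt_nonneg _ _)
        _ = _ := mul_one _
    · intro v hv _
      have h1 : Real.exp v / S.p i = Real.exp (v - Real.log (S.p i)) := by
        rw [Real.exp_sub, Real.exp_log (S.p_pos i)]
      rw [S.partialCnt_succ i (Real.exp v), h1]
      split_ifs with h2
      · have h3 : Real.exp (-Real.log (S.p i)) * Real.exp (-(v - Real.log (S.p i)))
            = Real.exp (-v) := by
          rw [← Real.exp_add]; congr 1; ring
        linear_combination S.partialCnt (i + 1) (Real.exp (v - Real.log (S.p i))) * h3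
      · rw [S.partialCnt_of_lt_one (i + 1) (Real.exp_lt_one_iff.2 (by linarith))]
        ring

lemma bddAbove_of_le_one_add_mul {a u : ℕ → ℝ} (ha : ∀ j, 0 ≤ a j) (hu : ∀ j, 0 ≤ u j)
    (hus : Summable u) (h : ∀ j, a (j + 1) ≤ (1 + u j) * a j) : ∃ B, ∀ j, a j ≤ B := by
  refine ⟨Real.exp (∑' j, u j) * a 0, fun J => ?_⟩
  have h1 : a J ≤ Real.exp (∑ j ∈ Finset.range J, u j) * a 0 := by
    induction J with
    | zero => simp
    | succ J ih =>
      rw [Finset.sum_range_succ, Real.exp_add]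
      have h2 : 1 + u J ≤ Real.exp (u J) := by linarith [Real.add_one_le_exp (u J)]
      calc a (J + 1) ≤ (1 + u J) * a J := h J
        _ ≤ Real.exp (u J) * (Real.exp (∑ j ∈ Finset.range J, u j) * a 0) :=
          mul_le_mul h2 ih (ha J) (Real.exp_pos _).le
        _ = _ := by ring
  refine h1.trans (mul_le_mul_of_nonneg_right (Real.exp_le_exp.2 ?_) (ha 0))
  exact hus.sum_le_tsum _ fun j _ => hu j

/-- Endpoints of the cells carrying unit prime mass. -/
lemma exists_cells {p : ℝ → ℝ} (hp : Continuous p) (hp0 : ∀ w, 0 ≤ w → 0 ≤ p w ∧ p w ≤ 2)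
    (hp1 : ∀ w, 1 ≤ w → 1 / 4 ≤ w * p w) :
    ∃ τ : ℕ → ℝ, τ 0 = 0 ∧ StrictMono τ ∧ Tendsto τ atTop atTop ∧
      (∀ j : ℕ, ∫ w in (0 : ℝ)..τ j, Real.exp w * p w = j) ∧
      ∀ j : ℕ, (j : ℝ) ≤ 2 * Real.exp (τ j) := by
  have hc : Continuous fun w => Real.exp w * p w := Real.continuous_exp.mul hp
  have hi : ∀ s t, IntervalIntegrable (fun w => Real.exp w * p w) volume s t :=
    fun s t => hc.intervalIntegrable s t
  set A : ℝ → ℝ := fun t => ∫ w in (0 : ℝ)..t, Real.exp w * p w with hA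
  have hAc : Continuous A := intervalIntegral.continuous_primitive (fun s t => hi s t) 0
  have hmono : ∀ s t, 0 ≤ s → s ≤ t → A s ≤ A t := by
    intro s t hs hst
    have h1 := intervalIntegral.integral_add_adjacent_intervals (hi 0 s) (hi s t)
    have h2 : 0 ≤ ∫ w in s..t, Real.exp w * p w :=
      intervalIntegral.integral_nonneg hst fun w hw =>
        mul_nonneg (Real.exp_pos _).le (hp0 w (hs.trans hw.1)).1
    simp only [hA]; linarith
  have hgrow : ∀ t, 1 ≤ t → (t - 1) / 4 ≤ A t := by
    intro t ht
    have h1 := intervalIntegral.integral_add_adjacent_intervals (hi 0 1) (hi 1 t)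
    have h2 : 0 ≤ A 1 := by
      have := hmono 0 1 le_rfl zero_le_one
      simpa [hA] using this
    have h3 : ∫ w in (1 : ℝ)..t, (1 / 4 : ℝ) ≤ ∫ w in (1 : ℝ)..t, Real.exp w * p w := by
      refine intervalIntegral.integral_mono_on ht (by simp) (hi 1 t) fun w hw => ?_
      refine (hp1 w hw.1).trans (mul_le_mul_of_nonneg_right ?_ (hp0 w (by linarith [hw.1])).1)
      linarith [Real.add_one_le_exp w]
    rw [intervalIntegral.integral_const, smul_eq_mul] at h3
    simp only [hA] at h2 ⊢
    linarith
  have hex : ∀ j : ℕ, ∃ t, 0 ≤ t ∧ A t = j ∧ (j = 0 → t = 0) := by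
    intro j
    rcases Nat.eq_zero_or_pos j with rfl | hj
    · exact ⟨0, le_rfl, by simp [hA], fun _ => rfl⟩
    · have h1 : (0 : ℝ) ≤ 4 * j + 1 := by positivity
      have h2 : (j : ℝ) ∈ Set.Icc (A 0) (A (4 * j + 1)) := by
        refine ⟨by simp [hA], ?_⟩
        have := hgrow (4 * j + 1) (by linarith [Nat.cast_nonneg (α := ℝ) j])
        linarith
      obtain ⟨t, ht, htj⟩ := intermediate_value_Icc h1 hAc.continuousOn h2
      exact ⟨t, ht.1, htj, fun h => by omega⟩
  choose τ hτ0 hτA hτz using hex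
  have hsm : StrictMono τ := by
    refine strictMono_nat_of_lt_succ fun j => ?_
    by_contra! h
    have := hmono _ _ (hτ0 (j + 1)) h
    rw [hτA, hτA] at this
    push_cast at this
    linarith
  have hle : ∀ j : ℕ, (j : ℝ) ≤ 2 * Real.exp (τ j) := by
    intro j
    rw [← hτA j]
    have h1 : A (τ j) ≤ ∫ w in (0 : ℝ)..τ j, 2 * Real.exp w := by
      refine intervalIntegral.integral_mono_on (hτ0 j) (hi _ _)
        ((by fun_prop : Continuous fun w => 2 * Real.exp w).intervalIntegrable _ _) fun w hw => ?_
      nlinarith [Real.exp_pos w, (hp0 w hw.1).2]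
    rw [intervalIntegral.integral_const_mul, integral_exp, Real.exp_zero] at h1
    linarith
  refine ⟨τ, hτz 0 rfl, hsm, ?_, hτA, hle⟩
  have h1 : Tendsto (fun j : ℕ => Real.exp (τ j)) atTop atTop := by
    refine tendsto_atTop_mono (fun j => ?_)
      (tendsto_natCast_atTop_atTop.atTop_div_const (two_pos : (0 : ℝ) < 2))
    linarith [hle j]
  simpa only [Function.comp_def, Real.log_exp] using Real.tendsto_log_atTop.comp h1

lemma summable_exp_cells {τ : ℕ → ℝ} {σ : ℝ} (hσ : 1 / 2 < σ)
    (h : ∀ j : ℕ, (j : ℝ) ≤ 2 * Real.exp (τ j)) :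
    Summable fun j : ℕ => Real.exp (-(σ * τ (j + 1))) ^ 2 := by
  have h1 : Summable fun j : ℕ => (2 : ℝ) ^ (2 * σ) * (1 / ((j + 1 : ℕ) : ℝ) ^ (2 * σ)) :=
    ((summable_nat_add_iff 1).2 (Real.summable_one_div_nat_rpow.2 (by linarith))).mul_left _
  refine h1.of_nonneg_of_le (fun j => by positivity) fun j => ?_
  have hj : (0 : ℝ) < ((j + 1 : ℕ) : ℝ) := by positivity
  have h2 : Real.exp (-(σ * τ (j + 1))) ^ 2 = 1 / Real.exp (τ (j + 1)) ^ (2 * σ) := by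
    rw [← Real.exp_mul, one_div, ← Real.exp_neg, ← Real.exp_nat_mul]
    congr 1; push_cast; ring
  rw [h2, mul_one_div, ← Real.div_rpow zero_le_two hj.le, one_div,
    ← Real.inv_rpow (Real.exp_pos _).le]
  refine Real.rpow_le_rpow (by positivity) ?_ (by linarith)
  rw [inv_le_comm₀ (Real.exp_pos _) (by positivity), inv_div]
  linarith [h (j + 1)]

end Construction

section Construction

variable {d : ℕ} [Fact (1 ≤ (d : ℝ≥0∞))]

lemma norm_smul_shift_lt_one {σ q : ℝ} (hσ : 0 < σ) (hq : 0 < q) :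
    ‖Real.exp (-(σ * q)) • (shift q : Lp ℝ d (volume : Measure ℝ) →L[ℝ] _)‖ < 1 := by
  rw [norm_smul, Real.norm_of_nonneg (Real.exp_pos _).le]
  have h1 : ‖(shift q : Lp ℝ d (volume : Measure ℝ) →L[ℝ] _)‖ ≤ 1 :=
    ContinuousLinearMap.opNorm_le_bound _ zero_le_one fun g => by
      rw [norm_shift_apply, one_mul]
  have h2 : Real.exp (-(σ * q)) < 1 := by
    rw [Real.exp_lt_one_iff]
    nlinarith
  calc _ ≤ Real.exp (-(σ * q)) * 1 := mul_le_mul_of_nonneg_left h1 (Real.exp_pos _).le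
    _ < 1 := by rwa [mul_one]

/-- Greedy choice of one prime in each cell, keeping the states bounded. -/
lemma exists_greedy_sequence (hd : Even d) (hd2 : 2 ≤ d) {σ κ : ℝ} (hσ : 1 / 2 < σ)
    (hσκ : σ + κ = 1) {p b : ℝ → ℝ} (hp : Continuous p) (hb : Continuous b)
    (hp0 : ∀ w, 0 ≤ w → 0 ≤ p w) (hbp : ∀ w, b w = p w * Real.exp (κ * w))
    {τ : ℕ → ℝ} (hτ0 : τ 0 = 0) (hτ : StrictMono τ)
    (hτA : ∀ j : ℕ, ∫ w in (0 : ℝ)..τ j, Real.exp w * p w = j)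
    (hτe : ∀ j : ℕ, (j : ℝ) ≤ 2 * Real.exp (τ j)) (g0 : Lp ℝ d (volume : Measure ℝ)) :
    ∃ (q : ℕ → ℝ) (g : ℕ → Lp ℝ d (volume : Measure ℝ)) (B : ℝ), g 0 = g0 ∧
      (∀ j, 0 < q j ∧ τ j ≤ q j ∧ q j ≤ τ (j + 1)) ∧ (∀ j, ‖g j‖ ≤ B) ∧
      ∀ j, (1 - Real.exp (-(σ * q j)) • shift (q j)) (g (j + 1))
        = NormedSpace.exp (-(shiftInt (d : ℝ≥0∞) (ENNReal.natCast_ne_top d) hb (τ j) (τ (j + 1))))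
          (g j) := by
  have hσ0 : 0 < σ := by linarith
  have hτnn : ∀ j, 0 ≤ τ j := fun j => hτ0 ▸ hτ.monotone (Nat.zero_le j)
  have hτ1 : 0 < τ 1 := hτ0 ▸ hτ zero_lt_one
  set e0 := Real.exp (-(σ * τ 1)) with he0
  have he01 : e0 < 1 := by
    rw [he0, Real.exp_lt_one_iff]; nlinarith
  set C := 2 * (4 : ℝ) ^ d + 3 / (1 - e0) with hC
  have hC0 : 0 ≤ C := by
    have : 0 < 1 - e0 := by linarith
    positivity
  have hcont : Continuous fun w => Real.exp w * p w := Real.continuous_exp.mul hp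
  have hstep : ∀ (j : ℕ) (g : Lp ℝ d (volume : Measure ℝ)), ∃ (q : ℝ)
      (g' : Lp ℝ d (volume : Measure ℝ)), (0 < q ∧ τ j ≤ q ∧ q ≤ τ (j + 1)) ∧
      (1 - Real.exp (-(σ * q)) • shift q) g'
        = NormedSpace.exp (-(shiftInt (d : ℝ≥0∞) (ENNReal.natCast_ne_top d) hb (τ j) (τ (j + 1))))
          g ∧ (1 ≤ j → ‖g'‖ ≤ (1 + C * Real.exp (-(σ * τ j)) ^ 2) * ‖g‖) := by
    intro j g
    rcases Nat.eq_zero_or_pos j with rfl | hj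
    · obtain ⟨z, hz⟩ := exists_one_sub_apply_eq (norm_smul_shift_lt_one (d := d) hσ0 hτ1)
        (NormedSpace.exp (-(shiftInt (d : ℝ≥0∞) (ENNReal.natCast_ne_top d) hb (τ 0) (τ (0 + 1)))) g)
      exact ⟨τ 1, z, ⟨hτ1, (hτ zero_lt_one).le, le_rfl⟩, hz,
        fun h => by omega⟩
    · have hlt : τ j < τ (j + 1) := hτ (Nat.lt_succ_self j)
      have h1 : ∫ w in τ j..τ (j + 1), Real.exp w * p w = 1 := by
        have := intervalIntegral.integral_add_adjacent_intervals
          (hcont.intervalIntegrable (μ := volume) 0 (τ j)) (hcont.intervalIntegrable (τ j) (τ (j + 1)))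
        rw [hτA, hτA] at this
        push_cast at this
        linarith
      have h2 : Real.exp (-(σ * τ j)) ≤ e0 := by
        rw [he0]
        refine Real.exp_le_exp.2 ?_
        have := hτ.monotone (show 1 ≤ j from hj)
        nlinarith
      obtain ⟨q, hq, g', hg', hn⟩ := exists_greedy_step hd hd2 hcont hσ0.le hb (fun w => by
        rw [hbp, mul_comm (Real.exp w), mul_assoc, ← Real.exp_add]
        congr 2
        linear_combination w * hσκ) hlt.le
        (fun w hw => mul_nonneg (Real.exp_pos w).le (hp0 w ((hτnn j).trans hw.1))) h1 he01 h2 g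
      refine ⟨q, g', ⟨?_, hq.1, hq.2⟩, hg', fun _ => hn⟩
      exact (hτ0 ▸ hτ hj : (0 : ℝ) < τ j).trans_le hq.1
  choose Q G hQ hG hN using hstep
  let g : ℕ → Lp ℝ d (volume : Measure ℝ) := fun j => Nat.rec g0 (fun j x => G j x) j
  obtain ⟨B, hB⟩ := bddAbove_of_le_one_add_mul (a := fun j => ‖g (j + 1)‖)
    (u := fun j => C * Real.exp (-(σ * τ (j + 1))) ^ 2) (fun _ => norm_nonneg _)
    (fun _ => by positivity) ((summable_exp_cells hσ hτe).mul_left C)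
    (fun j => hN (j + 1) (g (j + 1)) (by omega))
  refine ⟨fun j => Q j (g j), g, max B ‖g 0‖, rfl, fun j => hQ j (g j), fun j => ?_,
    fun j => hG j (g j)⟩
  rcases j with _ | j
  · exact le_max_right _ _
  · exact (hB j).trans (le_max_left _ _)

lemma exp_neg_shiftInt_add {b : ℝ → ℝ} (hb : Continuous b) (s t u : ℝ)
    (g : Lp ℝ d (volume : Measure ℝ)) :
    NormedSpace.exp (-(shiftInt (d : ℝ≥0∞) (ENNReal.natCast_ne_top d) hb t u))
      (NormedSpace.exp (-(shiftInt (d : ℝ≥0∞) (ENNReal.natCast_ne_top d) hb s t)) g)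
      = NormedSpace.exp (-(shiftInt (d : ℝ≥0∞) (ENNReal.natCast_ne_top d) hb s u)) g := by
  let _ : NormedAlgebra ℚ (Lp ℝ d (volume : Measure ℝ) →L[ℝ] Lp ℝ d (volume : Measure ℝ)) :=
    NormedAlgebra.restrictScalars ℚ ℝ _
  rw [← shiftInt_add _ hb s t u, neg_add_rev, NormedSpace.exp_add_of_commute]
  · rfl
  · exact (commute_shiftInt_shiftInt _ hb _ _ _ _).neg_left.neg_right

lemma exp_neg_shiftInt_one_sub {b : ℝ → ℝ} (hb : Continuous b) (s t r q : ℝ)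
    (g : Lp ℝ d (volume : Measure ℝ)) :
    (1 - r • shift q)
      (NormedSpace.exp (-(shiftInt (d : ℝ≥0∞) (ENNReal.natCast_ne_top d) hb s t)) g)
      = NormedSpace.exp (-(shiftInt (d : ℝ≥0∞) (ENNReal.natCast_ne_top d) hb s t))
        ((1 - r • shift q) g) := by
  have h : Commute (1 - r • shift q) (NormedSpace.exp
      (-(shiftInt (d : ℝ≥0∞) (ENNReal.natCast_ne_top d) hb s t))) := by
    refine Commute.exp_right ?_
    exact (((Commute.one_left _).sub_left
      ((commute_shiftInt_shift _ hb s t q).symm.smul_left r))).neg_right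
  exact congrArg (fun A => A g) h

/-- The discretization theorem: every regular continuous template is followed by a genuine
Beurling system whose counting function stays `L^d`-close to linear. -/
theorem exists_system (hd : Even d) (hd2 : 2 ≤ d) {σ κ : ℝ} (hσ : 1 / 2 < σ) (hκ : 0 < κ)
    (hσκ : σ + κ = 1) {n p : ℝ → ℝ} {A0 : ℝ} (hn : Continuous n) (hn0 : n 0 = 1)
    (hnA : ∀ v, 0 ≤ v → |n v - A0| ≤ 3 * Real.exp (-(v / 2))) (hp : Continuous p)
    (hp0 : ∀ w, 0 ≤ w → 0 ≤ p w ∧ p w ≤ 2) (hp1 : ∀ w, 1 ≤ w → 1 / 4 ≤ w * p w)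
    (hmul : ∀ v, v * n v = conv n (fun w => w * p w + Real.exp (-w)) v) :
    ∃ (S : BeurlingSystem) (B : ℝ),
      (∀ k : ℕ, (k : ℝ) ≤ ∫ w in (0 : ℝ)..Real.log (S.p k), Real.exp w * p w) ∧
      (∀ k : ℕ, ∫ w in (0 : ℝ)..Real.log (S.p k), Real.exp w * p w ≤ k + 1) ∧
      ∀ L : ℝ, ∃ L' ≥ L, ∃ (c : ℝ) (g : Lp ℝ d (volume : Measure ℝ)), ‖g‖ ≤ B ∧
        Represents κ L' (fun v => S.cnt (Real.exp v) * Real.exp (-v)) c g := by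
  have hd1 : 1 ≤ d := by omega
  have hσ0 : 0 < σ := by linarith
  obtain ⟨τ, hτ0, hτ, hτt, hτA, hτe⟩ := exists_cells hp hp0 hp1
  set b : ℝ → ℝ := fun w => p w * Real.exp (κ * w) with hbdef
  have hb : Continuous b := hp.mul (by fun_prop)
  have hcont : Continuous fun w => Real.exp w * p w := Real.continuous_exp.mul hp
  classical
  set f0 : ℝ → ℝ := fun v => ((if 0 ≤ v then n v else 0) - A0) * Real.exp (κ * v) with hf0
  have hf0m : Measurable f0 :=
    ((Measurable.ite measurableSet_Ici hn.measurable measurable_const).sub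
      measurable_const).mul (by fun_prop)
  have hf0L : MemLp f0 d volume := by
    refine memLp_of_abs_le_exp hd1 hf0m (C := |A0| + 3) (c := min κ (σ - 1 / 2))
      (lt_min hκ (by linarith)) fun v => ?_
    have hm : 0 ≤ |v| := abs_nonneg v
    rw [hf0]
    simp only
    rw [abs_mul, Real.abs_exp]
    by_cases h : 0 ≤ v
    · rw [if_pos h]
      calc |n v - A0| * Real.exp (κ * v)
          ≤ 3 * Real.exp (-(v / 2)) * Real.exp (κ * v) :=
            mul_le_mul_of_nonneg_right (hnA v h) (Real.exp_pos _).le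
        _ = 3 * Real.exp (-((σ - 1 / 2) * |v|)) := by
            rw [mul_assoc, ← Real.exp_add, abs_of_nonneg h]
            congr 2
            linear_combination v * hσκ
        _ ≤ (|A0| + 3) * Real.exp (-(min κ (σ - 1 / 2) * |v|)) := by
            refine mul_le_mul (by linarith [abs_nonneg A0]) (Real.exp_le_exp.2 (neg_le_neg ?_))
              (Real.exp_pos _).le (by positivity)
            exact mul_le_mul_of_nonneg_right (min_le_right _ _) hm
    · rw [if_neg h, zero_sub, abs_neg]
      refine mul_le_mul (by linarith) (Real.exp_le_exp.2 ?_) (Real.exp_pos _).le (by positivity)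
      have h1 : κ * v = -(κ * |v|) := by rw [abs_of_neg (not_le.1 h)]; ring
      rw [h1]
      exact neg_le_neg (mul_le_mul_of_nonneg_right (min_le_left _ _) hm)
  obtain ⟨q, g, B, hg0, hq, hgB, hg⟩ := exists_greedy_sequence hd hd2 hσ hσκ hp hb
    (fun w hw => (hp0 w hw).1) (fun _ => rfl) hτ0 hτ hτA hτe (hf0L.toLp f0)
  have hτnn : ∀ j, 0 ≤ τ j := fun j => hτ0 ▸ hτ.monotone (Nat.zero_le j)
  let S : BeurlingSystem :=
    { p := fun j => Real.exp (q j)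
      one_lt_p := fun j => Real.one_lt_exp_iff.2 (hq j).1
      p_mono := Real.exp_monotone.comp
        (monotone_nat_of_le_succ fun j => (hq j).2.2.trans (hq (j + 1)).2.1)
      p_tendsto := Real.tendsto_exp_atTop.comp (tendsto_atTop_mono (fun j => (hq j).2.1) hτt) }
  have hlog : ∀ j, Real.log (S.p j) = q j := fun j => Real.log_exp _
  have hmono : ∀ s t, 0 ≤ s → s ≤ t → ∫ w in (0 : ℝ)..s, Real.exp w * p w
      ≤ ∫ w in (0 : ℝ)..t, Real.exp w * p w := by
    intro s t hs hst
    rw [← intervalIntegral.integral_add_adjacent_intervals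
      (hcont.intervalIntegrable (μ := volume) 0 s) (hcont.intervalIntegrable s t)]
    have h2 : 0 ≤ ∫ w in s..t, Real.exp w * p w :=
      intervalIntegral.integral_nonneg hst fun w hw =>
        mul_nonneg (Real.exp_pos _).le (hp0 w (hs.trans hw.1)).1
    linarith
  refine ⟨S, B, fun k => ?_, fun k => ?_, fun L => ?_⟩
  · rw [hlog, ← hτA k]
    exact hmono _ _ (hτnn k) (hq k).2.1
  · rw [hlog]
    have := hmono _ _ (hq k).1.le (hq k).2.2
    rw [hτA] at this
    exact_mod_cast this
  · obtain ⟨J, hJ⟩ := (hτt.eventually_ge_atTop L).exists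
    set h : ℕ → Lp ℝ d (volume : Measure ℝ) := fun i =>
      NormedSpace.exp (-(shiftInt (d : ℝ≥0∞) (ENNReal.natCast_ne_top d) hb (τ i) (τ J))) (g i)
      with hh
    have hR0 : Represents κ (τ J) n A0 (g 0) := by
      rw [hg0]
      filter_upwards [hf0L.coeFn_toLp] with v hv _
      rw [hv]
    have h0 := hR0.exp_neg hd2 (hτnn J) hκ.le hn hp hb hn0 hmul (fun _ => rfl)
    rw [← hτ0] at h0
    obtain ⟨c, hc⟩ := represents_partialCnt hd1 hσ0 hκ hσκ S (J := J) h h0 fun i _ => by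
      rw [hlog, hh]
      simp only
      rw [exp_neg_shiftInt_one_sub, hg, exp_neg_shiftInt_add]
    have hJJ : h J = g J := by
      rw [hh]
      simp only
      rw [shiftInt_self, neg_zero, NormedSpace.exp_zero]
      rfl
    rw [hJJ] at hc
    refine ⟨τ J, hJ, c, g J, hgB J, hc.congr fun v _ hv => ?_⟩
    rw [S.partialCnt_eq_cnt (show Real.exp v < S.p J from
      Real.exp_lt_exp.2 (hv.trans_le (hq J).2.1))]

end Construction

section Pointwise

variable {d : ℕ} [Fact (1 ≤ (d : ℝ≥0∞))]

lemma pow_mul_le_of_le_abs (hd : Even d) (hd2 : 2 ≤ d) {g : Lp ℝ d (volume : Measure ℝ)} {B m s t : ℝ}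
    (hg : ‖g‖ ≤ B) (hst : s ≤ t) (hm : 0 ≤ m) (h : ∀ᵐ v, v ∈ Set.Ioo s t → m ≤ |g v|) :
    m ^ d * (t - s) ≤ B ^ d := by
  have h1 : ∫ v in Set.Ioo s t, m ^ d ≤ ∫ v in Set.Ioo s t, g v ^ d := by
    refine setIntegral_mono_on_ae (by simp [integrableOn_const_iff])
      (integrable_pow_Lp hd hd2 g).integrableOn measurableSet_Ioo ?_
    filter_upwards [h] with v hv hvs
    rw [← hd.pow_abs (g v)]
    exact pow_le_pow_left₀ hm (hv hvs) d
  have h2 : ∫ v in Set.Ioo s t, g v ^ d ≤ ∫ v, g v ^ d :=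
    setIntegral_le_integral (integrable_pow_Lp hd hd2 g)
      (Eventually.of_forall fun v => hd.pow_nonneg _)
  rw [setIntegral_const, smul_eq_mul, measureReal_def, Real.volume_Ioo,
    ENNReal.toReal_ofReal (by linarith)] at h1
  rw [← norm_pow_eq_integral hd hd2] at h2
  have h3 := pow_le_pow_left₀ (norm_nonneg g) hg d
  linarith

lemma abs_sub_le_of_represents (hd : Even d) (hd2 : 2 ≤ d) {κ : ℝ} (hκ : 0 < κ) {f : ℝ → ℝ} {B : ℝ}
    {L c c' : ℝ} {g g' : Lp ℝ d (volume : Measure ℝ)} (hg : ‖g‖ ≤ B) (hg' : ‖g'‖ ≤ B)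
    (h : Represents κ L f c g) (h' : Represents κ L f c' g') :
    |c - c'| ≤ 2 * B * Real.exp (-(κ * (L - 1))) := by
  have h1 : ‖g - g'‖ ≤ 2 * B := (norm_sub_le _ _).trans (by linarith)
  have h2 : (|c - c'| * Real.exp (κ * (L - 1))) ^ d * (L - (L - 1)) ≤ (2 * B) ^ d := by
    refine pow_mul_le_of_le_abs hd hd2 h1 (by linarith) (by positivity) ?_
    filter_upwards [h, h', Lp.coeFn_sub g g'] with v e1 e2 e3 hv
    rw [e3, Pi.sub_apply, e1 hv.2, e2 hv.2, ← sub_mul, abs_mul, Real.abs_exp]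
    refine mul_le_mul (le_of_eq ?_) (Real.exp_le_exp.2 (by nlinarith [hv.1])) (Real.exp_pos _).le
      (abs_nonneg _)
    rw [abs_sub_comm c c']
    congr 1; ring
  rw [sub_sub_cancel, mul_one] at h2
  have hB : 0 ≤ B := (norm_nonneg g).trans hg
  have h3 := le_of_pow_le_pow_left₀ (by omega) (by positivity) h2
  rw [Real.exp_neg, ← div_eq_mul_inv, le_div_iff₀ (Real.exp_pos _)]
  exact h3

lemma exists_density (hd : Even d) (hd2 : 2 ≤ d) {κ : ℝ} (hκ : 0 < κ) {f : ℝ → ℝ} {B : ℝ}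
    {c : ℝ → ℝ} {g : ℝ → Lp ℝ d (volume : Measure ℝ)} (hg : ∀ L, ‖g L‖ ≤ B)
    (h : ∀ L, Represents κ L f (c L) (g L)) :
    ∃ A, ∀ L, |c L - A| ≤ 2 * B * Real.exp (-(κ * (L - 1))) := by
  have hB : 0 ≤ B := (norm_nonneg _).trans (hg 0)
  have h1 : ∀ N L L', N ≤ L → N ≤ L' → |c L - c L'| ≤ 2 * B * Real.exp (-(κ * (N - 1))) :=
    fun N L L' hL hL' => abs_sub_le_of_represents hd hd2 hκ (hg L) (hg L')
      ((h L).mono fun v hv hvN => hv (hvN.trans_le hL))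
      ((h L').mono fun v hv hvN => hv (hvN.trans_le hL'))
  have h2 : Tendsto (fun N : ℝ => 2 * B * Real.exp (-(κ * (N - 1)))) atTop (𝓝 0) := by
    have : Tendsto (fun N : ℝ => κ * (N - 1)) atTop atTop :=
      (tendsto_atTop_add_const_right atTop (-1) tendsto_id).const_mul_atTop hκ
    simpa using (Real.tendsto_exp_neg_atTop_nhds_zero.comp this).const_mul (2 * B)
  obtain ⟨A, hA⟩ := cauchySeq_tendsto_of_complete
    (cauchySeq_of_le_tendsto_0 (s := c) _ (fun L L' N hL hL' => h1 N L L' hL hL') h2)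
  refine ⟨A, fun L => ?_⟩
  refine le_of_tendsto ((tendsto_const_nhds.sub hA).abs) ?_
  filter_upwards [eventually_ge_atTop L] with L' hL'
  exact h1 L L L' le_rfl hL'

/-- An `L^d` bound for the error term of a monotone function gives a pointwise bound. -/
lemma abs_le_of_represents (hd : Even d) (hd2 : 2 ≤ d) {κ r : ℝ} (hκ : 0 < κ) (hκ1 : κ ≤ 1)
    (hr : 0 < r) (hrd : r * (d + 1) ≤ κ * d) {N : ℝ → ℝ} (hN : Monotone N) (hN0 : ∀ x, 0 ≤ N x)
    (hN1 : ∀ x, x < 1 → N x = 0)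
    {B M L c u : ℝ} {g : Lp ℝ d (volume : Measure ℝ)} (hg : ‖g‖ ≤ B) (hM : 0 ≤ M) (hc : c ≤ M)
    (hu : 0 ≤ u) (huL : u + 1 ≤ L)
    (h : Represents κ L (fun v => N (Real.exp v) * Real.exp (-v)) c g) :
    |N (Real.exp u) * Real.exp (-u) - c| ≤ 4 * (M + 1) * (6 * B + 1) * Real.exp (-(r * u)) := by
  set K := 4 * (M + 1) * (6 * B + 1) with hK
  have hB : 0 ≤ B := (norm_nonneg _).trans hg
  have hK1 : 1 ≤ K := by rw [hK]; nlinarith [mul_nonneg hM hB]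
  set ε := Real.exp (-(r * u)) with hε
  have hε0 : 0 < ε := Real.exp_pos _
  have hε1 : ε ≤ 1 := by
    rw [hε]
    exact Real.exp_le_one_iff.2 (by nlinarith [mul_nonneg hr.le hu])
  set η := ε / (4 * (M + 1)) with hη
  have hη0 : 0 < η := by positivity
  have hηM : η * (4 * (M + 1)) = ε := div_mul_cancel₀ _ (by positivity)
  have hη1 : η ≤ 1 / 4 := by nlinarith [mul_nonneg hη0.le hM]
  have hηc : η * c ≤ ε / 4 := by
    have := mul_le_mul_of_nonneg_left hc hη0.le
    nlinarith
  have hrep : ∀ᵐ v, v < L → g v = (N (Real.exp v) * Real.exp (-v) - c) * Real.exp (κ * v) := by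
    filter_upwards [h] with v hv hvL
    rw [hv hvL]
    split_ifs with h0
    · rfl
    · rw [hN1 _ (Real.exp_lt_one_iff.2 (not_le.1 h0)), zero_mul]
  have key : ∀ s, u - 1 ≤ s → s + η ≤ L →
      (∀ v ∈ Set.Ioo s (s + η), K * ε / 2 ≤ |N (Real.exp v) * Real.exp (-v) - c|) → False := by
    intro s hs hsL hv
    have h1 : (K * ε / 2 * Real.exp (κ * (u - 1))) ^ d * (s + η - s) ≤ B ^ d := by
      refine pow_mul_le_of_le_abs hd hd2 hg (by linarith) (by positivity) ?_
      filter_upwards [hrep] with v e1 hvs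
      rw [e1 (hvs.2.trans_le hsL), abs_mul, Real.abs_exp]
      exact mul_le_mul (hv v hvs) (Real.exp_le_exp.2 (by nlinarith [hvs.1])) (Real.exp_pos _).le
        (abs_nonneg _)
    have h2 : Real.exp (κ * u) ≤ 3 * Real.exp (κ * (u - 1)) := by
      have e1 : Real.exp (κ * u) = Real.exp κ * Real.exp (κ * (u - 1)) := by
        rw [← Real.exp_add]; congr 1; ring
      have e2 : Real.exp κ ≤ 3 := (Real.exp_le_exp.2 hκ1).trans (by
        linarith [Real.exp_one_lt_d9])
      rw [e1]
      exact mul_le_mul_of_nonneg_right e2 (Real.exp_pos _).le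
    have h3 : 1 ≤ ε * (ε * Real.exp (κ * u)) ^ d := by
      rw [hε, ← Real.exp_add, ← Real.exp_nat_mul, ← Real.exp_add]
      refine Real.one_le_exp ?_
      nlinarith [mul_le_mul_of_nonneg_right hrd hu]
    have h4 : K ^ d ≤ 4 * (M + 1) * (6 * B) ^ d := by
      have e1 : K * (ε * Real.exp (κ * u)) ≤ 6 * (K * ε / 2 * Real.exp (κ * (u - 1))) := by
        have := mul_le_mul_of_nonneg_left h2 (show 0 ≤ K * ε by positivity)
        linarith
      have e2 := pow_le_pow_left₀ (by positivity) e1 d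
      rw [mul_pow, mul_pow (6 : ℝ)] at e2
      have e3 : K ^ d ≤ K ^ d * (ε * (ε * Real.exp (κ * u)) ^ d) :=
        le_mul_of_one_le_right (by positivity) h3
      have e4 := mul_le_mul_of_nonneg_left e2 hε0.le
      rw [add_sub_cancel_left] at h1
      have e5 := mul_le_mul_of_nonneg_left h1 (show (0 : ℝ) ≤ 6 ^ d * (4 * (M + 1)) by positivity)
      calc K ^ d ≤ ε * (K ^ d * (ε * Real.exp (κ * u)) ^ d) := by linarith
        _ ≤ ε * (6 ^ d * (K * ε / 2 * Real.exp (κ * (u - 1))) ^ d) := e4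
        _ = 6 ^ d * (4 * (M + 1)) * ((K * ε / 2 * Real.exp (κ * (u - 1))) ^ d * η) := by
            rw [← hηM]; ring
        _ ≤ 6 ^ d * (4 * (M + 1)) * B ^ d := e5
        _ = _ := by rw [mul_pow]; ring
    have h5 : 4 * (M + 1) * (6 * B) ^ d < K ^ d := by
      rw [hK, mul_pow _ (6 * B + 1)]
      refine mul_lt_mul' (le_self_pow₀ (by linarith) (by omega))
        (pow_lt_pow_left₀ (by linarith) (by positivity) (by omega)) (by positivity) (by positivity)
    linarith
  by_contra! hlt
  have hNu : N (Real.exp u) * Real.exp (-u) ≥ 0 := mul_nonneg (hN0 _) (Real.exp_pos _).le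
  have hKε : ε ≤ K * ε := le_mul_of_one_le_left hε0.le hK1
  set δ := N (Real.exp u) * Real.exp (-u) - c with hδ
  have hshift : ∀ v, N (Real.exp u) * Real.exp (-v) = (c + δ) * Real.exp (u - v) := by
    intro v
    have : Real.exp (-v) = Real.exp (-u) * Real.exp (u - v) := by
      rw [← Real.exp_add]; congr 1; ring
    rw [this, hδ]; ring
  have hcδ : 0 ≤ c + δ := by linarith
  rcases lt_abs.1 hlt with hpos | hneg
  · refine key u (by linarith) (by linarith) fun v hv => ?_
    refine le_trans ?_ (le_abs_self _)
    have h1 := mul_le_mul_of_nonneg_right (hN (Real.exp_le_exp.2 hv.1.le)) (Real.exp_pos (-v)).le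
    rw [hshift] at h1
    have h2 : 1 - η ≤ Real.exp (u - v) := by linarith [Real.add_one_le_exp (u - v), hv.2]
    have h3 := mul_le_mul_of_nonneg_left h2 hcδ
    nlinarith
  · refine key (u - η) (by linarith) (by linarith) fun v hv => ?_
    refine le_trans ?_ (neg_le_abs _)
    have h1 := mul_le_mul_of_nonneg_right (hN (Real.exp_le_exp.2 (show v ≤ u by linarith [hv.2])))
      (Real.exp_pos (-v)).le
    rw [hshift] at h1
    have h2 : Real.exp (u - v) ≤ 1 + 2 * η := by
      have e1 : u - v < η := by linarith [hv.1]
      have e2 : 0 < u - v := by linarith [hv.2]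
      have e3 := Real.abs_exp_sub_one_le (x := u - v) (by rw [abs_of_pos e2]; linarith)
      rw [abs_of_pos e2] at e3
      linarith [le_abs_self (Real.exp (u - v) - 1)]
    have h3 := mul_le_mul_of_nonneg_left h2 hcδ
    nlinarith

/-- Bounded states force the counting function to be close to linear at every point. -/
lemma exists_linear_asymptotics (hd : Even d) (hd2 : 2 ≤ d) {κ r : ℝ} (hκ : 0 < κ) (hκ1 : κ ≤ 1)
    (hr : 0 < r) (hrκ : r ≤ κ) (hrd : r * (d + 1) ≤ κ * d) {N : ℝ → ℝ} (hN : Monotone N)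
    (hN0 : ∀ x, 0 ≤ N x) (hN1 : ∀ x, x < 1 → N x = 0) {B : ℝ}
    (h : ∀ L : ℝ, ∃ L' ≥ L, ∃ (c : ℝ) (g : Lp ℝ d (volume : Measure ℝ)), ‖g‖ ≤ B ∧
      Represents κ L' (fun v => N (Real.exp v) * Real.exp (-v)) c g) :
    ∃ A K : ℝ, 0 ≤ K ∧ ∀ u, 0 ≤ u →
      |N (Real.exp u) - A * Real.exp u| ≤ K * Real.exp ((1 - r) * u) := by
  choose L hL c g hg hrep using h
  have hB : 0 ≤ B := (norm_nonneg _).trans (hg 0)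
  have hrep' : ∀ x, Represents κ x (fun v => N (Real.exp v) * Real.exp (-v)) (c x) (g x) :=
    fun x => (hrep x).mono fun v hv hvx => hv (hvx.trans_le (hL x))
  obtain ⟨A, hA⟩ := exists_density hd hd2 hκ hg hrep'
  set K := 4 * (|A| + 2 * B + 1) * (6 * B + 1) with hK
  have hK0 : 0 ≤ K := by positivity
  refine ⟨A, K + 2 * B, by positivity, fun u hu => ?_⟩
  have h1 := hA (u + 1)
  rw [add_sub_cancel_right] at h1
  have h2 : Real.exp (-(κ * u)) ≤ Real.exp (-(r * u)) :=
    Real.exp_le_exp.2 (by nlinarith)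
  have h3 : Real.exp (-(r * u)) ≤ 1 := Real.exp_le_one_iff.2 (by nlinarith [mul_nonneg hr.le hu])
  have h4 : c (u + 1) ≤ |A| + 2 * B := by
    have e1 : 2 * B * Real.exp (-(κ * u)) ≤ 2 * B * 1 :=
      mul_le_mul_of_nonneg_left (h2.trans h3) (by positivity)
    linarith [le_abs_self (c (u + 1) - A), le_abs_self A]
  have h5 := abs_le_of_represents hd hd2 hκ hκ1 hr hrd hN hN0 hN1 (hg (u + 1)) (by positivity) h4
    hu le_rfl (hrep' (u + 1))
  rw [← hK] at h5
  have h6 : |N (Real.exp u) * Real.exp (-u) - A| ≤ (K + 2 * B) * Real.exp (-(r * u)) := by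
    have e1 := abs_add_le (N (Real.exp u) * Real.exp (-u) - c (u + 1)) (c (u + 1) - A)
    rw [sub_add_sub_cancel] at e1
    have e2 := mul_le_mul_of_nonneg_left h2 (show 0 ≤ 2 * B by positivity)
    linarith
  have h7 : N (Real.exp u) - A * Real.exp u
      = (N (Real.exp u) * Real.exp (-u) - A) * Real.exp u := by
    rw [sub_mul, mul_assoc, ← Real.exp_add, neg_add_cancel, Real.exp_zero, mul_one]
  have h8 : Real.exp ((1 - r) * u) = Real.exp (-(r * u)) * Real.exp u := by
    rw [← Real.exp_add]; congr 1; ring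
  rw [h7, h8, abs_mul, Real.abs_exp, ← mul_assoc]
  exact mul_le_mul_of_nonneg_right h6 (Real.exp_pos _).le

end Pointwise

namespace BeurlingSystem

variable (S : BeurlingSystem)

lemma vonMangoldt_single (k : ℕ) {m : ℕ} (hm : m ≠ 0) :
    S.vonMangoldt (Finsupp.single k m) = Real.log (S.p k) := by
  rw [vonMangoldt, Finsupp.support_single k hm, Finset.sum_singleton, if_pos rfl]

lemma log_p_nonneg (k : ℕ) : 0 ≤ Real.log (S.p k) := Real.log_nonneg (S.one_lt_p k).le

lemma vonMangoldt_nonneg (n : ℕ →₀ ℕ) : 0 ≤ S.vonMangoldt n :=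
  Finset.sum_nonneg fun k _ => by
    split_ifs
    · exact S.log_p_nonneg k
    · exact le_rfl

lemma exists_eq_single_of_vonMangoldt_ne_zero {n : ℕ →₀ ℕ} (h : S.vonMangoldt n ≠ 0) :
    ∃ k m : ℕ, m ≠ 0 ∧ n = Finsupp.single k m := by
  obtain ⟨k, hk, hne⟩ := Finset.exists_ne_zero_of_sum_ne_zero h
  have hs : n.support = {k} := by
    by_contra hs
    rw [if_neg hs] at hne
    exact hne rfl
  obtain ⟨h1, h2⟩ := Finsupp.support_eq_singleton.1 hs
  exact ⟨k, n k, h1, h2⟩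

lemma finite_val_mem_Ioc (x y : ℝ) : {n : ℕ →₀ ℕ | x < S.val n ∧ S.val n ≤ y}.Finite :=
  (S.finite_setOf_val_le y).subset fun _ h => h.2

lemma psi_sub_psi {x y : ℝ} (hxy : x ≤ y) :
    S.psi y - S.psi x = ∑ n ∈ (S.finite_val_mem_Ioc x y).toFinset, S.vonMangoldt n := by
  have h : {n : ℕ →₀ ℕ | S.val n ≤ y}
      = {n | S.val n ≤ x} ∪ {n | x < S.val n ∧ S.val n ≤ y} := by
    ext n
    simp only [Set.mem_ofPred_eq, Set.mem_union]
    constructor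
    · intro h
      rcases le_or_gt (S.val n) x with h1 | h1
      · exact Or.inl h1
      · exact Or.inr ⟨h1, h⟩
    · rintro (h | h)
      · exact h.trans hxy
      · exact h.2
  have hd : Disjoint {n : ℕ →₀ ℕ | S.val n ≤ x} {n | x < S.val n ∧ S.val n ≤ y} :=
    Set.disjoint_left.2 fun n h1 h2 => absurd h2.1 (not_lt.2 h1)
  rw [psi, psi, h, finsum_mem_union hd (S.finite_setOf_val_le x) (S.finite_val_mem_Ioc x y),
    add_sub_cancel_left, finsum_mem_eq_finite_toFinset_sum]

lemma log_mul_le_psi_sub {x y : ℝ} (hx : 0 < x) (hxy : x ≤ y) :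
    Real.log x * (S.primesIn x y).ncard ≤ S.psi y - S.psi x := by
  classical
  rw [S.psi_sub_psi hxy, Set.ncard_eq_toFinset_card _ (S.finite_primesIn x y)]
  have hinj : Function.Injective fun k : ℕ => Finsupp.single k 1 :=
    Finsupp.single_left_injective one_ne_zero
  calc Real.log x * ((S.finite_primesIn x y).toFinset.card : ℝ)
      = ∑ k ∈ (S.finite_primesIn x y).toFinset, Real.log x := by
        rw [Finset.sum_const, nsmul_eq_mul, mul_comm]
    _ ≤ ∑ k ∈ (S.finite_primesIn x y).toFinset, S.vonMangoldt (Finsupp.single k 1) := by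
        refine Finset.sum_le_sum fun k hk => ?_
        rw [S.vonMangoldt_single k one_ne_zero]
        exact Real.log_le_log hx ((Set.Finite.mem_toFinset _).1 hk).1.le
    _ = ∑ n ∈ (S.finite_primesIn x y).toFinset.image (fun k => Finsupp.single k 1),
          S.vonMangoldt n := (Finset.sum_image hinj.injOn).symm
    _ ≤ _ := by
        refine Finset.sum_le_sum_of_subset_of_nonneg ?_ fun n _ _ => S.vonMangoldt_nonneg n
        intro n hn
        obtain ⟨k, hk, rfl⟩ := Finset.mem_image.1 hn
        rw [Set.Finite.mem_toFinset] at hk ⊢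
        show x < S.val _ ∧ S.val _ ≤ y
        rw [S.val_single, pow_one]
        exact hk

lemma psi_sub_le {x y : ℝ} (hx : 0 < x) (hxy : x ≤ y) :
    S.psi y - S.psi x
      ≤ Real.log y * ((S.primesIn x y).ncard + (S.primesIn 1 (Real.sqrt y)).ncard) := by
  classical
  have hy : 0 < y := hx.trans_le hxy
  rw [S.psi_sub_psi hxy, Set.ncard_eq_toFinset_card _ (S.finite_primesIn x y),
    Set.ncard_eq_toFinset_card _ (S.finite_primesIn 1 (Real.sqrt y)), mul_add]
  set T := (S.finite_val_mem_Ioc x y).toFinset with hT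
  set P := (S.finite_primesIn x y).toFinset with hP
  set R := (S.finite_primesIn 1 (Real.sqrt y)).toFinset with hR
  set F : Finset (Σ _ : ℕ, ℕ) :=
    R.sigma fun k => Finset.Icc 2 ⌊Real.log y / Real.log (S.p k)⌋₊ with hF
  set φ : (Σ _ : ℕ, ℕ) → (ℕ →₀ ℕ) := fun s => Finsupp.single s.1 s.2 with hφ
  have hsub : T.filter (fun n => S.vonMangoldt n ≠ 0)
      ⊆ P.image (fun k => Finsupp.single k 1) ∪ F.image φ := by
    intro n hn
    obtain ⟨hnT, hne⟩ := Finset.mem_filter.1 hn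
    rw [hT, Set.Finite.mem_toFinset] at hnT
    obtain ⟨k, m, hm, rfl⟩ := S.exists_eq_single_of_vonMangoldt_ne_zero hne
    have hnT' : x < S.p k ^ m ∧ S.p k ^ m ≤ y := by
      rw [← S.val_single]; exact hnT
    rcases eq_or_ne m 1 with rfl | hm1
    · refine Finset.mem_union_left _ (Finset.mem_image.2 ⟨k, ?_, rfl⟩)
      rw [hP, Set.Finite.mem_toFinset]
      rwa [pow_one] at hnT'
    · refine Finset.mem_union_right _ (Finset.mem_image.2 ⟨⟨k, m⟩, ?_, rfl⟩)
      have hm2 : 2 ≤ m := by omega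
      rw [hF, Finset.mem_sigma, Finset.mem_Icc]
      refine ⟨?_, hm2, ?_⟩
      · rw [hR, Set.Finite.mem_toFinset]
        refine ⟨S.one_lt_p k, Real.le_sqrt_of_sq_le ?_⟩
        exact (pow_le_pow_right₀ (S.one_lt_p k).le hm2).trans hnT'.2
      · refine Nat.le_floor ?_
        rw [le_div_iff₀ (Real.log_pos (S.one_lt_p k)), ← Real.log_pow]
        exact Real.log_le_log (pow_pos (S.p_pos k) _) hnT'.2
  have h1 : ∑ n ∈ T, S.vonMangoldt n
      ≤ ∑ n ∈ P.image (fun k => Finsupp.single k 1), S.vonMangoldt n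
        + ∑ n ∈ F.image φ, S.vonMangoldt n := by
    rw [← Finset.sum_filter_ne_zero, ← Finset.sum_union_inter]
    refine (Finset.sum_le_sum_of_subset_of_nonneg hsub
      fun n _ _ => S.vonMangoldt_nonneg n).trans (le_add_of_nonneg_right ?_)
    exact Finset.sum_nonneg fun n _ => S.vonMangoldt_nonneg n
  have h2 : ∑ n ∈ P.image (fun k => Finsupp.single k 1), S.vonMangoldt n
      ≤ Real.log y * P.card := by
    rw [Finset.sum_image (Finsupp.single_left_injective one_ne_zero).injOn, mul_comm,
      ← nsmul_eq_mul]
    refine Finset.sum_le_card_nsmul _ _ _ fun k hk => ?_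
    rw [S.vonMangoldt_single k one_ne_zero]
    rw [hP, Set.Finite.mem_toFinset] at hk
    exact Real.log_le_log (S.p_pos k) hk.2
  have h3 : ∑ n ∈ F.image φ, S.vonMangoldt n ≤ Real.log y * R.card := by
    have hinj : Set.InjOn φ F := by
      rintro ⟨k, m⟩ h ⟨k', m'⟩ - he
      rw [Finset.mem_coe, hF, Finset.mem_sigma, Finset.mem_Icc] at h
      rcases (Finsupp.single_eq_single_iff _ _ _ _).1 he with ⟨rfl, rfl⟩ | ⟨h0, -⟩
      · rfl
      · have := h.2.1
        simp only at this h0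
        omega
    rw [Finset.sum_image hinj, hF, Finset.sum_sigma, mul_comm, ← nsmul_eq_mul]
    refine Finset.sum_le_card_nsmul _ _ _ fun k hk => ?_
    rw [hR, Set.Finite.mem_toFinset] at hk
    have hlk := Real.log_pos (S.one_lt_p k)
    have hly : 0 ≤ Real.log y := by
      have h4 : 1 ≤ Real.sqrt y := hk.1.le.trans hk.2
      exact Real.log_nonneg (Real.one_le_sqrt.1 h4)
    calc ∑ m ∈ Finset.Icc 2 ⌊Real.log y / Real.log (S.p k)⌋₊, S.vonMangoldt (φ ⟨k, m⟩)
        = ∑ m ∈ Finset.Icc 2 ⌊Real.log y / Real.log (S.p k)⌋₊, Real.log (S.p k) := by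
          refine Finset.sum_congr rfl fun m hm => ?_
          have := (Finset.mem_Icc.1 hm).1
          exact S.vonMangoldt_single k (show m ≠ 0 by omega)
      _ = ((⌊Real.log y / Real.log (S.p k)⌋₊ + 1 - 2 : ℕ) : ℝ) * Real.log (S.p k) := by
          rw [Finset.sum_const, Nat.card_Icc, nsmul_eq_mul]
      _ ≤ (Real.log y / Real.log (S.p k)) * Real.log (S.p k) := by
          refine mul_le_mul_of_nonneg_right ?_ hlk.le
          refine le_trans ?_ (Nat.floor_le (div_nonneg hly hlk.le))
          exact_mod_cast (by omega : ⌊Real.log y / Real.log (S.p k)⌋₊ + 1 - 2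
            ≤ ⌊Real.log y / Real.log (S.p k)⌋₊)
      _ = Real.log y := div_mul_cancel₀ _ hlk.ne'
  linarith

lemma cnt_of_lt_one {x : ℝ} (hx : x < 1) : S.cnt x = 0 := by
  have : {n : ℕ →₀ ℕ | S.val n ≤ x} = ∅ := by
    ext n
    simp only [Set.mem_ofPred_eq, Set.mem_empty_iff_false, iff_false, not_le]
    exact hx.trans_le (S.one_le_val n)
  rw [cnt, this, Set.ncard_empty, Nat.cast_zero]

end BeurlingSystem

lemma tendsto_mul_exp_neg_mul {c : ℝ} (hc : 0 < c) :
    Tendsto (fun u : ℝ => u * Real.exp (-(c * u))) atTop (𝓝 0) := by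
  simpa using tendsto_rpow_mul_exp_neg_mul_atTop_nhds_zero 1 c hc

/-- The continuous counting function of the primes up to `exp t` with density `p`. -/
noncomputable def primeMass (p : ℝ → ℝ) (t : ℝ) : ℝ :=
  ∫ w in (0 : ℝ)..max t 0, Real.exp w * p w

section primeMass

variable {p : ℝ → ℝ}

lemma primeMass_of_nonneg {t : ℝ} (ht : 0 ≤ t) :
    primeMass p t = ∫ w in (0 : ℝ)..t, Real.exp w * p w := by
  rw [primeMass, max_eq_left ht]

lemma primeMass_zero : primeMass p 0 = 0 := by simp [primeMass]

lemma primeMass_sub (hp : Continuous p) {a b : ℝ} (ha : 0 ≤ a) (hab : a ≤ b) :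
    primeMass p b - primeMass p a = ∫ w in a..b, Real.exp w * p w := by
  have hc : Continuous fun w => Real.exp w * p w := Real.continuous_exp.mul hp
  rw [primeMass_of_nonneg ha, primeMass_of_nonneg (ha.trans hab),
    intervalIntegral.integral_interval_sub_left (hc.intervalIntegrable _ _)
      (hc.intervalIntegrable _ _)]

lemma primeMass_sub_le (hp : Continuous p) {a b c : ℝ} (ha : 0 ≤ a) (hab : a ≤ b)
    (h : ∀ w, a ≤ w → w ≤ b → p w ≤ c) :
    primeMass p b - primeMass p a ≤ c * (Real.exp b - Real.exp a) := by
  have hc : Continuous fun w => Real.exp w * p w := Real.continuous_exp.mul hp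
  rw [primeMass_sub hp ha hab, mul_comm, ← integral_exp, ← intervalIntegral.integral_mul_const]
  refine intervalIntegral.integral_mono_on hab (hc.intervalIntegrable _ _)
    ((Real.continuous_exp.mul continuous_const).intervalIntegrable _ _) fun w hw => ?_
  exact mul_le_mul_of_nonneg_left (h w hw.1 hw.2) (Real.exp_pos w).le

lemma le_primeMass_sub (hp : Continuous p) {a b c : ℝ} (ha : 0 ≤ a) (hab : a ≤ b)
    (h : ∀ w, a ≤ w → w ≤ b → c ≤ p w) :
    c * (Real.exp b - Real.exp a) ≤ primeMass p b - primeMass p a := by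
  have hc : Continuous fun w => Real.exp w * p w := Real.continuous_exp.mul hp
  rw [primeMass_sub hp ha hab, mul_comm, ← integral_exp, ← intervalIntegral.integral_mul_const]
  refine intervalIntegral.integral_mono_on hab
    ((Real.continuous_exp.mul continuous_const).intervalIntegrable _ _)
    (hc.intervalIntegrable _ _) fun w hw => ?_
  exact mul_le_mul_of_nonneg_left (h w hw.1 hw.2) (Real.exp_pos w).le

lemma primeMass_mono (hp : Continuous p) (hp0 : ∀ w, 0 ≤ w → 0 ≤ p w) :
    Monotone (primeMass p) := by
  intro a b hab
  have h : primeMass p (max b 0) - primeMass p (max a 0) ≥ 0 := by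
    have := le_primeMass_sub (c := 0) hp (le_max_right a 0) (max_le_max_right 0 hab)
      fun w hw _ => hp0 w ((le_max_right a 0).trans hw)
    linarith
  have hm : ∀ t, primeMass p (max t 0) = primeMass p t := fun t => by
    rw [primeMass, primeMass, max_assoc, max_self]
  rw [hm, hm] at h
  linarith

end primeMass

namespace BeurlingSystem

variable {S : BeurlingSystem} {p : ℝ → ℝ}

section shortInterval

variable (hp : Continuous p) (hp0 : ∀ w, 0 ≤ w → 0 ≤ p w ∧ p w ≤ 2)
  (hS : ∀ k : ℕ, (k : ℝ) ≤ primeMass p (Real.log (S.p k)) ∧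
    primeMass p (Real.log (S.p k)) ≤ k + 1)

include hp hp0 hS

lemma psi_short_le {v h C : ℝ} (hv : 1 ≤ v) (hh : 0 < h) (hhv : h ≤ Real.exp v)
    (hC : ∀ w, v ≤ w → w ≤ Real.log (Real.exp v + h) → w * p w ≤ C) :
    S.psi (Real.exp v + h) - S.psi (Real.exp v)
      ≤ (v + 1) * (C * h / v + 10 * Real.exp (v / 2)) := by
  have hmono := primeMass_mono hp fun w hw => (hp0 w hw).1
  have hx := Real.exp_pos v
  set y := Real.exp v + h with hy
  have hy0 : 0 < y := by positivity
  have hvy : v ≤ Real.log y := by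
    rw [Real.le_log_iff_exp_le hy0]; linarith
  have hyv : Real.log y ≤ v + 1 := by
    rw [Real.log_le_iff_le_exp hy0, Real.exp_add]
    nlinarith [Real.add_one_le_exp (1 : ℝ)]
  have h1 := S.psi_sub_le hx (by linarith : Real.exp v ≤ y)
  have h2 := S.ncard_primesIn_le hmono hS hx (by linarith : Real.exp v ≤ y)
  have hs0 : 1 ≤ Real.sqrt y := by
    rw [Real.one_le_sqrt]
    linarith [Real.add_one_le_exp v]
  have h3 := S.ncard_primesIn_le hmono hS one_pos hs0
  rw [Real.log_exp] at h2
  rw [Real.log_one] at h3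
  have h4 := primeMass_sub_le (c := C / v) hp (by linarith) hvy fun w hw1 hw2 => by
    rw [le_div_iff₀ (by linarith)]
    nlinarith [hC w hw1 hw2, (hp0 w (by linarith)).1]
  have h5 := primeMass_sub_le (c := 2) hp le_rfl (Real.log_nonneg hs0)
    fun w hw _ => (hp0 w hw).2
  rw [Real.exp_log hy0, show y - Real.exp v = h by rw [hy]; ring] at h4
  rw [Real.exp_log (by linarith), Real.exp_zero] at h5
  have hs : Real.sqrt y ≤ 2 * Real.exp (v / 2) := by
    refine Real.sqrt_le_iff.2 ⟨by positivity, ?_⟩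
    rw [mul_pow, ← Real.exp_nat_mul, show ((2 : ℕ) : ℝ) * (v / 2) = v by push_cast; ring]
    linarith
  have he : 1 ≤ Real.exp (v / 2) := Real.one_le_exp (by linarith)
  have h6 : ((S.primesIn (Real.exp v) y).ncard : ℝ) + (S.primesIn 1 (Real.sqrt y)).ncard
      ≤ C * h / v + 10 * Real.exp (v / 2) := by
    have : C / v * h = C * h / v := by ring
    linarith
  refine h1.trans (mul_le_mul hyv h6 (by positivity) (by linarith))

lemma le_psi_short {v h C : ℝ} (hv : 1 ≤ v) (hh : 0 < h) (hhv : h ≤ Real.exp v)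
    (hC : ∀ w, v ≤ w → w ≤ Real.log (Real.exp v + h) → C ≤ w * p w) :
    v * (C * h / (v + 1) - 3) ≤ S.psi (Real.exp v + h) - S.psi (Real.exp v) := by
  have hmono := primeMass_mono hp fun w hw => (hp0 w hw).1
  have hx := Real.exp_pos v
  set y := Real.exp v + h with hy
  have hy0 : 0 < y := by positivity
  have hvy : v ≤ Real.log y := by
    rw [Real.le_log_iff_exp_le hy0]; linarith
  have hyv : Real.log y ≤ v + 1 := by
    rw [Real.log_le_iff_le_exp hy0, Real.exp_add]
    nlinarith [Real.add_one_le_exp (1 : ℝ)]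
  have h1 := S.log_mul_le_psi_sub hx (by linarith : Real.exp v ≤ y)
  have hA0 : 0 ≤ primeMass p (Real.log (Real.exp v)) := by
    rw [Real.log_exp, ← primeMass_zero (p := p)]
    exact hmono (by linarith)
  have h2 := S.le_ncard_primesIn hmono hS hy0 hA0
  rw [Real.log_exp] at h1 h2
  have h4 := le_primeMass_sub (c := C / (v + 1)) hp (by linarith) hvy fun w hw1 hw2 => by
    rw [div_le_iff₀ (by linarith)]
    nlinarith [hC w hw1 hw2, (hp0 w (by linarith)).1]
  rw [Real.exp_log hy0, show y - Real.exp v = h by rw [hy]; ring] at h4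
  refine le_trans (mul_le_mul_of_nonneg_left ?_ (by linarith)) h1
  have : C / (v + 1) * h = C * h / (v + 1) := by ring
  linarith

end shortInterval

lemma density_pos {A K θ : ℝ} (hθ1 : θ < 1) (hp : Continuous p)
    (hp0 : ∀ w, 0 ≤ w → 0 ≤ p w ∧ p w ≤ 2) (hp1 : ∀ w, 1 ≤ w → 1 / 4 ≤ w * p w)
    (hS : ∀ k : ℕ, (k : ℝ) ≤ primeMass p (Real.log (S.p k)) ∧
      primeMass p (Real.log (S.p k)) ≤ k + 1)
    (hN : ∀ u, 0 ≤ u → |S.cnt (Real.exp u) - A * Real.exp u| ≤ K * Real.exp (θ * u)) :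
    0 < A := by
  by_contra! hA
  have hmono := primeMass_mono hp fun w hw => (hp0 w hw).1
  have key : ∀ u, 2 ≤ u → 1 / 8 ≤ u * (3 * Real.exp (-u) + K * Real.exp (-((1 - θ) * u))) := by
    intro u hu
    have h1 := S.ncard_primesIn_le_cnt 1 (Real.exp u)
    have h2 := S.le_ncard_primesIn hmono hS (x := 1) (Real.exp_pos u)
      (by rw [Real.log_one, primeMass_zero])
    rw [Real.log_exp, Real.log_one, primeMass_zero] at h2
    have h3 := le_primeMass_sub (c := 1 / (4 * u)) hp (by linarith : 0 ≤ u - 1)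
      (by linarith : u - 1 ≤ u) fun w hw1 hw2 => by
        have := hp1 w (by linarith)
        have := (hp0 w (by linarith)).1
        rw [div_le_iff₀ (by linarith)]
        nlinarith
    have h4 : 0 ≤ primeMass p (u - 1) := by
      rw [← primeMass_zero (p := p)]; exact hmono (by linarith)
    have h5 := (abs_le.1 (hN u (by linarith))).2
    have h6 : A * Real.exp u ≤ 0 := mul_nonpos_of_nonpos_of_nonneg hA (Real.exp_pos u).le
    have h7 : Real.exp (u - 1) ≤ Real.exp u / 2 := by
      rw [Real.exp_sub]
      exact div_le_div_of_nonneg_left (Real.exp_pos u).le two_pos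
        (by linarith [Real.add_one_le_exp (1 : ℝ)])
    have h8 : 1 / (4 * u) * (Real.exp u / 2) ≤ 3 + K * Real.exp (θ * u) := by
      have : 1 / (4 * u) * (Real.exp u / 2) ≤ 1 / (4 * u) * (Real.exp u - Real.exp (u - 1)) :=
        mul_le_mul_of_nonneg_left (by linarith) (by positivity)
      linarith
    have h9 : Real.exp (θ * u) * Real.exp (-u) = Real.exp (-((1 - θ) * u)) := by
      rw [← Real.exp_add]; ring_nf
    have h10 : Real.exp u * Real.exp (-u) = 1 := by
      rw [← Real.exp_add, add_neg_cancel, Real.exp_zero]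
    have h11 := mul_le_mul_of_nonneg_right h8
      (by positivity : 0 ≤ u * Real.exp (-u))
    have h12 : 1 / (4 * u) * (Real.exp u / 2) * (u * Real.exp (-u)) = 1 / 8 := by
      have : u ≠ 0 := by linarith
      calc _ = 1 / 8 * (u / u) * (Real.exp u * Real.exp (-u)) := by field_simp; norm_num
        _ = 1 / 8 := by rw [h10, div_self this]; norm_num
    rw [h12] at h11
    calc _ ≤ _ := h11
      _ = u * (3 * Real.exp (-u) + K * (Real.exp (θ * u) * Real.exp (-u))) := by ring
      _ = _ := by rw [h9]
  have ht : Tendsto (fun u : ℝ => u * (3 * Real.exp (-u) + K * Real.exp (-((1 - θ) * u))))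
      atTop (𝓝 0) := by
    have := ((tendsto_mul_exp_neg_mul one_pos).const_mul 3).add
      ((tendsto_mul_exp_neg_mul (by linarith : 0 < 1 - θ)).const_mul K)
    simp only [mul_zero, add_zero, one_mul] at this
    refine this.congr fun u => by ring
  obtain ⟨u, h1, h2⟩ := ((ht.eventually (gt_mem_nhds (by norm_num : (0 : ℝ) < 1 / 8))).and
    (eventually_ge_atTop 2)).exists
  linarith [key u h2]

end BeurlingSystem

lemma tendsto_upper_ratio (C : ℝ) :
    Tendsto (fun v : ℝ => C * ((v + 1) / v) + 10 * ((v + 1) * Real.exp (-(3 / 10 * v))))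
      atTop (𝓝 C) := by
  have h1 : Tendsto (fun v : ℝ => (v + 1) / v) atTop (𝓝 1) := by
    have := (tendsto_inv_atTop_zero (𝕜 := ℝ)).const_add 1
    rw [add_zero] at this
    refine this.congr' ?_
    filter_upwards [eventually_gt_atTop 0] with v hv
    field_simp
  have h2 : Tendsto (fun v : ℝ => (v + 1) * Real.exp (-(3 / 10 * v))) atTop (𝓝 0) := by
    have h3 : Tendsto (fun v : ℝ => Real.exp (-(3 / 10 * v))) atTop (𝓝 0) :=
      Real.tendsto_exp_neg_atTop_nhds_zero.comp (tendsto_id.const_mul_atTop (by norm_num))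
    have := (tendsto_mul_exp_neg_mul (by norm_num : (0 : ℝ) < 3 / 10)).add h3
    rw [add_zero] at this
    exact this.congr fun v => by ring
  simpa using (h1.const_mul C).add (h2.const_mul 10)

lemma tendsto_lower_ratio (C : ℝ) :
    Tendsto (fun v : ℝ => C * (v / (v + 1)) - 3 * (v * Real.exp (-(4 / 5 * v))))
      atTop (𝓝 C) := by
  have h1 : Tendsto (fun v : ℝ => v / (v + 1)) atTop (𝓝 1) := by
    have h0 : Tendsto (fun v : ℝ => (v + 1)⁻¹) atTop (𝓝 0) :=
      tendsto_inv_atTop_zero.comp (tendsto_atTop_add_const_right _ _ tendsto_id)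
    have := h0.const_sub 1
    rw [sub_zero] at this
    refine this.congr' ?_
    filter_upwards [eventually_gt_atTop 0] with v hv
    field_simp
    ring
  simpa using (h1.const_mul C).sub
    ((tendsto_mul_exp_neg_mul (by norm_num : (0 : ℝ) < 4 / 5)).const_mul 3)

lemma log_exp_add_exp_le (lam v : ℝ) : Real.log (Real.exp v + Real.exp (lam * v))
    ≤ v + 2 * Real.exp (-((1 - lam) * v)) := by
  rw [Real.log_le_iff_le_exp (by positivity), Real.exp_add]
  have h1 : Real.exp (lam * v) = Real.exp v * Real.exp (-((1 - lam) * v)) := by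
    rw [← Real.exp_add]; ring_nf
  have h2 := Real.add_one_le_exp (2 * Real.exp (-((1 - lam) * v)))
  have h3 := Real.exp_pos (-((1 - lam) * v))
  rw [h1]
  nlinarith [Real.exp_pos v]

namespace BeurlingSystem

variable {S : BeurlingSystem} {p : ℝ → ℝ}

section ratio

variable (hp : Continuous p) (hp0 : ∀ w, 0 ≤ w → 0 ≤ p w ∧ p w ≤ 2)
  (hS : ∀ k : ℕ, (k : ℝ) ≤ primeMass p (Real.log (S.p k)) ∧
    primeMass p (Real.log (S.p k)) ≤ k + 1)
  {lam : ℝ} (hlam : 4 / 5 ≤ lam) (hlam1 : lam < 1)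

include hp hp0 hS hlam hlam1

lemma ratio_le {v C : ℝ} (hv : 1 ≤ v)
    (hC : ∀ w, v ≤ w → w ≤ v + 2 * Real.exp (-((1 - lam) * v)) → w * p w ≤ C) :
    (S.psi (Real.exp v + Real.exp (lam * v)) - S.psi (Real.exp v)) / Real.exp (lam * v)
      ≤ C * ((v + 1) / v) + 10 * ((v + 1) * Real.exp (-(3 / 10 * v))) := by
  have h1 := psi_short_le hp hp0 hS hv (Real.exp_pos (lam * v))
    (Real.exp_le_exp.2 (by nlinarith)) fun w hw1 hw2 =>
      hC w hw1 (hw2.trans (log_exp_add_exp_le lam v))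
  rw [div_le_iff₀ (Real.exp_pos _)]
  refine h1.trans ?_
  have h2 : Real.exp (v / 2) ≤ Real.exp (-(3 / 10 * v)) * Real.exp (lam * v) := by
    rw [← Real.exp_add]
    exact Real.exp_le_exp.2 (by nlinarith)
  have h3 : (v + 1) * (10 * Real.exp (v / 2))
      ≤ (v + 1) * (10 * (Real.exp (-(3 / 10 * v)) * Real.exp (lam * v))) := by gcongr
  calc _ = C * ((v + 1) / v) * Real.exp (lam * v) + (v + 1) * (10 * Real.exp (v / 2)) := by ring
    _ ≤ _ := by linarith

lemma le_ratio {v C : ℝ} (hv : 1 ≤ v)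
    (hC : ∀ w, v ≤ w → w ≤ v + 2 * Real.exp (-((1 - lam) * v)) → C ≤ w * p w) :
    C * (v / (v + 1)) - 3 * (v * Real.exp (-(4 / 5 * v))) ≤
      (S.psi (Real.exp v + Real.exp (lam * v)) - S.psi (Real.exp v)) / Real.exp (lam * v) := by
  have h1 := le_psi_short hp hp0 hS hv (Real.exp_pos (lam * v))
    (Real.exp_le_exp.2 (by nlinarith)) fun w hw1 hw2 =>
      hC w hw1 (hw2.trans (log_exp_add_exp_le lam v))
  rw [le_div_iff₀ (Real.exp_pos _)]
  refine le_trans ?_ h1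
  have h2 : 1 ≤ Real.exp (-(4 / 5 * v)) * Real.exp (lam * v) := by
    rw [← Real.exp_add]
    exact Real.one_le_exp (by nlinarith)
  have h3 : v * 3 * 1 ≤ v * 3 * (Real.exp (-(4 / 5 * v)) * Real.exp (lam * v)) := by gcongr
  calc _ = C * (v / (v + 1)) * Real.exp (lam * v)
        - v * 3 * (Real.exp (-(4 / 5 * v)) * Real.exp (lam * v)) := by ring
    _ ≤ C * (v / (v + 1)) * Real.exp (lam * v) - v * 3 * 1 := by linarith
    _ = _ := by ring

theorem exists_short_intervals (hp2 : ∀ w, w * p w ≤ 2)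
    (hosc : ∃ q > 0, ∀ ε : ℝ, (ε = 1 ∨ ε = -1) → ∀ X : ℝ, ∃ v, X ≤ v ∧ 0 ≤ v ∧
      ∀ w, v ≤ w → w ≤ v + 2 * Real.exp (-((1 - lam) * v)) → q ≤ ε * (w * p w - 1)) :
    ∃ x h : ℕ → ℝ, (∀ K, 0 < x K) ∧ (∀ K, 0 < h K) ∧ Tendsto x atTop atTop ∧
      (∃ c₁ c₂ : ℝ, 0 < c₁ ∧ c₁ ≤ c₂ ∧
        ∀ K, c₁ * x K ^ lam ≤ h K ∧ h K ≤ c₂ * x K ^ lam) ∧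
      1 < limsup (fun K => (S.psi (x K + h K) - S.psi (x K)) / h K) atTop ∧
      liminf (fun K => (S.psi (x K + h K) - S.psi (x K)) / h K) atTop < 1 := by
  obtain ⟨q, hq, hosc⟩ := hosc
  obtain ⟨V, hV⟩ := eventually_atTop.1 (((tendsto_upper_ratio 2).eventually
    (gt_mem_nhds (by norm_num : (2 : ℝ) < 3))).and
    (((tendsto_upper_ratio (1 - q)).eventually
      (gt_mem_nhds (by linarith : 1 - q < 1 - q / 2))).and
    (((tendsto_lower_ratio (1 + q)).eventually
      (lt_mem_nhds (by linarith : 1 + q / 2 < 1 + q))).and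
    ((tendsto_lower_ratio 0).eventually (lt_mem_nhds (by norm_num : (-1 : ℝ) < 0))))))
  have hε : ∀ K : ℕ, (if Even K then (1 : ℝ) else -1) = 1 ∨
      (if Even K then (1 : ℝ) else -1) = -1 := fun K => by split_ifs <;> simp
  choose v hvX hv0 hv using fun K : ℕ => hosc _ (hε K) (K + (|V| + 1))
  have hv1 : ∀ K, 1 ≤ v K := fun K => by
    linarith [hvX K, abs_nonneg V, (Nat.cast_nonneg K : (0 : ℝ) ≤ K)]
  have hvV : ∀ K, V ≤ v K := fun K => by
    linarith [hvX K, le_abs_self V, (Nat.cast_nonneg K : (0 : ℝ) ≤ K)]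
  have hvt : Tendsto v atTop atTop :=
    tendsto_atTop_mono (fun K => by linarith [hvX K, abs_nonneg V]) tendsto_natCast_atTop_atTop
  have hup : ∀ K, (S.psi (Real.exp (v K) + Real.exp (lam * v K)) - S.psi (Real.exp (v K)))
      / Real.exp (lam * v K) ≤ 3 := fun K =>
    (ratio_le hp hp0 hS hlam hlam1 (hv1 K) fun w _ _ => hp2 w).trans (hV _ (hvV K)).1.le
  have hlow : ∀ K, -1 ≤ (S.psi (Real.exp (v K) + Real.exp (lam * v K)) - S.psi (Real.exp (v K)))
      / Real.exp (lam * v K) := fun K =>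
    (hV _ (hvV K)).2.2.2.le.trans (le_ratio hp hp0 hS hlam hlam1 (hv1 K) fun w hw _ =>
      mul_nonneg ((hv0 K).trans hw) (hp0 w ((hv0 K).trans hw)).1)
  refine ⟨fun K => Real.exp (v K), fun K => Real.exp (lam * v K), fun K => Real.exp_pos _,
    fun K => Real.exp_pos _, Real.tendsto_exp_atTop.comp hvt, ⟨1, 1, one_pos, le_rfl, fun K => ?_⟩,
    ?_, ?_⟩
  · rw [← Real.exp_mul, one_mul, mul_comm]
    exact ⟨le_rfl, le_rfl⟩
  · refine lt_of_lt_of_le (by linarith : 1 < 1 + q / 2) (le_limsup_of_frequently_le ?_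
      (isBoundedUnder_of ⟨3, hup⟩))
    refine frequently_atTop.2 fun N => ⟨2 * N, by omega, ?_⟩
    refine (hV _ (hvV (2 * N))).2.2.1.le.trans
      (le_ratio hp hp0 hS hlam hlam1 (hv1 _) fun w hw1 hw2 => ?_)
    have := hv (2 * N) w hw1 hw2
    rw [if_pos (even_two_mul N)] at this
    linarith
  · refine lt_of_le_of_lt (liminf_le_of_frequently_le ?_ (isBoundedUnder_of ⟨-1, hlow⟩))
      (by linarith : 1 - q / 2 < 1)
    refine frequently_atTop.2 fun N => ⟨2 * N + 1, by omega, ?_⟩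
    refine (ratio_le hp hp0 hS hlam hlam1 (hv1 _) fun w hw1 hw2 => ?_).trans
      (hV _ (hvV (2 * N + 1))).2.1.le
    have := hv (2 * N + 1) w hw1 hw2
    rw [if_neg (Nat.not_even_iff_odd.2 (odd_two_mul_add_one N))] at this
    linarith

end ratio

end BeurlingSystem

/-- **Failure of the PNT in short intervals** (Proposition 4.3): for every
`θ ∈ (1/2, 1)` there is a Beurling system with `θ`-well-behaved integers such that
for every `λ ∈ [4/5, 1)` there are sequences `x_K → ∞`, `h_K ≍ x_K^λ` with
`limsup (ψ(x_K+h_K)-ψ(x_K))/h_K > 1` and `liminf (ψ(x_K+h_K)-ψ(x_K))/h_K < 1`. -/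
theorem beurling_pnt_short_intervals_fails
    (θ : ℝ) (hθ : 1 / 2 < θ) (hθ1 : θ < 1) :
    ∃ (S : BeurlingSystem) (A K₀ : ℝ), S.WellBehaved A θ K₀ ∧
      ∀ lam : ℝ, 4 / 5 ≤ lam → lam < 1 →
        ∃ x h : ℕ → ℝ,
          (∀ K, 0 < x K) ∧ (∀ K, 0 < h K) ∧
          Filter.Tendsto x Filter.atTop Filter.atTop ∧
          (∃ c₁ c₂ : ℝ, 0 < c₁ ∧ c₁ ≤ c₂ ∧
            ∀ K, c₁ * x K ^ lam ≤ h K ∧ h K ≤ c₂ * x K ^ lam) ∧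
          1 < Filter.limsup (fun K => (S.psi (x K + h K) - S.psi (x K)) / h K)
                Filter.atTop ∧
          Filter.liminf (fun K => (S.psi (x K + h K) - S.psi (x K)) / h K)
                Filter.atTop < 1 := by
  obtain ⟨n, p, A0, hn, hn0, hnA, hp, hp0, hp1, hp2, hmul, hosc⟩ := exists_template
  obtain ⟨m, hm⟩ := exists_nat_ge ((1 - θ) / ((θ - 1 / 2) / 2))
  rw [div_le_iff₀ (by linarith)] at hm
  set e : ℕ := 2 * (m + 1) with he
  have heR : (e : ℝ) = 2 * m + 2 := by rw [he]; push_cast; ring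
  have hd : Even e := even_two_mul _
  have hd2 : 2 ≤ e := by omega
  have hfact : Fact (1 ≤ (e : ℝ≥0∞)) :=
    ⟨by exact_mod_cast (by omega : 1 ≤ e)⟩
  have hm0 : (0 : ℝ) ≤ m := Nat.cast_nonneg m
  obtain ⟨S, B, hS1, hS2, hS3⟩ := exists_system (σ := (1 / 2 + θ) / 2)
    (κ := 1 - (1 / 2 + θ) / 2) hd hd2 (by linarith) (by linarith) (by ring) hn hn0 hnA hp hp0
    hp1 hmul
  obtain ⟨A, K, hK, hAK⟩ := exists_linear_asymptotics (r := 1 - θ) hd hd2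
    (by linarith) (by linarith) (by linarith) (by linarith)
    (by rw [heR]; nlinarith) S.cnt_mono (fun x => Nat.cast_nonneg _)
    (fun x hx => S.cnt_of_lt_one hx) hS3
  have hS : ∀ k : ℕ, (k : ℝ) ≤ primeMass p (Real.log (S.p k)) ∧
      primeMass p (Real.log (S.p k)) ≤ k + 1 := fun k => by
    rw [primeMass_of_nonneg (S.log_p_nonneg k)]
    exact ⟨hS1 k, hS2 k⟩
  rw [sub_sub_cancel] at hAK
  refine ⟨S, A, K, ⟨BeurlingSystem.density_pos hθ1 hp hp0 hp1 hS hAK, by linarith, hθ1, hK,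
    fun x hx => ?_⟩, fun lam hlam hlam1 => BeurlingSystem.exists_short_intervals hp hp0 hS hlam
      hlam1 hp2 (hosc lam hlam1)⟩
  have hx0 : 0 < x := one_pos.trans_le hx
  have := hAK (Real.log x) (Real.log_nonneg hx)
  rwa [Real.exp_log hx0, mul_comm θ, Real.exp_mul, Real.exp_log hx0] at this
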